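/- Let u_ε, for ε > 0, be solutions of Δu_ε = ε⁻²∇W(u_ε) in Ω with u_ε = g on ∂Ω, satisfying dist(u_ε(x),Γ) ≤ δ₁ for all x ∈ Ω, and let φ_ε be the global phase of u_ε, normalized so that ψ_ε := φ_ε − ζ vanishes on ∂Ω. Then the family {φ_ε} is bounded in W^{1,4}(Ω); moreover ∫_Ω |∇ψ_ε|⁴ → 0 as ε → 0. -/

import Mathlib

open Complex Metric MeasureTheory Filter Set Topology Bornology

noncomputable section

/-- The Laplacian of a map `u : ℂ → ℂ`, viewing `ℂ ≅ ℝ²`. -/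
def lapC (u : ℂ → ℂ) (x : ℂ) : ℂ :=
  fderiv ℝ (fun y => fderiv ℝ u y 1) x 1 +
    fderiv ℝ (fun y => fderiv ℝ u y Complex.I) x Complex.I

/-- The Laplacian of a function `h : ℂ → ℝ`. -/
def lapR (h : ℂ → ℝ) (x : ℂ) : ℝ :=
  fderiv ℝ (fun y => fderiv ℝ h y 1) x 1 +
    fderiv ℝ (fun y => fderiv ℝ h y Complex.I) x Complex.I

/-- `|∇u|²` for `u : ℂ → ℂ`. -/
def gradSq (u : ℂ → ℂ) (x : ℂ) : ℝ :=
  ‖fderiv ℝ u x 1‖ ^ 2 + ‖fderiv ℝ u x Complex.I‖ ^ 2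

/-- The gradient `∇W` of a potential `W : ℂ → ℝ`, as a point of `ℂ ≅ ℝ²`. -/
def gradW (W : ℂ → ℝ) (x : ℂ) : ℂ :=
  (fderiv ℝ W x 1 : ℂ) + (fderiv ℝ W x Complex.I : ℂ) * Complex.I

/-- The Ginzburg–Landau type energy `E_ε(u) = ∫_Ω [½|∇u|² + W(u)/ε²]`. -/
def energy (W : ℂ → ℝ) (Ω : Set ℂ) (ε : ℝ) (u : ℂ → ℂ) : ℝ :=
  ∫ x in Ω, ((1 / 2) * gradSq u x + W (u x) / ε ^ 2)

/-- `Γ` is a smooth simple closed curve of length `2π`, with (`2π`-periodic) arclength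
parametrization `τ` (so that the point `τ(e^{is})` of the paper is `τ s` here). -/
structure ArcParam (Γ : Set ℂ) (τ : ℝ → ℂ) : Prop where
  smooth : ContDiff ℝ (⊤ : ℕ∞) τ
  periodic : Function.Periodic τ (2 * Real.pi)
  arclength : ∀ s, ‖deriv τ s‖ = 1
  inj : ∀ s t : ℝ, τ s = τ t → ∃ k : ℤ, s - t = 2 * Real.pi * k
  srange : Set.range τ = Γ

/-- The hypotheses (h1)–(h5) on the potential `W`: smooth, nonnegative, vanishing exactly
on `Γ`, non-degenerate near `Γ`, and radially coercive outside `B_{R₀} ⊇ Γ`. -/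
structure PotentialHyp (Γ : Set ℂ) (W : ℂ → ℝ) (R₀ : ℝ) : Prop where
  smooth : ContDiff ℝ (⊤ : ℕ∞) W
  nonneg : ∀ z, 0 ≤ W z
  zeros : W ⁻¹' {0} = Γ
  nondeg : ∃ μ > 0, ∃ δ > 0, ∀ z : ℂ,
    Metric.infDist z Γ < δ → μ * Metric.infDist z Γ ^ 2 ≤ W z
  R0_large : ∀ z ∈ Γ, ‖z‖ < R₀
  coercive : ∀ z : ℂ, R₀ < ‖z‖ →
    0 ≤ (gradW W z).re * z.re + (gradW W z).im * z.im

/-- `u` is a (globally smooth) solution of `Δu = ε⁻² ∇W(u)` in `Ω`. -/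
def SolvesGL (W : ℂ → ℝ) (Ω : Set ℂ) (ε : ℝ) (u : ℂ → ℂ) : Prop :=
  ContDiff ℝ (⊤ : ℕ∞) u ∧ ∀ x ∈ Ω, lapC u x = (ε ^ 2)⁻¹ • gradW W (u x)

/-- The decomposition `u = τ(e^{iφ}) + t·n⃗(τ(e^{iφ}))` on the set `s`, where `t` is the
signed distance of `u` to `Γ` and `φ` is a (global) phase; the unit normal to `Γ` at `τ s`
is `i·τ'(s)`. -/
def PhaseDecomp (Γ : Set ℂ) (τ : ℝ → ℂ) (s : Set ℂ) (u : ℂ → ℂ) (t φ : ℂ → ℝ) : Prop :=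
  ContinuousOn t s ∧ ContinuousOn φ s ∧
    ∀ x ∈ s, u x = τ (φ x) + (t x : ℂ) * (Complex.I * deriv τ (φ x)) ∧
      |t x| = Metric.infDist (u x) Γ

/-- `γ` is an `L`-periodic arclength parametrization of the (smooth) boundary of `Ω`. -/
structure BoundaryParam (Ω : Set ℂ) (γ : ℝ → ℂ) (L : ℝ) : Prop where
  Lpos : 0 < L
  smooth : ContDiff ℝ (⊤ : ℕ∞) γ
  periodic : Function.Periodic γ L
  arclength : ∀ s, ‖deriv γ s‖ = 1
  inj : ∀ s t : ℝ, γ s = γ t → ∃ k : ℤ, s - t = L * k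
  srange : Set.range γ = frontier Ω

/-- `n` is the outward unit normal field along the boundary parametrization `γ` of `Ω`. -/
structure OutwardNormal (Ω : Set ℂ) (γ : ℝ → ℂ) (n : ℝ → ℂ) : Prop where
  unit : ∀ s, ‖n s‖ = 1
  orth : ∀ s, (n s).re * (deriv γ s).re + (n s).im * (deriv γ s).im = 0
  outward : ∀ s, ∀ᶠ r in nhdsWithin (0 : ℝ) (Set.Ioi (0 : ℝ)), γ s + Complex.ofReal r * n s ∉ closure Ω

/-- The maximum principle for the phase (Proposition 2.2) holds with constants `δ₁`, `m`:
for every critical point `u` of `E_ε` on a bounded simply connected domain `ω`, continuous on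
`closure ω` and with `dist(u,Γ) ≤ δ₁` there, the functions `φ ∓ m t²/2` attain their
min/max on `∂ω`. -/
def MaxPrinciple (Γ : Set ℂ) (τ : ℝ → ℂ) (W : ℂ → ℝ) (δ₁ m : ℝ) : Prop :=
  ∀ (ω : Set ℂ) (ε : ℝ) (u : ℂ → ℂ) (t φ : ℂ → ℝ),
    IsOpen ω → Bornology.IsBounded ω → ω.Nonempty → SimplyConnectedSpace ↥ω →
    0 < ε → ContDiffOn ℝ (⊤ : ℕ∞) u ω → ContinuousOn u (closure ω) →
    (∀ x ∈ ω, lapC u x = (ε ^ 2)⁻¹ • gradW W (u x)) →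
    (∀ x ∈ closure ω, Metric.infDist (u x) Γ ≤ δ₁) →
    PhaseDecomp Γ τ (closure ω) u t φ →
    sInf ((fun x => φ x - m * t x ^ 2 / 2) '' closure ω) =
        sInf ((fun x => φ x - m * t x ^ 2 / 2) '' frontier ω) ∧
      sSup ((fun x => φ x + m * t x ^ 2 / 2) '' closure ω) =
        sSup ((fun x => φ x + m * t x ^ 2 / 2) '' frontier ω)

lemma one_le_smooth : (1 : WithTop ℕ∞) ≤ ((⊤ : ℕ∞) : WithTop ℕ∞) := by
  exact_mod_cast (le_top : (1 : ℕ∞) ≤ ⊤)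

lemma two_le_smooth : (2 : WithTop ℕ∞) ≤ ((⊤ : ℕ∞) : WithTop ℕ∞) := by
  exact WithTop.coe_le_coe.2 (le_top : (2 : ℕ∞) ≤ ⊤)

lemma ContDiff.deriv_smooth {F : Type*} [NormedAddCommGroup F] [NormedSpace ℝ F] {V : ℝ → F}
    (hV : ContDiff ℝ (⊤ : ℕ∞) V) : ContDiff ℝ (⊤ : ℕ∞) (deriv V) :=
  (contDiff_infty_iff_deriv.1 hV).2

section Jets

variable {F G : Type*} [NormedAddCommGroup F] [NormedSpace ℝ F]
  [NormedAddCommGroup G] [NormedSpace ℝ G]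

/-- `f : ℝ → F` has value `v`, derivative `p` and second derivative `a` at `0`. -/
def HasJet (f : ℝ → F) (v p a : F) : Prop :=
  f 0 = v ∧ ∃ f' : ℝ → F, (∀ᶠ s in 𝓝 (0 : ℝ), HasDerivAt f (f' s) s) ∧ f' 0 = p ∧
    HasDerivAt f' a 0

lemma HasJet.unique {f : ℝ → F} {v p a v' p' a' : F} (h : HasJet f v p a)
    (h' : HasJet f v' p' a') : v = v' ∧ p = p' ∧ a = a' := by
  obtain ⟨h0, f1, h1, h2, h3⟩ := h
  obtain ⟨k0, g1, k1, k2, k3⟩ := h'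
  have heq : f1 =ᶠ[𝓝 0] g1 := by
    filter_upwards [h1, k1] with s hs ks using hs.unique ks
  refine ⟨h0.symm.trans k0, ?_, ?_⟩
  · rw [← h2, ← k2]; exact heq.self_of_nhds
  · exact h3.unique (k3.congr_of_eventuallyEq heq)

lemma HasJet.congr {f g : ℝ → F} {v p a : F} (h : HasJet f v p a) (hfg : f =ᶠ[𝓝 0] g) :
    HasJet g v p a := by
  obtain ⟨h0, f1, h1, h2, h3⟩ := h
  refine ⟨hfg.self_of_nhds ▸ h0, f1, ?_, h2, h3⟩
  filter_upwards [h1, hfg.eventuallyEq_nhds] with s hs hs'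
  exact hs.congr_of_eventuallyEq hs'.symm

lemma HasJet.hasDerivAt {f : ℝ → F} {v p a : F} (h : HasJet f v p a) : HasDerivAt f p 0 := by
  obtain ⟨h0, f1, h1, h2, h3⟩ := h
  exact h2 ▸ h1.self_of_nhds

lemma hasJet_const (c : F) : HasJet (fun _ => c) c 0 0 :=
  ⟨rfl, fun _ => 0, Eventually.of_forall fun s => hasDerivAt_const s c, rfl, hasDerivAt_const _ _⟩

lemma HasJet.add {f g : ℝ → F} {v p a v' p' a' : F} (h : HasJet f v p a)
    (h' : HasJet g v' p' a') : HasJet (fun s => f s + g s) (v + v') (p + p') (a + a') := by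
  obtain ⟨h0, f1, h1, h2, h3⟩ := h
  obtain ⟨k0, g1, k1, k2, k3⟩ := h'
  refine ⟨by simp only [h0, k0], fun s => f1 s + g1 s, ?_, by simp only [h2, k2], h3.add k3⟩
  filter_upwards [h1, k1] with s hs ks using hs.add ks

lemma HasJet.clm {f : ℝ → F} {v p a : F} (h : HasJet f v p a) (A : F →L[ℝ] G) :
    HasJet (fun s => A (f s)) (A v) (A p) (A a) := by
  obtain ⟨h0, f1, h1, h2, h3⟩ := h
  refine ⟨by simp only [h0], fun s => A (f1 s), ?_, by simp only [h2], A.hasFDerivAt.comp_hasDerivAt _ h3⟩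
  filter_upwards [h1] with s hs using A.hasFDerivAt.comp_hasDerivAt _ hs

lemma HasJet.neg {f : ℝ → F} {v p a : F} (h : HasJet f v p a) :
    HasJet (fun s => - f s) (-v) (-p) (-a) := by
  simpa using h.clm (-ContinuousLinearMap.id ℝ F)

lemma HasJet.sub {f g : ℝ → F} {v p a v' p' a' : F} (h : HasJet f v p a)
    (h' : HasJet g v' p' a') : HasJet (fun s => f s - g s) (v - v') (p - p') (a - a') := by
  simpa [sub_eq_add_neg] using h.add h'.neg

lemma HasJet.mul_alg {A : Type*} [NormedRing A] [NormedAlgebra ℝ A] {f g : ℝ → A}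
    {v p a v' p' a' : A} (h : HasJet f v p a) (h' : HasJet g v' p' a') :
    HasJet (fun s => f s * g s) (v * v') (v * p' + p * v') (v * a' + 2 * (p * p') + a * v') := by
  obtain ⟨h0, f1, h1, h2, h3⟩ := h
  obtain ⟨k0, g1, k1, k2, k3⟩ := h'
  refine ⟨by simp only [h0, k0], fun s => f s * g1 s + f1 s * g s, ?_, by simp only [h2, k2, h0, k0], ?_⟩
  · filter_upwards [h1, k1] with s hs ks
    exact (hs.mul ks).congr_deriv (add_comm _ _)
  · have := (h1.self_of_nhds.mul k3).add (h3.mul k1.self_of_nhds)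
    refine this.congr_deriv ?_
    rw [h0, k0, h2, k2, two_mul]; abel

lemma HasJet.mul {f g : ℝ → ℝ} {v p a v' p' a' : ℝ} (h : HasJet f v p a)
    (h' : HasJet g v' p' a') :
    HasJet (fun s => f s * g s) (v * v') (v * p' + p * v') (v * a' + 2 * (p * p') + a * v') :=
  h.mul_alg h'

lemma HasJet.cmul {f g : ℝ → ℂ} {v p a v' p' a' : ℂ} (h : HasJet f v p a)
    (h' : HasJet g v' p' a') :
    HasJet (fun s => f s * g s) (v * v') (v * p' + p * v') (v * a' + 2 * (p * p') + a * v') :=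
  h.mul_alg h'

lemma HasJet.cast {f g : ℝ → F} {v p a v' p' a' : F} (h : HasJet f v p a) (hf : ∀ s, f s = g s)
    (hv : v = v') (hp : p = p') (ha : a = a') : HasJet g v' p' a' := by
  obtain rfl : f = g := funext hf
  subst hv hp ha
  exact h

lemma hasJet_line_id {E : Type*} [NormedAddCommGroup E] [NormedSpace ℝ E] (y e : E) :
    HasJet (fun s : ℝ => y + s • e) y e 0 := by
  refine ⟨by simp, fun _ => e, Eventually.of_forall fun s => ?_, rfl, hasDerivAt_const _ _⟩
  simpa using ((hasDerivAt_id s).smul_const e).const_add y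

/-- Composition with a function of one real variable. -/
lemma HasJet.scomp {f : ℝ → ℝ} {v p a : ℝ} (h : HasJet f v p a) {V V' : ℝ → F} {c : F}
    (hV : ∀ᶠ r in 𝓝 v, HasDerivAt V (V' r) r) (hV' : HasDerivAt V' c v) :
    HasJet (fun s => V (f s)) (V v) (p • V' v) (a • V' v + p ^ 2 • c) := by
  obtain ⟨h0, f1, h1, h2, h3⟩ := h
  have hc : ContinuousAt f 0 := h1.self_of_nhds.continuousAt
  refine ⟨by simp only [h0], fun s => f1 s • V' (f s), ?_, by simp only [h2, h0], ?_⟩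
  · have : ∀ᶠ s in 𝓝 0, HasDerivAt V (V' (f s)) (f s) := by
      refine hc.eventually (p := fun r => HasDerivAt V (V' r) r) ?_
      rw [h0]; exact hV
    filter_upwards [h1, this] with s hs hs'
    exact hs'.scomp s hs
  · have h4 : HasDerivAt (fun s => V' (f s)) (f1 0 • c) 0 := by
      have : HasDerivAt V' c (f 0) := by simp only [h0]; exact hV'
      exact this.scomp 0 h1.self_of_nhds
    have := h3.smul h4
    refine this.congr_deriv ?_
    rw [h0, h2, smul_smul, add_comm, sq]

lemma HasJet.scomp_contDiff {f : ℝ → ℝ} {v p a : ℝ} (h : HasJet f v p a) {V : ℝ → F}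
    (hV : ContDiff ℝ (⊤ : ℕ∞) V) :
    HasJet (fun s => V (f s)) (V v) (p • deriv V v) (a • deriv V v + p ^ 2 • deriv (deriv V) v) := by
  refine h.scomp (Eventually.of_forall fun r => ?_) ?_
  · exact (hV.differentiable (by simp)).differentiableAt.hasDerivAt
  · exact (hV.deriv_smooth.differentiable (by simp)).differentiableAt.hasDerivAt

/-- Second directional derivative. -/
def dd {E : Type*} [NormedAddCommGroup E] [NormedSpace ℝ E] (h : E → F) (e x : E) : F :=
  fderiv ℝ (fun y => fderiv ℝ h y e) x e

lemma hasJet_line {E : Type*} [NormedAddCommGroup E] [NormedSpace ℝ E] {h : E → F} {x : E}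
    (hh : ContDiffAt ℝ 2 h x) (e : E) :
    HasJet (fun s : ℝ => h (x + s • e)) (h x) (fderiv ℝ h x e) (dd h e x) := by
  have hl : ∀ s : ℝ, HasDerivAt (fun s : ℝ => x + s • e) e s := by
    intro s
    simpa using ((hasDerivAt_id s).smul_const e).const_add x
  have hc : ContinuousAt (fun s : ℝ => x + s • e) 0 := (hl 0).continuousAt
  refine ⟨by simp, fun s => fderiv ℝ h (x + s • e) e, ?_, by simp, ?_⟩
  · have : ∀ᶠ y in 𝓝 x, ContDiffAt ℝ 2 h y := hh.eventually (by simp)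
    have : ∀ᶠ s in 𝓝 (0 : ℝ), ContDiffAt ℝ 2 h (x + s • e) := by
      apply hc.eventually; simpa using this
    filter_upwards [this] with s hs
    exact (hs.differentiableAt (by simp)).hasFDerivAt.comp_hasDerivAt s (hl s)
  · have h1 : ContDiffAt ℝ 1 (fderiv ℝ h) x := hh.fderiv_right (by norm_num)
    have h2 : DifferentiableAt ℝ (fun y => fderiv ℝ h y e) x :=
      (h1.differentiableAt (by simp)).clm_apply (differentiableAt_const e)
    have h3 : HasFDerivAt (fun y => fderiv ℝ h y e) (fderiv ℝ (fun y => fderiv ℝ h y e) x)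
      (x + (0 : ℝ) • e) := by simpa using h2.hasFDerivAt
    exact h3.comp_hasDerivAt (0 : ℝ) (hl 0)

lemma HasJet.nonpos_of_isLocalMax {f : ℝ → ℝ} {v p a : ℝ} (h : HasJet f v p a)
    (hmax : IsLocalMax f 0) : p = 0 ∧ a ≤ 0 := by
  have hp : p = 0 := hmax.hasDerivAt_eq_zero h.hasDerivAt
  refine ⟨hp, ?_⟩
  by_contra! ha
  have h' := h
  obtain ⟨h0, f1, h1, h2, h3⟩ := h'
  have hd : deriv f =ᶠ[𝓝 0] f1 := by
    filter_upwards [h1] with s hs using hs.deriv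
  have hmin : IsLocalMin f 0 := by
    apply isLocalMin_of_deriv_deriv_pos
    · rw [hd.deriv_eq, h3.deriv]; exact ha
    · rw [hd.self_of_nhds, h2, hp]
    · exact h1.self_of_nhds.continuousAt
  have hcst : (fun _ => v) =ᶠ[𝓝 0] f := by
    filter_upwards [hmin, hmax] with s hs hs'
    rw [← h0]; exact le_antisymm hs hs'
  have := (h.unique ((hasJet_const v).congr hcst)).2.2
  linarith

lemma HasJet.nonneg_of_isLocalMin {f : ℝ → ℝ} {v p a : ℝ} (h : HasJet f v p a)
    (hmin : IsLocalMin f 0) : p = 0 ∧ 0 ≤ a := by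
  have := h.neg.nonpos_of_isLocalMax hmin.neg
  constructor <;> linarith [this.1, this.2]

end Jets

section Laplacian

lemma lapR_eq (h : ℂ → ℝ) (x : ℂ) : lapR h x = dd h 1 x + dd h I x := rfl

lemma lapC_eq (h : ℂ → ℂ) (x : ℂ) : lapC h x = dd h 1 x + dd h I x := rfl

lemma isLocalMax_line {h : ℂ → ℝ} {x : ℂ} (hmax : IsLocalMax h x) (e : ℂ) :
    IsLocalMax (fun s : ℝ => h (x + s • e)) 0 := by
  have hc : ContinuousAt (fun s : ℝ => x + s • e) 0 := by fun_prop
  have h2 : ∀ᶠ y in 𝓝 (x + (0 : ℝ) • e), h y ≤ h x := by simpa using (show ∀ᶠ y in 𝓝 x, h y ≤ h x from hmax)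
  have := hc.eventually h2
  simpa [IsLocalMax, IsMaxFilter] using this

/-- Uniqueness of the second order data along two lines at a point. -/
lemma dd_eq_of_hasJet {F : Type*} [NormedAddCommGroup F] [NormedSpace ℝ F] {h : ℂ → F} {x e : ℂ}
    {v p a : F} (hh : ContDiffAt ℝ 2 h x) (hj : HasJet (fun s : ℝ => h (x + s • e)) v p a) :
    fderiv ℝ h x e = p ∧ dd h e x = a :=
  ((hasJet_line hh e).unique hj).2

lemma lapR_nonpos_of_isLocalMax {h : ℂ → ℝ} {x : ℂ} (hh : ContDiffAt ℝ 2 h x)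
    (hmax : IsLocalMax h x) :
    fderiv ℝ h x 1 = 0 ∧ fderiv ℝ h x I = 0 ∧ lapR h x ≤ 0 := by
  have h1 := (hasJet_line hh 1).nonpos_of_isLocalMax (isLocalMax_line hmax 1)
  have h2 := (hasJet_line hh I).nonpos_of_isLocalMax (isLocalMax_line hmax I)
  rw [lapR_eq]
  exact ⟨h1.1, h2.1, by linarith [h1.2, h2.2]⟩

lemma dd_add {F : Type*} [NormedAddCommGroup F] [NormedSpace ℝ F] {f g : ℂ → F} {x : ℂ}
    (hf : ContDiffAt ℝ 2 f x) (hg : ContDiffAt ℝ 2 g x) (e : ℂ) :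
    dd (fun y => f y + g y) e x = dd f e x + dd g e x :=
  (dd_eq_of_hasJet (hf.add hg) ((hasJet_line hf e).add (hasJet_line hg e))).2

lemma dd_sub {F : Type*} [NormedAddCommGroup F] [NormedSpace ℝ F] {f g : ℂ → F} {x : ℂ}
    (hf : ContDiffAt ℝ 2 f x) (hg : ContDiffAt ℝ 2 g x) (e : ℂ) :
    dd (fun y => f y - g y) e x = dd f e x - dd g e x :=
  (dd_eq_of_hasJet (hf.sub hg) ((hasJet_line hf e).sub (hasJet_line hg e))).2

lemma lapR_add {f g : ℂ → ℝ} {x : ℂ} (hf : ContDiffAt ℝ 2 f x) (hg : ContDiffAt ℝ 2 g x) :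
    lapR (fun y => f y + g y) x = lapR f x + lapR g x := by
  simp only [lapR_eq, dd_add hf hg]; ring

lemma lapR_sub {f g : ℂ → ℝ} {x : ℂ} (hf : ContDiffAt ℝ 2 f x) (hg : ContDiffAt ℝ 2 g x) :
    lapR (fun y => f y - g y) x = lapR f x - lapR g x := by
  simp only [lapR_eq, dd_sub hf hg]; ring

lemma lapR_mul {f g : ℂ → ℝ} {x : ℂ} (hf : ContDiffAt ℝ 2 f x) (hg : ContDiffAt ℝ 2 g x) :
    lapR (fun y => f y * g y) x = f x * lapR g x + g x * lapR f x +
      2 * (fderiv ℝ f x 1 * fderiv ℝ g x 1 + fderiv ℝ f x I * fderiv ℝ g x I) := by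
  have h := fun e => (dd_eq_of_hasJet (hf.mul hg) ((hasJet_line hf e).mul (hasJet_line hg e))).2
  simp only [lapR_eq, h]; ring

lemma lapR_const_mul {f : ℂ → ℝ} {x : ℂ} (c : ℝ) (hf : ContDiffAt ℝ 2 f x) :
    lapR (fun y => c * f y) x = c * lapR f x := by
  rw [lapR_mul contDiffAt_const hf]
  simp [lapR]

/-- Chain rule for the Laplacian of a function of one variable. -/
lemma lapR_scomp {f : ℂ → ℝ} {x : ℂ} (hf : ContDiffAt ℝ 2 f x) {V : ℝ → ℝ}
    (hV : ContDiff ℝ (⊤ : ℕ∞) V) :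
    lapR (fun y => V (f y)) x = deriv V (f x) * lapR f x +
      deriv (deriv V) (f x) * (fderiv ℝ f x 1 ^ 2 + fderiv ℝ f x I ^ 2) := by
  have hVf : ContDiffAt ℝ 2 (fun y => V (f y)) x :=
    (hV.of_le two_le_smooth).contDiffAt.comp x hf
  have h := fun e => (dd_eq_of_hasJet hVf ((hasJet_line hf e).scomp_contDiff hV)).2
  simp only [lapR_eq, h, smul_eq_mul]; ring

end Laplacian

section Newton

/-- A smooth radial cutoff, equal to one on the ball of radius `5`. -/
def kcut (y : ℂ) : ℝ := Real.smoothTransition (26 - ‖y‖ ^ 2)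

lemma kcut_contDiff : ContDiff ℝ (⊤ : ℕ∞) kcut :=
  Real.smoothTransition.contDiff.comp (contDiff_const.sub (contDiff_norm_sq ℝ))

lemma kcut_eq_one {y : ℂ} (hy : ‖y‖ ≤ 5) : kcut y = 1 :=
  Real.smoothTransition.one_of_one_le (by nlinarith [norm_nonneg y])

lemma kcut_eq_zero {y : ℂ} (hy : 6 ≤ ‖y‖) : kcut y = 0 :=
  Real.smoothTransition.zero_of_nonpos (by nlinarith [norm_nonneg y])

lemma kcut_abs_le (y : ℂ) : |kcut y| ≤ 1 := by
  rw [kcut, abs_of_nonneg (Real.smoothTransition.nonneg _)]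
  exact Real.smoothTransition.le_one _

lemma hasCompactSupport_of_kcut {F : Type*} [Zero F] {f : ℂ → F} (hf : ∀ y, 6 ≤ ‖y‖ → f y = 0) :
    HasCompactSupport f := by
  refine HasCompactSupport.intro (isCompact_closedBall (0 : ℂ) 6) fun y hy => hf y ?_
  simp only [mem_closedBall, dist_zero_right, not_le] at hy
  exact hy.le

lemma fderiv_kcut_eq_zero {y : ℂ} (hy : 6 ≤ ‖y‖) : fderiv ℝ kcut y = 0 := by
  have : y ∉ tsupport kcut ∨ y ∈ tsupport kcut := (em _).symm
  have hc : Continuous (fderiv ℝ kcut) := kcut_contDiff.continuous_fderiv (by simp)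
  have hmin : IsLocalMin kcut y := by
    refine Eventually.of_forall fun z => ?_
    rw [kcut_eq_zero hy]
    exact Real.smoothTransition.nonneg _
  exact hmin.fderiv_eq_zero

/-- The truncated, regularized logarithmic kernel. -/
def newtK (δ : ℝ) (y : ℂ) : ℝ := kcut y * (Real.log (‖y‖ ^ 2 + δ ^ 2) / 2)

/-- The gradient of the truncated, regularized logarithmic kernel. -/
def dnewtK (δ : ℝ) (y : ℂ) : ℂ →L[ℝ] ℝ :=
  (Real.log (‖y‖ ^ 2 + δ ^ 2) / 2) • fderiv ℝ kcut y +
    (kcut y / (‖y‖ ^ 2 + δ ^ 2)) • innerSL ℝ y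

lemma newtK_contDiff {δ : ℝ} (hδ : δ ≠ 0) : ContDiff ℝ (⊤ : ℕ∞) (newtK δ) := by
  refine kcut_contDiff.mul (ContDiff.div_const (ContDiff.log ?_ fun y => ?_) _)
  · exact (contDiff_norm_sq ℝ).add contDiff_const
  · positivity

lemma fderiv_newtK {δ : ℝ} (hδ : δ ≠ 0) : fderiv ℝ (newtK δ) = dnewtK δ := by
  ext1 y
  have h1 : HasFDerivAt (fun y : ℂ => ‖y‖ ^ 2 + δ ^ 2) ((2 : ℝ) • innerSL ℝ y) y := by
    have := (hasStrictFDerivAt_norm_sq (F := ℂ) y).hasFDerivAt.add_const (δ ^ 2)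
    refine this.congr_fderiv ?_
    ext x
    simp
    ring
  have h2 := h1.log (show ‖y‖ ^ 2 + δ ^ 2 ≠ 0 by positivity)
  have h3 : HasFDerivAt kcut (fderiv ℝ kcut y) y :=
    (kcut_contDiff.differentiable (by simp)).differentiableAt.hasFDerivAt
  have h4 := h3.mul (h2.mul_const (1 / 2))
  have h5 : HasFDerivAt (newtK δ) (dnewtK δ y) y := by
    have he : newtK δ = kcut * (fun y => Real.log (‖y‖ ^ 2 + δ ^ 2) * (1 / 2)) := by
      ext z; simp [newtK, div_eq_mul_inv]
    rw [he]
    refine h4.congr_fderiv ?_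
    ext x
    simp [dnewtK]
    ring
  exact h5.fderiv

lemma newtK_eq_zero (δ : ℝ) {y : ℂ} (hy : 6 ≤ ‖y‖) : newtK δ y = 0 := by
  simp [newtK, kcut_eq_zero hy]

lemma dnewtK_eq_zero (δ : ℝ) {y : ℂ} (hy : 6 ≤ ‖y‖) : dnewtK δ y = 0 := by
  simp [dnewtK, kcut_eq_zero hy, fderiv_kcut_eq_zero hy]

lemma measurable_newtK (δ : ℝ) : Measurable (newtK δ) := by
  have := kcut_contDiff.continuous.measurable
  unfold newtK
  fun_prop

lemma aesm_dnewtK (δ : ℝ) : AEStronglyMeasurable (dnewtK δ) volume := by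
  have h0 := kcut_contDiff.continuous.measurable
  have h1 : Continuous (fderiv ℝ kcut) := kcut_contDiff.continuous_fderiv (by simp)
  have h2 : AEStronglyMeasurable (fun y : ℂ => Real.log (‖y‖ ^ 2 + δ ^ 2) / 2) volume :=
    Measurable.aestronglyMeasurable (by fun_prop)
  have h3 : AEStronglyMeasurable (fun y : ℂ => kcut y / (‖y‖ ^ 2 + δ ^ 2)) volume :=
    Measurable.aestronglyMeasurable (by fun_prop)
  have h4 : Continuous (fun y : ℂ => innerSL ℝ y) := (innerSL ℝ (E := ℂ)).continuous
  exact (h2.smul h1.aestronglyMeasurable).add (h3.smul h4.aestronglyMeasurable)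

/-- An integrable function dominating the kernels. -/
def domK (y : ℂ) : ℝ := (ball (0 : ℂ) 6).indicator (fun y => 1 + ‖y‖⁻¹) y

lemma integrable_domK : Integrable domK := by
  have h : IntegrableOn (fun y : ℂ => ‖y‖⁻¹) (ball (0 : ℂ) 6) := by
    refine integrableOn_ball_of_norm_le_rpow (C := 1) (α := 1) (by simp) (by simp) ?_ ?_
    · refine Eventually.of_forall fun y => ?_
      simp [Real.rpow_neg_one]
    · exact Measurable.aestronglyMeasurable (by fun_prop)
  have h1 : IntegrableOn (fun _ : ℂ => (1 : ℝ)) (ball (0 : ℂ) 6) :=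
    integrableOn_const measure_ball_lt_top.ne
  exact (integrable_indicator_iff measurableSet_ball).2 (h1.add h)

lemma log_kernel_bound {δ : ℝ} (hδ : |δ| ≤ 1) {y : ℂ} (hy : ‖y‖ < 6) (hy0 : y ≠ 0) :
    |Real.log (‖y‖ ^ 2 + δ ^ 2) / 2| ≤ 19 * (1 + ‖y‖⁻¹) := by
  have hp : 0 < ‖y‖ := norm_pos_iff.2 hy0
  have hd : δ ^ 2 ≤ 1 := by rw [← sq_abs]; nlinarith [abs_nonneg δ]
  have h1 : Real.log (‖y‖ ^ 2 + δ ^ 2) ≤ 37 := by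
    have := Real.log_le_sub_one_of_pos (show 0 < ‖y‖ ^ 2 + δ ^ 2 by positivity)
    nlinarith
  have h2 : 1 - ‖y‖⁻¹ ≤ Real.log ‖y‖ := Real.one_sub_inv_le_log_of_pos hp
  have h3 : Real.log (‖y‖ ^ 2) ≤ Real.log (‖y‖ ^ 2 + δ ^ 2) :=
    Real.log_le_log (by positivity) (by nlinarith [sq_nonneg δ])
  rw [Real.log_pow] at h3
  push_cast at h3
  have h4 : 0 < ‖y‖⁻¹ := by positivity
  rw [abs_le]
  constructor <;> linarith

lemma newtK_bound {δ : ℝ} (hδ : |δ| ≤ 1) {y : ℂ} (hy0 : y ≠ 0) :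
    ‖newtK δ y‖ ≤ 19 * domK y := by
  by_cases hy : ‖y‖ < 6
  · have h := log_kernel_bound hδ hy hy0
    have : domK y = 1 + ‖y‖⁻¹ := by simp [domK, hy]
    rw [this, newtK, Real.norm_eq_abs, abs_mul]
    calc _ ≤ 1 * _ := mul_le_mul_of_nonneg_right (kcut_abs_le y) (abs_nonneg _)
      _ ≤ _ := by rw [one_mul]; exact h
  · have : domK y = 0 := by simp [domK, hy]
    simp [newtK_eq_zero δ (not_lt.1 hy), this]

lemma exists_dnewtK_bound : ∃ C, ∀ δ : ℝ, |δ| ≤ 1 → ∀ y : ℂ, y ≠ 0 → ‖dnewtK δ y‖ ≤ C * domK y := by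
  have h1 : Continuous (fderiv ℝ kcut) := kcut_contDiff.continuous_fderiv (by simp)
  obtain ⟨C, hC⟩ := h1.bounded_above_of_compact_support
    (hasCompactSupport_of_kcut fun y hy => fderiv_kcut_eq_zero hy)
  have hC0 : 0 ≤ C := (norm_nonneg _).trans (hC 0)
  refine ⟨19 * C + 1, fun δ hδ y hy0 => ?_⟩
  by_cases hy : ‖y‖ < 6
  · have h := log_kernel_bound hδ hy hy0
    have hp : 0 < ‖y‖ := norm_pos_iff.2 hy0
    have : domK y = 1 + ‖y‖⁻¹ := by simp [domK, hy]
    rw [this, dnewtK]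
    refine (norm_add_le _ _).trans ?_
    rw [norm_smul, norm_smul, innerSL_apply_norm, Real.norm_eq_abs, Real.norm_eq_abs]
    have h3 : |kcut y / (‖y‖ ^ 2 + δ ^ 2)| * ‖y‖ ≤ ‖y‖⁻¹ := by
      rw [abs_div, abs_of_pos (show 0 < ‖y‖ ^ 2 + δ ^ 2 by positivity), div_mul_eq_mul_div,
        div_le_iff₀ (by positivity), inv_mul_eq_div, le_div_iff₀ hp]
      nlinarith [kcut_abs_le y, sq_nonneg δ, sq_nonneg ‖y‖]
    have h4 : |Real.log (‖y‖ ^ 2 + δ ^ 2) / 2| * ‖fderiv ℝ kcut y‖ ≤ 19 * (1 + ‖y‖⁻¹) * C :=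
      mul_le_mul h (hC y) (norm_nonneg _) (by positivity)
    nlinarith
  · have : domK y = 0 := by simp [domK, hy]
    simp [dnewtK_eq_zero δ (not_lt.1 hy), this]

lemma integrable_newtK {δ : ℝ} (hδ : |δ| ≤ 1) : Integrable (newtK δ) := by
  refine (integrable_domK.const_mul 19).mono' (measurable_newtK δ).aestronglyMeasurable ?_
  filter_upwards [compl_mem_ae_iff.2 (measure_singleton (0 : ℂ))] with y hy
  exact newtK_bound hδ hy

lemma integrable_dnewtK {δ : ℝ} (hδ : |δ| ≤ 1) : Integrable (dnewtK δ) := by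
  obtain ⟨C, hC⟩ := exists_dnewtK_bound
  refine (integrable_domK.const_mul C).mono' (aesm_dnewtK δ) ?_
  filter_upwards [compl_mem_ae_iff.2 (measure_singleton (0 : ℂ))] with y hy
  exact hC δ hδ y hy

/-- A sequence of regularization parameters. -/
def regSeq (n : ℕ) : ℝ := 1 / ((n : ℝ) + 1)

lemma regSeq_pos (n : ℕ) : 0 < regSeq n := by unfold regSeq; positivity

lemma regSeq_le (n : ℕ) : |regSeq n| ≤ 1 := by
  rw [abs_of_pos (regSeq_pos n), regSeq, div_le_one (by positivity)]
  have : (0 : ℝ) ≤ n := n.cast_nonneg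
  linarith

lemma regSeq_tendsto : Tendsto regSeq atTop (𝓝 0) := tendsto_one_div_add_atTop_nhds_zero_nat

lemma tendsto_newtK : Tendsto (fun n => ∫ y, ‖newtK (regSeq n) y - newtK 0 y‖) atTop (𝓝 0) := by
  have h := tendsto_integral_of_dominated_convergence (μ := (volume : Measure ℂ))
    (F := fun n y => ‖newtK (regSeq n) y - newtK 0 y‖) (f := fun _ => (0 : ℝ))
    (fun y => 38 * domK y)
    (fun n => ((measurable_newtK _).sub (measurable_newtK _)).norm.aestronglyMeasurable)
    (integrable_domK.const_mul 38) (fun n => ?_) ?_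
  · simpa using h
  · filter_upwards [compl_mem_ae_iff.2 (measure_singleton (0 : ℂ))] with y hy
    rw [norm_norm]
    refine (norm_sub_le _ _).trans ?_
    linarith [newtK_bound (regSeq_le n) hy, newtK_bound (δ := 0) (by simp) hy]
  · filter_upwards [compl_mem_ae_iff.2 (measure_singleton (0 : ℂ))] with y hy
    have hp : 0 < ‖y‖ := norm_pos_iff.2 hy
    have hc : ContinuousAt (fun δ => newtK δ y) 0 := by
      unfold newtK
      refine continuousAt_const.mul (ContinuousAt.div_const (ContinuousAt.log (by fun_prop) ?_) _)
      positivity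
    have := (hc.tendsto.comp regSeq_tendsto).sub_const (newtK 0 y)
    simpa using this.norm

lemma tendsto_dnewtK : Tendsto (fun n => ∫ y, ‖dnewtK (regSeq n) y - dnewtK 0 y‖) atTop (𝓝 0) := by
  obtain ⟨C, hC⟩ := exists_dnewtK_bound
  have h := tendsto_integral_of_dominated_convergence (μ := (volume : Measure ℂ))
    (F := fun n y => ‖dnewtK (regSeq n) y - dnewtK 0 y‖) (f := fun _ => (0 : ℝ))
    (fun y => 2 * C * domK y)
    (fun n => ((aesm_dnewtK _).sub (aesm_dnewtK _)).norm)
    (integrable_domK.const_mul (2 * C)) (fun n => ?_) ?_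
  · simpa using h
  · filter_upwards [compl_mem_ae_iff.2 (measure_singleton (0 : ℂ))] with y hy
    rw [norm_norm]
    refine (norm_sub_le _ _).trans ?_
    linarith [hC _ (regSeq_le n) y hy, hC 0 (by simp) y hy]
  · filter_upwards [compl_mem_ae_iff.2 (measure_singleton (0 : ℂ))] with y hy
    have hp : 0 < ‖y‖ := norm_pos_iff.2 hy
    have hc : ContinuousAt (fun δ => dnewtK δ y) 0 := by
      unfold dnewtK
      refine ContinuousAt.add (ContinuousAt.smul (ContinuousAt.div_const
        (ContinuousAt.log (by fun_prop) ?_) _) continuousAt_const)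
        (ContinuousAt.smul (ContinuousAt.div (f := fun _ => kcut y)
          (g := fun δ : ℝ => ‖y‖ ^ 2 + δ ^ 2) continuousAt_const (by fun_prop) ?_)
          continuousAt_const)
      · positivity
      · positivity
    have := (hc.tendsto.comp regSeq_tendsto).sub_const (dnewtK 0 y)
    simpa using this.norm

end Newton

section Potential

open ContinuousLinearMap

lemma integrable_conv_integrand {E F' G : Type*} [NormedAddCommGroup E] [NormedSpace ℝ E]
    [NormedAddCommGroup F'] [NormedSpace ℝ F'] [NormedAddCommGroup G] [NormedSpace ℝ G]
    (A : E →L[ℝ] F' →L[ℝ] G) {k : ℂ → E} {f : ℂ → F'} (hk : Integrable k) (hf : Continuous f)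
    {M : ℝ} (hM : ∀ x, ‖f x‖ ≤ M) (x : ℂ) :
    Integrable (fun y => A (k y) (f (x - y))) := by
  refine (hk.norm.const_mul (‖A‖ * M)).mono' ?_ (Eventually.of_forall fun y => ?_)
  · have hm : Continuous fun y : ℂ => f (x - y) := by fun_prop
    exact A.aestronglyMeasurable_comp₂ hk.1 hm.aestronglyMeasurable
  · refine (A.le_opNorm₂ _ _).trans ?_
    have := mul_le_mul_of_nonneg_left (hM (x - y)) (by positivity : 0 ≤ ‖A‖ * ‖k y‖)
    linarith

lemma conv_sub_le {E F' G : Type*} [NormedAddCommGroup E] [NormedSpace ℝ E]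
    [NormedAddCommGroup F'] [NormedSpace ℝ F'] [NormedAddCommGroup G] [NormedSpace ℝ G]
    (A : E →L[ℝ] F' →L[ℝ] G) {k k' : ℂ → E} {f : ℂ → F'}
    (hk : Integrable k) (hk' : Integrable k') (hf : Continuous f)
    {M : ℝ} (hM : ∀ x, ‖f x‖ ≤ M) (x : ℂ) :
    ‖convolution k f A volume x - convolution k' f A volume x‖ ≤
      ‖A‖ * M * ∫ y, ‖k y - k' y‖ := by
  simp only [convolution]
  rw [← integral_sub (integrable_conv_integrand A hk hf hM x)
    (integrable_conv_integrand A hk' hf hM x), ← integral_const_mul]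
  refine norm_integral_le_of_norm_le ((hk.sub hk').norm.const_mul _)
    (Eventually.of_forall fun y => ?_)
  have : A (k y) (f (x - y)) - A (k' y) (f (x - y)) = A (k y - k' y) (f (x - y)) := by simp
  rw [this]
  refine (A.le_opNorm₂ _ _).trans ?_
  have := mul_le_mul_of_nonneg_left (hM (x - y)) (by positivity : 0 ≤ ‖A‖ * ‖k y - k' y‖)
  linarith

/-- The scalar multiplication pairing used for convolutions. -/
def smulL (F : Type*) [NormedAddCommGroup F] [NormedSpace ℝ F] : ℝ →L[ℝ] F →L[ℝ] F := lsmul ℝ ℝ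

@[simp] lemma smulL_apply {F : Type*} [NormedAddCommGroup F] [NormedSpace ℝ F] (r : ℝ) (z : F) :
    smulL F r z = r • z := rfl

/-- The truncated logarithmic potential. -/
def newtPot (f : ℂ → ℂ) : ℂ → ℂ := convolution (newtK 0) f (smulL ℂ) volume

lemma hasFDerivAt_newtPot {f : ℂ → ℂ} (hf : Continuous f) {M : ℝ} (hM : ∀ x, ‖f x‖ ≤ M) (x : ℂ) :
    HasFDerivAt (newtPot f) (convolution (dnewtK 0) f ((smulL ℂ).precompL ℂ) volume x) x := by
  refine hasFDerivAt_of_tendstoUniformly (𝕜 := ℝ) (l := atTop)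
    (f := fun n : ℕ => convolution (newtK (regSeq n)) f (smulL ℂ) volume)
    (f' := fun n => convolution (dnewtK (regSeq n)) f ((smulL ℂ).precompL ℂ) volume)
    (g' := convolution (dnewtK 0) f ((smulL ℂ).precompL ℂ) volume) ?_ ?_ ?_ x
  · rw [Metric.tendstoUniformly_iff]
    intro e he
    have h := tendsto_dnewtK.const_mul (‖(smulL ℂ).precompL ℂ‖ * M)
    rw [mul_zero] at h
    filter_upwards [h.eventually (gt_mem_nhds he)] with n hn y
    rw [dist_comm, dist_eq_norm]
    exact (conv_sub_le _ (integrable_dnewtK (regSeq_le n)) (integrable_dnewtK (by simp))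
      hf hM y).trans_lt hn
  · intro n y
    have h := (hasCompactSupport_of_kcut fun y hy => newtK_eq_zero (regSeq n) hy
      : HasCompactSupport (newtK (regSeq n))).hasFDerivAt_convolution_left (smulL ℂ)
      (μ := volume) ((newtK_contDiff (regSeq_pos n).ne').of_le one_le_smooth)
      hf.locallyIntegrable y
    rwa [fderiv_newtK (regSeq_pos n).ne'] at h
  · intro y
    rw [tendsto_iff_norm_sub_tendsto_zero]
    have h := tendsto_newtK.const_mul (‖smulL ℂ‖ * M)
    rw [mul_zero] at h
    refine squeeze_zero (fun _ => norm_nonneg _) (fun n => ?_) h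
    exact conv_sub_le _ (integrable_newtK (regSeq_le n)) (integrable_newtK (by simp)) hf hM y

lemma newtPot_contDiff {f : ℂ → ℂ} (hs : HasCompactSupport f) {n : ℕ} (hf : ContDiff ℝ n f) :
    ContDiff ℝ (n + 1) (newtPot f) := by
  obtain ⟨M, hM⟩ := hf.continuous.bounded_above_of_compact_support hs
  have h := hasFDerivAt_newtPot hf.continuous hM
  rw [contDiff_succ_iff_fderiv]
  refine ⟨fun x => (h x).differentiableAt, by simp, ?_⟩
  have : fderiv ℝ (newtPot f) = convolution (dnewtK 0) f ((smulL ℂ).precompL ℂ) volume := by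
    ext1 x; exact (h x).fderiv
  rw [this]
  exact hs.contDiff_convolution_right (n := n) _
    (integrable_dnewtK (by simp)).locallyIntegrable hf

lemma fderiv_conv_right {F : Type*} [NormedAddCommGroup F] [NormedSpace ℝ F]
    {k : ℂ → ℝ} {f : ℂ → F} (hk : LocallyIntegrable k)
    (hs : HasCompactSupport f) (hf : ContDiff ℝ 1 f) (e x : ℂ) :
    fderiv ℝ (convolution k f (smulL F) volume) x e =
      convolution k (fun y => fderiv ℝ f y e) (smulL F) volume x := by
  rw [(hs.hasFDerivAt_convolution_right (smulL F) hk hf x).fderiv,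
    convolution_precompR_apply _ hk (hs.fderiv ℝ) (hf.continuous_fderiv one_ne_zero)]

lemma HasCompactSupport.fderiv_dir {F : Type*} [NormedAddCommGroup F] [NormedSpace ℝ F]
    {f : ℂ → F} (hs : HasCompactSupport f) (e : ℂ) :
    HasCompactSupport fun y => fderiv ℝ f y e :=
  (hs.fderiv ℝ).comp_left (g := fun A : ℂ →L[ℝ] F => A e) rfl

lemma ContDiff.fderiv_dir {F : Type*} [NormedAddCommGroup F] [NormedSpace ℝ F]
    {f : ℂ → F} (hf : ContDiff ℝ (⊤ : ℕ∞) f) (e : ℂ) :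
    ContDiff ℝ (⊤ : ℕ∞) fun y => fderiv ℝ f y e :=
  (hf.fderiv_right (m := ((⊤ : ℕ∞) : WithTop ℕ∞)) (by simp)).clm_apply contDiff_const

lemma dd_conv_right {F : Type*} [NormedAddCommGroup F] [NormedSpace ℝ F]
    {k : ℂ → ℝ} {f : ℂ → F} (hk : LocallyIntegrable k)
    (hs : HasCompactSupport f) (hf : ContDiff ℝ (⊤ : ℕ∞) f) (e x : ℂ) :
    dd (convolution k f (smulL F) volume) e x = convolution k (dd f e) (smulL F) volume x := by
  have h1 : (fun y => fderiv ℝ (convolution k f (smulL F) volume) y e) =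
      convolution k (fun y => fderiv ℝ f y e) (smulL F) volume := by
    ext1 y; exact fderiv_conv_right hk hs (hf.of_le one_le_smooth) e y
  rw [dd, h1, fderiv_conv_right hk (hs.fderiv_dir e) ((hf.fderiv_dir e).of_le one_le_smooth)]
  rfl

lemma convolution_smul_comm (k : ℂ → ℝ) (f : ℂ → ℂ) :
    convolution k f (smulL ℂ) volume = convolution f k (smulL ℂ).flip volume :=
  (convolution_flip _).symm

lemma fderiv_conv_left {k : ℂ → ℝ} {f : ℂ → ℂ} (hs : HasCompactSupport k) (hk : ContDiff ℝ 1 k)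
    (hf : LocallyIntegrable f) (e x : ℂ) :
    fderiv ℝ (convolution k f (smulL ℂ) volume) x e =
      convolution (fun y => fderiv ℝ k y e) f (smulL ℂ) volume x := by
  rw [convolution_smul_comm, convolution_smul_comm,
    (hs.hasFDerivAt_convolution_right (smulL ℂ).flip hf hk x).fderiv,
    convolution_precompR_apply _ hf (hs.fderiv ℝ) (hk.continuous_fderiv one_ne_zero)]

lemma dd_conv_left {k : ℂ → ℝ} {f : ℂ → ℂ} (hs : HasCompactSupport k)
    (hk : ContDiff ℝ (⊤ : ℕ∞) k) (hf : LocallyIntegrable f) (e x : ℂ) :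
    dd (convolution k f (smulL ℂ) volume) e x = convolution (dd k e) f (smulL ℂ) volume x := by
  have h1 : (fun y => fderiv ℝ (convolution k f (smulL ℂ) volume) y e) =
      convolution (fun y => fderiv ℝ k y e) f (smulL ℂ) volume := by
    ext1 y; exact fderiv_conv_left hs (hk.of_le one_le_smooth) hf e y
  rw [dd, h1, fderiv_conv_left (hs.fderiv_dir e) ((hk.fderiv_dir e).of_le one_le_smooth) hf]
  rfl

lemma lapR_newtK {δ : ℝ} (hδ : δ ≠ 0) {y : ℂ} (hy : ‖y‖ < 5) :
    lapR (newtK δ) y = 2 * δ ^ 2 / (‖y‖ ^ 2 + δ ^ 2) ^ 2 := by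
  have key : ∀ e : ℂ, dd (newtK δ) e y =
      ‖e‖ ^ 2 / (‖y‖ ^ 2 + δ ^ 2) - 2 * inner ℝ y e ^ 2 / (‖y‖ ^ 2 + δ ^ 2) ^ 2 := by
    intro e
    have hD : ‖y‖ ^ 2 + δ ^ 2 ≠ 0 := by positivity
    have h0 := hasJet_line_id y e
    have hn : ∀ z : ℂ, ‖z‖ ^ 2 = z.re * z.re + z.im * z.im := fun z => by
      rw [← normSq_eq_norm_sq, normSq_apply]
    have h1 : HasJet (fun s : ℝ => ‖y + s • e‖ ^ 2 + δ ^ 2) (‖y‖ ^ 2 + δ ^ 2) (2 * inner ℝ y e)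
        (2 * ‖e‖ ^ 2) := by
      have hr := h0.clm reCLM
      have hi := h0.clm imCLM
      refine (((hr.mul hr).add (hi.mul hi)).add (hasJet_const (δ ^ 2))).cast ?_ ?_ ?_ ?_
      · intro s; rw [hn]; rfl
      · rw [hn]; rfl
      · simp [Complex.inner]; ring
      · rw [hn]; simp; ring
    have h2 : HasJet (fun s : ℝ => Real.log (‖y + s • e‖ ^ 2 + δ ^ 2))
        _ _ _ := h1.scomp (V := Real.log) (V' := fun r => r⁻¹)
          (c := -((‖y‖ ^ 2 + δ ^ 2) ^ 2)⁻¹) (by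
          filter_upwards [isOpen_ne.mem_nhds hD] with r hr using Real.hasDerivAt_log hr)
          (hasDerivAt_inv hD)
    have h3 := (hasJet_const (1 / 2 : ℝ)).mul h2
    have h4 : HasJet (fun s : ℝ => newtK δ (y + s • e)) _ _ _ := h3.congr (by
      have hc : ContinuousAt (fun s : ℝ => ‖y + s • e‖) 0 := by fun_prop
      have := hc.eventually (eventually_lt_nhds (b := 5) (by simpa using hy))
      filter_upwards [this] with s hs
      rw [newtK, kcut_eq_one hs.le]; ring)
    rw [(dd_eq_of_hasJet ((newtK_contDiff hδ).of_le two_le_smooth).contDiffAt h4).2]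
    simp only [smul_eq_mul]
    field_simp
    ring
  rw [lapR_eq, key, key]
  have h1 : inner ℝ y (1 : ℂ) = y.re := by simp [Complex.inner]
  have h2 : inner ℝ y I = y.im := by simp [Complex.inner]
  have h3 : ‖y‖ ^ 2 = y.re ^ 2 + y.im ^ 2 := by rw [← normSq_eq_norm_sq, normSq_apply]; ring
  have hD : ‖y‖ ^ 2 + δ ^ 2 ≠ 0 := by positivity
  rw [h1, h2]
  simp only [norm_one, norm_I]
  field_simp
  rw [h3]; ring

/-- The mass of the fundamental solution. -/
def massK : ℝ := ∫ z : ℂ, 2 / (1 + ‖z‖ ^ 2) ^ 2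

lemma integrable_massK : Integrable fun z : ℂ => 2 / (1 + ‖z‖ ^ 2) ^ 2 := by
  have h := integrable_rpow_neg_one_add_norm_sq (μ := (volume : Measure ℂ)) (r := 4) (by simp; norm_num)
  refine (h.const_mul 2).congr (Eventually.of_forall fun z => ?_)
  have : (1 + ‖z‖ ^ 2) ^ (-(4 : ℝ) / 2) = ((1 + ‖z‖ ^ 2) ^ 2)⁻¹ := by
    rw [show (-(4 : ℝ) / 2) = -((2 : ℕ) : ℝ) by norm_num, Real.rpow_neg (by positivity),
      Real.rpow_natCast]
  simp only [this]
  rw [div_eq_mul_inv]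

lemma massK_pos : 0 < massK := by
  rw [massK, integral_pos_iff_support_of_nonneg (fun z => by positivity) integrable_massK]
  have : Function.support (fun z : ℂ => 2 / (1 + ‖z‖ ^ 2) ^ 2) = univ := by
    ext z
    simp only [Function.mem_support, mem_univ, iff_true]
    positivity
  rw [this]; simp

lemma tendsto_approx_identity {f : ℂ → ℂ} (hf : Continuous f) {M : ℝ} (hM : ∀ x, ‖f x‖ ≤ M)
    (x : ℂ) :
    Tendsto (fun n => ∫ y : ℂ, (2 * regSeq n ^ 2 / (‖y‖ ^ 2 + regSeq n ^ 2) ^ 2) • f (x - y))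
      atTop (𝓝 (massK • f x)) := by
  have h1 : ∀ n, ∫ y : ℂ, (2 * regSeq n ^ 2 / (‖y‖ ^ 2 + regSeq n ^ 2) ^ 2) • f (x - y) =
      ∫ z : ℂ, (2 / (1 + ‖z‖ ^ 2) ^ 2) • f (x - regSeq n • z) := by
    intro n
    have hp := regSeq_pos n
    have := Measure.integral_comp_smul (volume : Measure ℂ)
      (fun y => (2 * regSeq n ^ 2 / (‖y‖ ^ 2 + regSeq n ^ 2) ^ 2) • f (x - y)) (regSeq n)
    simp only [Complex.finrank_real_complex] at this
    rw [abs_of_pos (by positivity)] at this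
    rw [← inv_smul_smul₀ (show (regSeq n ^ 2)⁻¹ ≠ 0 by positivity)
      (∫ y : ℂ, (2 * regSeq n ^ 2 / (‖y‖ ^ 2 + regSeq n ^ 2) ^ 2) • f (x - y)), ← this, inv_inv,
      ← integral_smul]
    congr 1
    ext1 z
    rw [smul_smul]
    congr 1
    rw [norm_smul, Real.norm_of_nonneg hp.le]
    field_simp
    ring
  simp only [h1]
  rw [massK, ← integral_smul_const]
  refine tendsto_integral_of_dominated_convergence (fun z => 2 / (1 + ‖z‖ ^ 2) ^ 2 * M)
    (fun n => ?_) (integrable_massK.mul_const M) (fun n => ?_) ?_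
  · have h2 : Continuous fun z : ℂ => f (x - regSeq n • z) := by fun_prop
    exact integrable_massK.1.smul h2.aestronglyMeasurable
  · refine Eventually.of_forall fun z => ?_
    rw [norm_smul, Real.norm_of_nonneg (by positivity)]
    exact mul_le_mul_of_nonneg_left (hM _) (by positivity)
  · refine Eventually.of_forall fun z => ?_
    refine Tendsto.const_smul ?_ _
    have h2 : Continuous fun d : ℝ => f (x - d • z) := by fun_prop
    have h3 := (h2.tendsto 0).comp regSeq_tendsto
    rw [zero_smul, sub_zero] at h3
    exact h3

lemma lapC_newtPot {f : ℂ → ℂ} (hf : ContDiff ℝ (⊤ : ℕ∞) f) (hs : ∀ y, 2 ≤ ‖y‖ → f y = 0)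
    {x : ℂ} (hx : ‖x‖ < 1) : lapC (newtPot f) x = massK • f x := by
  have hsc : HasCompactSupport f := hasCompactSupport_of_kcut fun y hy => hs y (by linarith)
  obtain ⟨M, hM⟩ := hf.continuous.bounded_above_of_compact_support hsc
  have hcl : Continuous (lapC f) :=
    ((hf.fderiv_dir 1).fderiv_dir 1).continuous.add ((hf.fderiv_dir I).fderiv_dir I).continuous
  have hdd : ∀ e, Continuous (dd f e) := fun e => ((hf.fderiv_dir e).fderiv_dir e).continuous
  have hddM : ∀ e, ∃ M, ∀ y, ‖dd f e y‖ ≤ M := fun e =>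
    (hdd e).bounded_above_of_compact_support ((hsc.fderiv_dir e).fderiv_dir e)
  have hlap : ∀ k : ℂ → ℝ, Integrable k → lapC (convolution k f (smulL ℂ) volume) x =
      convolution k (lapC f) (smulL ℂ) volume x := by
    intro k hk
    rw [lapC_eq, dd_conv_right hk.locallyIntegrable hsc hf,
      dd_conv_right hk.locallyIntegrable hsc hf]
    simp only [convolution]
    rw [← integral_add]
    · congr 1; ext1 y; rw [lapC_eq, map_add]
    · obtain ⟨M1, h1⟩ := hddM 1
      exact integrable_conv_integrand _ hk (hdd 1) h1 x
    · obtain ⟨M1, h1⟩ := hddM I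
      exact integrable_conv_integrand _ hk (hdd I) h1 x
  have hlapM : ∃ M, ∀ y, ‖lapC f y‖ ≤ M := by
    obtain ⟨M1, h1⟩ := hddM 1
    obtain ⟨M2, h2⟩ := hddM I
    exact ⟨M1 + M2, fun y => (norm_add_le _ _).trans (add_le_add (h1 y) (h2 y))⟩
  obtain ⟨M', hM'⟩ := hlapM
  have hleft : ∀ n, lapC (convolution (newtK (regSeq n)) f (smulL ℂ) volume) x =
      ∫ y : ℂ, (2 * regSeq n ^ 2 / (‖y‖ ^ 2 + regSeq n ^ 2) ^ 2) • f (x - y) := by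
    intro n
    have hk := newtK_contDiff (regSeq_pos n).ne'
    have hks : HasCompactSupport (newtK (regSeq n)) :=
      hasCompactSupport_of_kcut fun y hy => newtK_eq_zero _ hy
    have hkI : ∀ e, Integrable (dd (newtK (regSeq n)) e) := fun e =>
      ((hk.fderiv_dir e).fderiv_dir e).continuous.integrable_of_hasCompactSupport
        ((hks.fderiv_dir e).fderiv_dir e)
    rw [lapC_eq, dd_conv_left hks hk hf.continuous.locallyIntegrable,
      dd_conv_left hks hk hf.continuous.locallyIntegrable]
    simp only [convolution]
    rw [← integral_add (integrable_conv_integrand _ (hkI 1) hf.continuous hM x)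
      (integrable_conv_integrand _ (hkI I) hf.continuous hM x)]
    congr 1
    ext1 y
    by_cases hy : ‖y‖ < 5
    · rw [← lapR_newtK (regSeq_pos n).ne' hy, lapR_eq]
      simp [add_smul]
    · have : f (x - y) = 0 := by
        apply hs
        have := norm_sub_norm_le y x
        rw [norm_sub_rev] at this
        linarith
      simp [this]
  have hlim1 := tendsto_approx_identity hf.continuous hM x
  have hlim2 : Tendsto (fun n => convolution (newtK (regSeq n)) (lapC f) (smulL ℂ) volume x) atTop
      (𝓝 (convolution (newtK 0) (lapC f) (smulL ℂ) volume x)) := by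
    rw [tendsto_iff_norm_sub_tendsto_zero]
    have h := tendsto_newtK.const_mul (‖smulL ℂ‖ * M')
    rw [mul_zero] at h
    refine squeeze_zero (fun _ => norm_nonneg _) (fun n => ?_) h
    exact conv_sub_le _ (integrable_newtK (regSeq_le n)) (integrable_newtK (by simp)) hcl hM' x
  have : ∀ n, convolution (newtK (regSeq n)) (lapC f) (smulL ℂ) volume x =
      ∫ y : ℂ, (2 * regSeq n ^ 2 / (‖y‖ ^ 2 + regSeq n ^ 2) ^ 2) • f (x - y) := fun n => by
    rw [← hleft n, hlap _ (integrable_newtK (regSeq_le n))]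
  simp only [this] at hlim2
  rw [newtPot, hlap _ (integrable_newtK (by simp))]
  exact tendsto_nhds_unique hlim2 hlim1

end Potential

section LocalSolution

/-- A smooth cutoff, equal to one on the unit ball and supported in the ball of radius `2`. -/
def ucut (x : ℂ) : ℝ := Real.smoothTransition (2 - ‖x‖ ^ 2)

lemma ucut_contDiff : ContDiff ℝ (⊤ : ℕ∞) ucut :=
  Real.smoothTransition.contDiff.comp (contDiff_const.sub (contDiff_norm_sq ℝ))

lemma ucut_eq_one {y : ℂ} (hy : ‖y‖ ≤ 1) : ucut y = 1 :=
  Real.smoothTransition.one_of_one_le (by nlinarith [norm_nonneg y])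

lemma ucut_eq_zero {y : ℂ} (hy : 2 ≤ ‖y‖) : ucut y = 0 :=
  Real.smoothTransition.zero_of_nonpos (by nlinarith [norm_nonneg y])

lemma ucut_abs_le (y : ℂ) : |ucut y| ≤ 1 := by
  rw [ucut, abs_of_nonneg (Real.smoothTransition.nonneg _)]
  exact Real.smoothTransition.le_one _

lemma hasCompactSupport_ucut_smul (h : ℂ → ℂ) : HasCompactSupport fun x => ucut x • h x :=
  hasCompactSupport_of_kcut fun y hy => by simp [ucut_eq_zero (by linarith : (2 : ℝ) ≤ ‖y‖)]

lemma newtPot_sub_le {f g : ℂ → ℂ} (hf : Continuous f) (hg : Continuous g) {M N : ℝ}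
    (hfM : ∀ x, ‖f x‖ ≤ N) (hgM : ∀ x, ‖g x‖ ≤ N) (hM : ∀ x, ‖f x - g x‖ ≤ M) (x : ℂ) :
    ‖newtPot f x - newtPot g x‖ ≤ M * ∫ y, ‖newtK 0 y‖ := by
  have hk := integrable_newtK (δ := 0) (by simp)
  simp only [newtPot, convolution]
  rw [← integral_sub (integrable_conv_integrand _ hk hf hfM x)
    (integrable_conv_integrand _ hk hg hgM x), ← integral_const_mul]
  refine norm_integral_le_of_norm_le (hk.norm.const_mul _) (Eventually.of_forall fun y => ?_)
  rw [smulL_apply, smulL_apply, ← smul_sub, norm_smul, mul_comm]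
  exact mul_le_mul_of_nonneg_right (hM _) (norm_nonneg _)

lemma newtPot_zero : newtPot (fun _ => 0) = fun _ => 0 := by
  ext x; simp [newtPot, convolution]

/-- Local solvability of `Δu = ΔB + λ (F(u) - F(z₀))` near a given smooth map `B`. -/
theorem exists_local_solution {F : ℂ → ℂ} (hF : ContDiff ℝ (⊤ : ℕ∞) F) {K : NNReal}
    (hK : LipschitzWith K F) :
    ∃ C > 0, ∃ l₀ > 0, ∀ l : ℝ, 0 < l → l ≤ l₀ → ∀ B : ℂ → ℂ, ContDiff ℝ (⊤ : ℕ∞) B →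
      ∀ (z₀ : ℂ) (M : ℝ), (∀ x, ‖x‖ ≤ 2 → ‖B x - z₀‖ ≤ M) →
      ∃ u : ℂ → ℂ, ContDiff ℝ (⊤ : ℕ∞) u ∧ (∀ x, ‖u x - B x‖ ≤ C * l * M) ∧
        ∀ x, ‖x‖ < 1 → lapC u x = lapC B x + l • (F (u x) - F z₀) := by
  set c := massK with hc
  have hc0 : 0 < c := massK_pos
  set S := ∫ y, ‖newtK 0 y‖ with hS
  have hS0 : 0 ≤ S := integral_nonneg fun _ => norm_nonneg _
  have hK0 : (0 : ℝ) ≤ K := K.2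
  refine ⟨2 * c⁻¹ * (K * S + 1), by positivity, c / (2 * (K * S + 1)), by positivity,
    fun l hl hl0 B hB z₀ M hM => ?_⟩
  have hM0 : 0 ≤ M := (norm_nonneg _).trans (hM 0 (by simp))
  have hlS : l * c⁻¹ * (K * S) ≤ 1 / 2 := by
    rw [le_div_iff₀ (by positivity)] at hl0
    rw [mul_assoc, ← div_eq_inv_mul, ← mul_div_assoc, div_le_iff₀ hc0]
    nlinarith
  -- the source term
  let f : (BoundedContinuousFunction ℂ ℂ) → ℂ → ℂ := fun v x => ucut x • (F (B x + v x) - F z₀)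
  have hfc : ∀ v, Continuous (f v) := fun v => ucut_contDiff.continuous.smul
    ((hF.continuous.comp (hB.continuous.add v.continuous)).sub continuous_const)
  have hfs : ∀ v, HasCompactSupport (f v) := fun v => hasCompactSupport_ucut_smul _
  have hfb : ∀ v, ∃ N, ∀ x, ‖f v x‖ ≤ N := fun v =>
    (hfc v).bounded_above_of_compact_support (hfs v)
  have hTc : ∀ v, ContDiff ℝ 1 (newtPot (f v)) := fun v => by
    have := newtPot_contDiff (hfs v) (n := 0) (by exact_mod_cast contDiff_zero.2 (hfc v))
    simpa using this
  let g : (BoundedContinuousFunction ℂ ℂ) → ℂ → ℂ := fun v x =>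
    ucut x • (l * c⁻¹) • newtPot (f v) x
  have hgc : ∀ v, Continuous (g v) := fun v => by
    have h1 := (hTc v).continuous
    have h2 := ucut_contDiff.continuous
    simp only [g]
    fun_prop
  have hgb : ∀ v, ∃ N, ∀ x, ‖g v x‖ ≤ N := fun v =>
    (hgc v).bounded_above_of_compact_support (hasCompactSupport_ucut_smul _)
  choose N hN using hgb
  let T : (BoundedContinuousFunction ℂ ℂ) → (BoundedContinuousFunction ℂ ℂ) := fun v =>
    BoundedContinuousFunction.ofNormedAddCommGroup (g v) (hgc v) (N v) (hN v)
  have hfl : ∀ v w x, ‖f v x - f w x‖ ≤ K * dist v w := by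
    intro v w x
    simp only [f]
    rw [← smul_sub, norm_smul, sub_sub_sub_cancel_right]
    have h1 := hK.dist_le_mul (B x + v x) (B x + w x)
    rw [dist_add_left, dist_eq_norm] at h1
    have h2 := BoundedContinuousFunction.dist_coe_le_dist (f := v) (g := w) x
    calc _ ≤ 1 * (K * dist v w) := mul_le_mul (ucut_abs_le x)
          (h1.trans (mul_le_mul_of_nonneg_left h2 hK0)) (norm_nonneg _) zero_le_one
      _ = _ := one_mul _
  have hgl : ∀ v w x, ‖g v x - g w x‖ ≤ 1 / 2 * dist v w := by
    intro v w x
    obtain ⟨N1, h1⟩ := hfb v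
    obtain ⟨N2, h2⟩ := hfb w
    have h3 := newtPot_sub_le (hfc v) (hfc w) (fun x => (h1 x).trans (le_max_left N1 N2))
      (fun x => (h2 x).trans (le_max_right N1 N2)) (hfl v w) x
    simp only [g]
    rw [← smul_sub, ← smul_sub, norm_smul, norm_smul, Real.norm_of_nonneg (by positivity : 0 ≤ l * c⁻¹)]
    calc _ ≤ 1 * (l * c⁻¹ * (K * dist v w * S)) := mul_le_mul (ucut_abs_le x)
          (mul_le_mul_of_nonneg_left h3 (by positivity)) (by positivity) zero_le_one
      _ = l * c⁻¹ * (K * S) * dist v w := by ring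
      _ ≤ _ := mul_le_mul_of_nonneg_right hlS dist_nonneg
  have hTcon : ContractingWith (1 / 2 : NNReal) T := by
    refine ⟨by rw [← NNReal.coe_lt_coe]; norm_num, LipschitzWith.of_dist_le_mul fun v w => ?_⟩
    refine (BoundedContinuousFunction.dist_le (by positivity)).2 fun x => ?_
    have h1 := hgl v w x
    have h2 : ((1 / 2 : NNReal) : ℝ) = 1 / 2 := by norm_num
    rw [dist_eq_norm, h2]
    exact h1
  obtain ⟨v, hv⟩ : ∃ v, T v = v := ⟨_, hTcon.fixedPoint_isFixedPt⟩
  have hvx : ∀ x, v x = g v x := fun x => by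
    conv_lhs => rw [← hv]
    rfl
  -- size of the correction
  have hg0 : ∀ x, ‖g 0 x‖ ≤ l * c⁻¹ * (K * S) * M := by
    intro x
    obtain ⟨N1, h1⟩ := hfb 0
    have hN1 : 0 ≤ N1 := (norm_nonneg _).trans (h1 0)
    have h2 : ∀ x, ‖f 0 x - (fun _ => (0 : ℂ)) x‖ ≤ K * M := by
      intro x
      simp only [f, sub_zero, norm_smul]
      rcases le_or_gt 2 ‖x‖ with hx | hx
      · rw [ucut_eq_zero hx]; simp; positivity
      · have h3 := hK.dist_le_mul (B x) z₀
        rw [dist_eq_norm, dist_eq_norm] at h3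
        calc _ ≤ 1 * (K * M) := mul_le_mul (ucut_abs_le x)
              (by simpa using h3.trans (mul_le_mul_of_nonneg_left (hM x hx.le) hK0))
              (norm_nonneg _) zero_le_one
          _ = _ := one_mul _
    have h3 := newtPot_sub_le (hfc 0) continuous_const h1 (by simpa using hN1) h2 x
    rw [newtPot_zero, sub_zero] at h3
    simp only [g, norm_smul]
    rw [Real.norm_of_nonneg (by positivity : 0 ≤ l * c⁻¹)]
    calc _ ≤ 1 * (l * c⁻¹ * (K * M * S)) := mul_le_mul (ucut_abs_le x)
          (mul_le_mul_of_nonneg_left h3 (by positivity)) (by positivity) zero_le_one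
      _ = _ := by ring
  have hvn : ‖v‖ ≤ 2 * (l * c⁻¹ * (K * S) * M) := by
    have : ‖v‖ ≤ l * c⁻¹ * (K * S) * M + 1 / 2 * ‖v‖ := by
      refine (BoundedContinuousFunction.norm_le (by positivity)).2 fun x => ?_
      have h1 := hgl v 0 x
      rw [dist_zero_right] at h1
      rw [hvx x]
      calc ‖g v x‖ = ‖g 0 x + (g v x - g 0 x)‖ := by congr 1; ring
        _ ≤ _ := norm_add_le _ _
        _ ≤ _ := add_le_add (hg0 x) h1
    linarith
  -- smoothness
  have hvs : ∀ n : ℕ, ContDiff ℝ n v := by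
    intro n
    induction n with
    | zero => exact_mod_cast contDiff_zero.2 v.continuous
    | succ n ih =>
      have hn : ((n : ℕ) : WithTop ℕ∞) ≤ ((⊤ : ℕ∞) : WithTop ℕ∞) := by
        exact_mod_cast (le_top : (n : ℕ∞) ≤ ⊤)
      have hn1 : ((n + 1 : ℕ) : WithTop ℕ∞) ≤ ((⊤ : ℕ∞) : WithTop ℕ∞) := by
        exact_mod_cast (le_top : ((n + 1 : ℕ) : ℕ∞) ≤ ⊤)
      have hfn : ContDiff ℝ n (f v) := (ucut_contDiff.of_le hn).smul
        (((hF.of_le hn).comp ((hB.of_le hn).add ih)).sub contDiff_const)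
      have h1 : ContDiff ℝ ((n + 1 : ℕ) : WithTop ℕ∞) (newtPot (f v)) := by
        exact_mod_cast newtPot_contDiff (hfs v) hfn
      have : (v : ℂ → ℂ) = g v := funext hvx
      rw [this]
      have h2 := ucut_contDiff.of_le hn1
      simp only [g]
      fun_prop
  have hvs' : ContDiff ℝ (⊤ : ℕ∞) v := contDiff_infty.2 hvs
  have hfv : ContDiff ℝ (⊤ : ℕ∞) (f v) :=
    ucut_contDiff.smul ((hF.comp (hB.add hvs')).sub contDiff_const)
  have hTv : ContDiff ℝ (⊤ : ℕ∞) (newtPot (f v)) := by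
    refine contDiff_infty.2 fun n => ?_
    have := newtPot_contDiff (hfs v) (contDiff_infty.1 hfv n)
    exact this.of_le (by exact_mod_cast Nat.le_succ n)
  refine ⟨fun x => B x + v x, hB.add hvs', fun x => ?_, fun x hx => ?_⟩
  · rw [add_sub_cancel_left]
    refine (v.norm_coe_le_norm x).trans (hvn.trans ?_)
    have : l * c⁻¹ * (K * S) * M ≤ l * c⁻¹ * (K * S + 1) * M := by gcongr; linarith
    linarith
  · have h2B : ContDiffAt ℝ 2 B x := (hB.of_le two_le_smooth).contDiffAt
    have h2v : ContDiffAt ℝ 2 v x := (hvs'.of_le two_le_smooth).contDiffAt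
    have h2T : ContDiffAt ℝ 2 (newtPot (f v)) x := (hTv.of_le two_le_smooth).contDiffAt
    have hdd : ∀ e : ℂ, dd v e x = (l * c⁻¹) • dd (newtPot (f v)) e x := by
      intro e
      refine (dd_eq_of_hasJet h2v ((((hasJet_line h2T e).clm
        ((l * c⁻¹) • ContinuousLinearMap.id ℝ ℂ)).congr ?_))).2
      have hcont : ContinuousAt (fun s : ℝ => ‖x + s • e‖) 0 := by fun_prop
      filter_upwards [hcont.eventually (eventually_lt_nhds (b := 1) (by simpa using hx))] with s hs
      rw [hvx]
      simp only [g]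
      rw [ucut_eq_one hs.le, one_smul]
      rfl
    have hl : lapC v x = l • (F (B x + v x) - F z₀) := by
      rw [lapC_eq, hdd, hdd, ← smul_add, ← lapC_eq,
        lapC_newtPot hfv (fun y hy => by simp [f, ucut_eq_zero hy]) hx, smul_smul, ← hc,
        mul_assoc, inv_mul_cancel₀ hc0.ne', mul_one]
      simp [f, ucut_eq_one hx.le]
    rw [← hl, lapC_eq, dd_add h2B h2v, dd_add h2B h2v, lapC_eq, lapC_eq]
    ring

end LocalSolution

section Loops

/-- A smooth simple closed curve with arclength parametrization of period `L`. -/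
structure IsLoop (γ : ℝ → ℂ) (L : ℝ) : Prop where
  Lpos : 0 < L
  smooth : ContDiff ℝ (⊤ : ℕ∞) γ
  periodic : Function.Periodic γ L
  arclength : ∀ s, ‖deriv γ s‖ = 1
  inj : ∀ s t : ℝ, γ s = γ t → ∃ k : ℤ, s - t = L * k

lemma ArcParam.isLoop {Γ : Set ℂ} {τ : ℝ → ℂ} (h : ArcParam Γ τ) : IsLoop τ (2 * Real.pi) :=
  ⟨by positivity, h.smooth, h.periodic, h.arclength, h.inj⟩

lemma BoundaryParam.isLoop {Ω : Set ℂ} {γ : ℝ → ℂ} {L : ℝ} (h : BoundaryParam Ω γ L) :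
    IsLoop γ L := ⟨h.Lpos, h.smooth, h.periodic, h.arclength, h.inj⟩

/-- The Euclidean inner product on `ℂ`. -/
def ip (z w : ℂ) : ℝ := z.re * w.re + z.im * w.im

lemma ip_abs_le (z w : ℂ) : |ip z w| ≤ ‖z‖ * ‖w‖ := by
  refine abs_le_of_sq_le_sq ?_ (by positivity)
  rw [mul_pow, Complex.sq_norm, Complex.sq_norm, normSq_apply, normSq_apply, ip]
  nlinarith [sq_nonneg (z.re * w.im - z.im * w.re)]

lemma norm_sq_re_im (z : ℂ) : ‖z‖ ^ 2 = z.re ^ 2 + z.im ^ 2 := by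
  rw [Complex.sq_norm, normSq_apply]; ring

/-- The signed curvature. -/
def curv (γ : ℝ → ℂ) (s : ℝ) : ℝ :=
  (deriv γ s).re * (deriv (deriv γ) s).im - (deriv γ s).im * (deriv (deriv γ) s).re

/-- Tubular coordinates around a curve. -/
def tub (γ : ℝ → ℂ) (s t : ℝ) : ℂ := γ s + (t : ℂ) * (I * deriv γ s)

variable {γ : ℝ → ℂ} {L : ℝ}

namespace IsLoop

lemma hasDerivAt (h : IsLoop γ L) (s : ℝ) : HasDerivAt γ (deriv γ s) s :=
  (h.smooth.differentiable (by simp)).differentiableAt.hasDerivAt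

lemma unit (h : IsLoop γ L) (s : ℝ) : (deriv γ s).re ^ 2 + (deriv γ s).im ^ 2 = 1 := by
  rw [← norm_sq_re_im, h.arclength]; norm_num

lemma hasDerivAt_deriv (h : IsLoop γ L) (s : ℝ) :
    HasDerivAt (deriv γ) (deriv (deriv γ) s) s :=
  (h.smooth.deriv_smooth.differentiable (by simp)).differentiableAt.hasDerivAt

lemma frenet (h : IsLoop γ L) (s : ℝ) :
    deriv (deriv γ) s = (curv γ s : ℂ) * (I * deriv γ s) := by
  have h1 := h.hasDerivAt_deriv s
  have hre : HasDerivAt (fun s => (deriv γ s).re) (deriv (deriv γ) s).re s :=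
    (reCLM.hasFDerivAt.comp_hasDerivAt s h1)
  have him : HasDerivAt (fun s => (deriv γ s).im) (deriv (deriv γ) s).im s :=
    (imCLM.hasFDerivAt.comp_hasDerivAt s h1)
  have h2 := ((hre.mul hre).add (him.mul him))
  have h3 : HasDerivAt (fun _ : ℝ => (1 : ℝ)) 0 s := hasDerivAt_const _ _
  have h4 := h2.unique (h3.congr_of_eventuallyEq (Eventually.of_forall fun r => by
    have := h.unit r
    simp only [Pi.add_apply, Pi.mul_apply]
    nlinarith))
  have hu := h.unit s
  apply Complex.ext
  · simp [curv]
    linear_combination (-(deriv (deriv γ) s).re) * hu + (deriv γ s).re / 2 * h4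
  · simp [curv]
    linear_combination (-(deriv (deriv γ) s).im) * hu + (deriv γ s).im / 2 * h4

lemma curv_smooth (h : IsLoop γ L) : ContDiff ℝ (⊤ : ℕ∞) (curv γ) := by
  have h1 := h.smooth.deriv_smooth
  have h2 := h1.deriv_smooth
  have a1 := reCLM.contDiff.comp h1
  have a2 := imCLM.contDiff.comp h1
  have a3 := reCLM.contDiff.comp h2
  have a4 := imCLM.contDiff.comp h2
  exact (a1.mul a4).sub (a2.mul a3)

lemma curv_hasDerivAt (h : IsLoop γ L) (s : ℝ) : HasDerivAt (curv γ) (deriv (curv γ) s) s :=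
  (h.curv_smooth.differentiable (by simp)).differentiableAt.hasDerivAt

lemma deriv_periodic {F : Type*} [NormedAddCommGroup F] [NormedSpace ℝ F] {f : ℝ → F} {L : ℝ}
    (h : Function.Periodic f L) : Function.Periodic (deriv f) L := by
  intro s
  have h1 : (fun x => f (x + L)) = f := funext h
  conv_rhs => rw [← h1]
  rw [deriv_comp_add_const]

lemma curv_periodic (h : IsLoop γ L) : Function.Periodic (curv γ) L := by
  intro s
  have h1 := deriv_periodic h.periodic
  have h2 := deriv_periodic h1
  simp only [curv, h1 s, h2 s]

lemma exists_bound (h : IsLoop γ L) {F : Type*} [NormedAddCommGroup F] {f : ℝ → F}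
    (hf : Continuous f) (hp : Function.Periodic f L) : ∃ K, 0 < K ∧ ∀ s, ‖f s‖ ≤ K := by
  obtain ⟨K, hK⟩ := (isCompact_Icc (a := (0 : ℝ)) (b := 0 + L)).exists_bound_of_continuousOn hf.continuousOn
  refine ⟨max K 1, by positivity, fun s => ?_⟩
  obtain ⟨y, hy, hy'⟩ := hp.exists_mem_Ico h.Lpos s 0
  rw [hy']
  exact (hK y ⟨hy.1, hy.2.le⟩).trans (le_max_left _ _)

lemma tub_jet (h : IsLoop γ L) {f k : ℝ → ℝ} {s p a t q b : ℝ} (hf : HasJet f s p a)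
    (hk : HasJet k t q b) :
    HasJet (fun r => tub γ (f r) (k r)) (tub γ s t)
      (deriv γ s * (((1 - curv γ s * t) * p : ℝ) + (q : ℝ) * I))
      (deriv γ s * ((((1 - curv γ s * t) * a - 2 * curv γ s * q * p
        - deriv (curv γ) s * t * p ^ 2 : ℝ) : ℂ) +
        ((b + (1 - curv γ s * t) * curv γ s * p ^ 2 : ℝ) : ℂ) * I)) := by
  have j1 := hf.scomp_contDiff h.smooth
  have h3 : HasDerivAt (fun r => (curv γ r : ℂ) * (I * deriv γ r))
      (((deriv (curv γ) s : ℝ) : ℂ) * (I * deriv γ s) +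
        (curv γ s : ℂ) * (I * ((curv γ s : ℂ) * (I * deriv γ s)))) s := by
    refine (h.curv_hasDerivAt s).ofReal_comp.mul ?_
    have := (h.hasDerivAt_deriv s).const_mul I
    rwa [h.frenet] at this
  have j2 := hf.scomp (V := deriv γ) (V' := fun r => (curv γ r : ℂ) * (I * deriv γ r))
    (Eventually.of_forall fun r => h.frenet r ▸ h.hasDerivAt_deriv r) h3
  have j3 := j1.add ((hk.clm ofRealCLM).cmul ((hasJet_const I).cmul j2))
  refine j3.cast (fun r => by simp [tub]) (by simp [tub]) ?_ ?_
  · simp only [ofRealCLM_apply, real_smul]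
    push_cast
    linear_combination ((t : ℂ) * p * curv γ s * deriv γ s) * I_sq
  · rw [h.frenet]
    simp only [ofRealCLM_apply, real_smul]
    push_cast
    linear_combination ((t : ℂ) * a * curv γ s * deriv γ s + (t : ℂ) * p ^ 2 * ((deriv (curv γ) s : ℝ) : ℂ) * deriv γ s
      + 2 * q * p * curv γ s * deriv γ s + (t : ℂ) * p ^ 2 * curv γ s ^ 2 * deriv γ s * I) * I_sq

end IsLoop

end Loops

section LoopGeometry

variable {γ : ℝ → ℂ} {L : ℝ}

namespace IsLoop

lemma exists_shift (h : IsLoop γ L) (s s' : ℝ) : ∃ σ, |σ| ≤ L / 2 ∧ γ (s + σ) = γ s' := by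
  obtain ⟨y, hy, hy'⟩ := h.periodic.exists_mem_Ico h.Lpos s' (s - L / 2)
  refine ⟨y - s, abs_le.2 ⟨by linarith [hy.1], by linarith [hy.2]⟩, ?_⟩
  rw [hy']; congr 1; ring

lemma taylor (h : IsLoop γ L) {K : ℝ} (hK : ∀ s, ‖deriv (deriv γ) s‖ ≤ K) (s σ : ℝ) :
    ‖γ (s + σ) - γ s - σ • deriv γ s‖ ≤ K * σ ^ 2 := by
  have hd : ∀ x, HasDerivAt (fun x => γ (s + x) - x • deriv γ s) (deriv γ (s + x) - deriv γ s) x := by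
    intro x
    have h1 : HasDerivAt (fun x => γ (s + x)) (deriv γ (s + x)) x := by
      simpa using (h.hasDerivAt (s + x)).comp_const_add s x
    exact (h1.sub ((hasDerivAt_id x).smul_const (deriv γ s))).congr_deriv (by simp)
  have hb : ∀ x ∈ Icc (-|σ|) |σ|, ‖deriv γ (s + x) - deriv γ s‖ ≤ K * |σ| := by
    intro x hx
    have := convex_univ.norm_image_sub_le_of_norm_hasDerivWithin_le (f := deriv γ)
      (fun y _ => (h.hasDerivAt_deriv y).hasDerivWithinAt) (fun y _ => hK y)
      (mem_univ s) (mem_univ (s + x))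
    refine this.trans ?_
    have hK0 : 0 ≤ K := (norm_nonneg _).trans (hK 0)
    rw [add_sub_cancel_left, Real.norm_eq_abs]
    exact mul_le_mul_of_nonneg_left (abs_le.2 hx) hK0
  have := (convex_Icc (-|σ|) |σ|).norm_image_sub_le_of_norm_hasDerivWithin_le
      (fun y _ => (hd y).hasDerivWithinAt) hb (x := 0) (y := σ)
      ⟨by simp, by simp⟩ ⟨neg_abs_le σ, le_abs_self σ⟩
  simp only [add_zero, zero_smul, sub_zero, Real.norm_eq_abs] at this
  calc _ = ‖γ (s + σ) - σ • deriv γ s - γ s‖ := by congr 1; ring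
    _ ≤ _ := this
    _ = _ := by rw [mul_assoc, abs_mul_abs_self, sq]

lemma exists_bound_deriv2 (h : IsLoop γ L) : ∃ K, 0 < K ∧ ∀ s, ‖deriv (deriv γ) s‖ ≤ K :=
  h.exists_bound h.smooth.deriv_smooth.deriv_smooth.continuous
    (deriv_periodic (deriv_periodic h.periodic))

lemma chord_arc (h : IsLoop γ L) :
    ∃ c > 0, ∀ s σ, |σ| ≤ L / 2 → c * |σ| ≤ ‖γ (s + σ) - γ s‖ := by
  obtain ⟨K, hK0, hK⟩ := h.exists_bound_deriv2
  have hL := h.Lpos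
  have hcont : Continuous fun p : ℝ × ℝ => ‖γ (p.1 + p.2) - γ p.1‖ := by
    have := h.smooth.continuous
    fun_prop
  have hcomp : IsCompact (Icc (0 : ℝ) L ×ˢ {σ : ℝ | 1 / (2 * K) ≤ |σ| ∧ |σ| ≤ L / 2}) := by
    refine isCompact_Icc.prod ?_
    refine (isCompact_Icc (a := -(L / 2)) (b := L / 2)).of_isClosed_subset ?_ ?_
    · exact (isClosed_le continuous_const continuous_abs).inter
        (isClosed_le continuous_abs continuous_const)
    · exact fun x hx => abs_le.1 hx.2
  obtain ⟨c, hc0, hc⟩ : ∃ c > 0, ∀ p ∈ Icc (0 : ℝ) L ×ˢ {σ : ℝ | 1 / (2 * K) ≤ |σ| ∧ |σ| ≤ L / 2},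
      c ≤ ‖γ (p.1 + p.2) - γ p.1‖ := by
    rcases (Icc (0 : ℝ) L ×ˢ {σ : ℝ | 1 / (2 * K) ≤ |σ| ∧ |σ| ≤ L / 2}).eq_empty_or_nonempty with he | hne
    · exact ⟨1, one_pos, fun p hp => by rw [he] at hp; exact hp.elim⟩
    · obtain ⟨p, hp, hmin⟩ := hcomp.exists_isMinOn hne hcont.continuousOn
      refine ⟨_, ?_, fun q hq => hmin hq⟩
      refine norm_pos_iff.2 (sub_ne_zero.2 ?_)
      intro heq
      obtain ⟨k, hk⟩ := h.inj _ _ heq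
      rw [add_sub_cancel_left] at hk
      have h1 : 0 < |p.2| := lt_of_lt_of_le (by positivity) hp.2.1
      have h2 := hp.2.2
      rw [hk, abs_mul, abs_of_pos hL] at h1 h2
      have h3 : |(k : ℝ)| < 1 := by
        by_contra! h3
        nlinarith
      have h4 : k = 0 := by
        rw [← Int.cast_abs] at h3
        have : |k| < 1 := by exact_mod_cast h3
        exact Int.abs_lt_one_iff.1 this
      simp [h4] at h1
  refine ⟨min (1 / 2) (c / L), by positivity, fun s σ hσ => ?_⟩
  rcases le_or_gt |σ| (1 / (2 * K)) with h1 | h1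
  · have h2 := h.taylor hK s σ
    have h3 : ‖σ • deriv γ s‖ = |σ| := by rw [norm_smul, h.arclength, mul_one, Real.norm_eq_abs]
    have h4 := norm_sub_norm_le (σ • deriv γ s) (σ • deriv γ s - (γ (s + σ) - γ s))
    rw [sub_sub_cancel, norm_sub_rev (σ • deriv γ s), h3] at h4
    have h5 : K * σ ^ 2 ≤ 1 / 2 * |σ| := by
      rw [← sq_abs]
      rw [le_div_iff₀ (by positivity)] at h1
      nlinarith [abs_nonneg σ]
    have h6 : min (1 / 2) (c / L) * |σ| ≤ 1 / 2 * |σ| :=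
      mul_le_mul_of_nonneg_right (min_le_left _ _) (abs_nonneg _)
    linarith
  · obtain ⟨y, hy, hy'⟩ := Function.Periodic.exists_mem_Ico₀ (f := fun s => ‖γ (s + σ) - γ s‖)
      (fun s => by
        simp only
        rw [h.periodic s, show s + L + σ = s + σ + L by ring, h.periodic]) hL s
    rw [hy']
    refine le_trans ?_ (hc (y, σ) ⟨⟨hy.1, hy.2.le⟩, h1.le, hσ⟩)
    calc _ ≤ c / L * L := mul_le_mul (min_le_right _ _) (by linarith) (abs_nonneg _) (by positivity)
      _ = c := by field_simp

lemma norm_I_deriv (h : IsLoop γ L) (s : ℝ) : ‖I * deriv γ s‖ = 1 := by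
  rw [norm_mul, norm_I, h.arclength, one_mul]

lemma tangent_balls (h : IsLoop γ L) :
    ∃ r > 0, ∀ s s', 2 * r * |ip (γ s' - γ s) (I * deriv γ s)| ≤ ‖γ s' - γ s‖ ^ 2 := by
  obtain ⟨K, hK0, hK⟩ := h.exists_bound_deriv2
  obtain ⟨c, hc0, hc⟩ := h.chord_arc
  refine ⟨c ^ 2 / (2 * K), by positivity, fun s s' => ?_⟩
  obtain ⟨σ, hσ, hσ'⟩ := h.exists_shift s s'
  rw [← hσ']
  have h1 := h.taylor hK s σ
  have h2 := hc s σ hσ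
  have h3 : ip (γ (s + σ) - γ s) (I * deriv γ s) =
      ip (γ (s + σ) - γ s - σ • deriv γ s) (I * deriv γ s) := by
    simp [ip]; ring
  have h4 := ip_abs_le (γ (s + σ) - γ s - σ • deriv γ s) (I * deriv γ s)
  rw [h.norm_I_deriv, mul_one] at h4
  rw [h3]
  calc _ ≤ 2 * (c ^ 2 / (2 * K)) * (K * σ ^ 2) := by gcongr; exact h4.trans h1
    _ = (c * |σ|) ^ 2 := by rw [mul_pow, sq_abs]; field_simp
    _ ≤ _ := by gcongr

lemma tub_dist_sq (h : IsLoop γ L) (s t s' : ℝ) : ‖tub γ s t - γ s'‖ ^ 2 =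
    ‖γ s' - γ s‖ ^ 2 - 2 * t * ip (γ s' - γ s) (I * deriv γ s) + t ^ 2 := by
  have hu := h.unit s
  simp only [norm_sq_re_im, tub, ip]
  simp
  linear_combination t ^ 2 * hu

lemma tub_dist (h : IsLoop γ L) (s t : ℝ) : ‖tub γ s t - γ s‖ = |t| := by
  rw [tub, add_sub_cancel_left, norm_mul, h.norm_I_deriv, mul_one, norm_real, Real.norm_eq_abs]

/-- Every point has a foot on the curve. -/
lemma exists_foot (h : IsLoop γ L) (z : ℂ) (s₀ : ℝ) : ∃ s, |s - s₀| ≤ L / 2 ∧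
    z = tub γ s (ip (z - γ s) (I * deriv γ s)) ∧
    |ip (z - γ s) (I * deriv γ s)| = infDist z (range γ) := by
  have hcont := h.smooth.continuous
  have hcpt : IsCompact (range γ) := by
    have : range γ = γ '' Icc 0 L := by
      rw [← zero_add L, h.periodic.image_Icc h.Lpos]
    rw [this]
    exact isCompact_Icc.image hcont
  obtain ⟨w, ⟨s1, rfl⟩, hw⟩ := hcpt.exists_infDist_eq_dist (range_nonempty γ) z
  obtain ⟨σ, hσ, hσ'⟩ := h.exists_shift s₀ s1
  have hmin : ∀ x, ‖z - γ (s₀ + σ)‖ ≤ ‖z - γ x‖ := by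
    intro x
    rw [hσ', ← dist_eq_norm, ← dist_eq_norm, ← hw]
    exact infDist_le_dist_of_mem (mem_range_self x)
  set s := s₀ + σ with hs
  have hd : HasDerivAt (fun x => (z.re - (γ x).re) ^ 2 + (z.im - (γ x).im) ^ 2)
      (2 * (z.re - (γ s).re) * (- (deriv γ s).re) + 2 * (z.im - (γ s).im) * (- (deriv γ s).im)) s := by
    have h1 := h.hasDerivAt s
    have hre : HasDerivAt (fun s => (γ s).re) (deriv γ s).re s :=
      (reCLM.hasFDerivAt.comp_hasDerivAt s h1)
    have him : HasDerivAt (fun s => (γ s).im) (deriv γ s).im s :=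
      (imCLM.hasFDerivAt.comp_hasDerivAt s h1)
    exact (((hre.const_sub z.re).pow 2).add ((him.const_sub z.im).pow 2)).congr_deriv (by simp)
  have hlm : IsLocalMin (fun x => (z.re - (γ x).re) ^ 2 + (z.im - (γ x).im) ^ 2) s := by
    refine Eventually.of_forall fun x => ?_
    have := pow_le_pow_left₀ (norm_nonneg _) (hmin x) 2
    simpa [norm_sq_re_im] using this
  have h0 := hlm.hasDerivAt_eq_zero hd
  have hu := h.unit s
  have hz : z = tub γ s (ip (z - γ s) (I * deriv γ s)) := by
    apply Complex.ext
    · simp [tub, ip]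
      linear_combination (-(z.re - (γ s).re)) * hu - (deriv γ s).re / 2 * h0
    · simp [tub, ip]
      linear_combination (-(z.im - (γ s).im)) * hu - (deriv γ s).im / 2 * h0
  refine ⟨s, by simpa [hs] using hσ, hz, ?_⟩
  rw [hw, ← hσ', ← h.tub_dist, ← hz, dist_eq_norm]

lemma one_sub_curv_nonneg (h : IsLoop γ L) {s t : ℝ} (hf : |t| = infDist (tub γ s t) (range γ)) :
    0 ≤ 1 - curv γ s * t := by
  have hj : HasJet (fun r : ℝ => γ (s + r • (1 : ℝ)) - γ s) 0 (deriv γ s) (deriv (deriv γ) s) := by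
    refine (((hasJet_line_id s (1 : ℝ)).scomp_contDiff h.smooth).sub (hasJet_const (γ s))).cast
      (fun _ => rfl) ?_ ?_ ?_ <;> simp
  have hre := hj.clm reCLM
  have him := hj.clm imCLM
  have hq := ((hre.mul hre).add (him.mul him)).sub ((hasJet_const (2 * t)).mul
    ((hre.mul (hasJet_const (I * deriv γ s).re)).add (him.mul (hasJet_const (I * deriv γ s).im))))
  have h1 := hq.nonneg_of_isLocalMin (Eventually.of_forall fun r => ?_)
  · have h2 := h1.2
    rw [h.frenet] at h2
    have hu := h.unit s
    simp at h2
    nlinarith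
  · have h3 := h.tub_dist_sq s t (s + r • (1 : ℝ))
    have h4 : |t| ≤ ‖tub γ s t - γ (s + r • (1 : ℝ))‖ := by
      rw [hf, ← dist_eq_norm]; exact infDist_le_dist_of_mem (mem_range_self _)
    have h5 := pow_le_pow_left₀ (abs_nonneg _) h4 2
    rw [sq_abs, h3, norm_sq_re_im, ip] at h5
    simp only [reCLM_apply, imCLM_apply]
    simp at h5 ⊢
    nlinarith

lemma tub_gap (h : IsLoop γ L) {s t : ℝ} (hf : |t| = infDist (tub γ s t) (range γ)) {θ : ℝ}
    (h0 : 0 ≤ θ) (s' : ℝ) : (1 - θ) * ‖γ s' - γ s‖ ^ 2 + (θ * t) ^ 2 ≤ ‖tub γ s (θ * t) - γ s'‖ ^ 2 := by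
  have h3 := h.tub_dist_sq s t s'
  have h4 : |t| ≤ ‖tub γ s t - γ s'‖ := by
    rw [hf, ← dist_eq_norm]; exact infDist_le_dist_of_mem (mem_range_self _)
  have h5 := pow_le_pow_left₀ (abs_nonneg _) h4 2
  rw [sq_abs, h3] at h5
  rw [h.tub_dist_sq]
  nlinarith

lemma infDist_tub (h : IsLoop γ L) : ∃ r > 0, ∀ s t, |t| ≤ r →
    |t| = infDist (tub γ s t) (range γ) := by
  obtain ⟨r, hr, H⟩ := h.tangent_balls
  refine ⟨r, hr, fun s t ht => le_antisymm ?_ ?_⟩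
  · refine (le_infDist (range_nonempty γ)).2 ?_
    rintro _ ⟨s', rfl⟩
    rw [dist_eq_norm]
    refine abs_le_of_sq_le_sq ?_ (norm_nonneg _)
    rw [h.tub_dist_sq]
    have h1 := H s s'
    have h2 : t * ip (γ s' - γ s) (I * deriv γ s) ≤ r * |ip (γ s' - γ s) (I * deriv γ s)| := by
      refine (le_abs_self _).trans ?_
      rw [abs_mul]; gcongr
    linarith
  · rw [← h.tub_dist s t, ← dist_eq_norm]
    exact infDist_le_dist_of_mem (mem_range_self _)

end IsLoop

end LoopGeometry

section ExteriorBall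

lemma subset_of_disjoint_frontier {Ω B : Set ℂ} (hΩ : IsOpen Ω) (hB : IsPreconnected B)
    (hf : Disjoint B (frontier Ω)) (hn : (B ∩ Ω).Nonempty) : B ⊆ Ω := by
  refine hB.subset_left_of_subset_union hΩ isClosed_closure.isOpen_compl
    (disjoint_compl_right_iff_subset.2 subset_closure) (fun x hx => ?_) hn
  by_contra hc
  rw [mem_union, not_or, mem_compl_iff, not_not] at hc
  refine hf.le_bot ⟨hx, ?_⟩
  rw [frontier, hΩ.interior_eq]
  exact ⟨hc.2, hc.1⟩

/-- A bounded domain bounded by a smooth loop has exterior balls of uniform radius. -/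
theorem exists_exterior_balls {Ω : Set ℂ} (hΩo : IsOpen Ω) (hΩb : IsBounded Ω) (hne : Ω.Nonempty)
    {γ : ℝ → ℂ} {L : ℝ} (h : IsLoop γ L) (hfr : range γ = frontier Ω) :
    ∃ r > 0, ∀ y ∈ frontier Ω, ∃ c, ‖y - c‖ = r ∧ ∀ x ∈ closure Ω, r ≤ ‖x - c‖ := by
  obtain ⟨r, hr, hd⟩ := h.infDist_tub
  have hcont := h.smooth.continuous
  have hcont' := h.smooth.deriv_smooth.continuous
  have hdisj : ∀ s t, |t| = r → Disjoint (ball (tub γ s t) r) (frontier Ω) := by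
    intro s t ht
    rw [Set.disjoint_left]
    intro x hx hx'
    rw [← hfr] at hx'
    have h1 := infDist_le_dist_of_mem (x := tub γ s t) hx'
    rw [← hd s t ht.le, ht, dist_comm] at h1
    exact absurd (mem_ball.1 hx) (not_lt.2 h1)
  have hdich : ∀ s t, |t| = r → ball (tub γ s t) r ⊆ Ω ∨ Disjoint (ball (tub γ s t) r) (closure Ω) := by
    intro s t ht
    by_cases hn : (ball (tub γ s t) r ∩ Ω).Nonempty
    · exact Or.inl (subset_of_disjoint_frontier hΩo (convex_ball _ _).isPreconnected (hdisj s t ht) hn)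
    · exact Or.inr ((Set.disjoint_iff_inter_eq_empty.2 (not_nonempty_iff_eq_empty.1 hn)).closure_right
        isOpen_ball)
  have hclopen : ∀ t, |t| = r → IsClopen {s | tub γ s t ∈ Ω} := by
    intro t ht
    have htc : Continuous fun s => tub γ s t := by unfold tub; fun_prop
    refine ⟨?_, hΩo.preimage htc⟩
    have : {s | tub γ s t ∈ Ω} = {s | tub γ s t ∈ closure Ω} := by
      ext s
      refine ⟨fun hs => subset_closure hs, fun hs => ?_⟩
      rcases hdich s t ht with h1 | h1
      · exact h1 (mem_ball_self hr)
      · exact (h1.le_bot ⟨mem_ball_self hr, hs⟩).elim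
    rw [this]
    exact isClosed_closure.preimage htc
  have hside : ∀ s, tub γ s r ∉ Ω ∨ tub γ s (-r) ∉ Ω := by
    by_contra! hcon
    obtain ⟨s0, h1, h2⟩ := hcon
    have hu1 := (hclopen r (abs_of_pos hr)).eq_univ ⟨s0, h1⟩
    have hu2 := (hclopen (-r) (by rw [abs_neg, abs_of_pos hr])).eq_univ ⟨s0, h2⟩
    obtain ⟨y, hy, hmax⟩ := (hΩb.isCompact_closure).exists_isMaxOn hne.closure
      continuous_norm.continuousOn
    have hpar : ∀ v : ℂ, v ≠ 0 → y + v ∈ closure Ω → y - v ∈ closure Ω → False := by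
      intro v hv hp hm
      have h3 : ‖y + v‖ ≤ ‖y‖ := hmax hp
      have h4 : ‖y - v‖ ≤ ‖y‖ := hmax hm
      have h5 := parallelogram_law_with_norm ℝ y v
      have h6 : 0 < ‖v‖ := norm_pos_iff.2 hv
      nlinarith [norm_nonneg (y + v), norm_nonneg (y - v)]
    by_cases hyΩ : y ∈ Ω
    · obtain ⟨e, he, hball⟩ := Metric.isOpen_iff.1 hΩo y hyΩ
      have hn : ‖((e / 2 : ℝ) : ℂ)‖ < e := by
        rw [norm_real, Real.norm_of_nonneg (by positivity)]; linarith
      refine hpar ((e / 2 : ℝ) : ℂ) (by exact_mod_cast (by positivity : e / 2 ≠ 0))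
        (subset_closure (hball ?_)) (subset_closure (hball ?_))
      · simpa [dist_eq_norm] using hn
      · simpa [dist_eq_norm] using hn
    · have hyf : y ∈ frontier Ω := by
        rw [frontier, hΩo.interior_eq]; exact ⟨hy, hyΩ⟩
      rw [← hfr] at hyf
      obtain ⟨s, rfl⟩ := hyf
      refine hpar ((r : ℂ) * (I * deriv γ s)) ?_ (subset_closure ?_) (subset_closure ?_)
      · rw [← norm_pos_iff, norm_mul, h.norm_I_deriv]; simpa using hr.ne'
      · have : s ∈ {s | tub γ s r ∈ Ω} := hu1.symm ▸ mem_univ s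
        exact this
      · have : s ∈ {s | tub γ s (-r) ∈ Ω} := hu2.symm ▸ mem_univ s
        have h3 : tub γ s (-r) ∈ Ω := this
        convert h3 using 1
        simp [tub]; ring
  refine ⟨r, hr, fun y hy => ?_⟩
  rw [← hfr] at hy
  obtain ⟨s, rfl⟩ := hy
  have key : ∀ t, |t| = r → tub γ s t ∉ Ω → ∃ c, ‖γ s - c‖ = r ∧ ∀ x ∈ closure Ω, r ≤ ‖x - c‖ := by
    intro t ht hn
    refine ⟨tub γ s t, by rw [norm_sub_rev, h.tub_dist, ht], fun x hx => ?_⟩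
    rcases hdich s t ht with h1 | h1
    · exact (hn (h1 (mem_ball_self hr))).elim
    · by_contra! hlt
      exact h1.le_bot ⟨by rwa [mem_ball, dist_eq_norm], hx⟩
  rcases hside s with h1 | h1
  · exact key r (abs_of_pos hr) h1
  · exact key (-r) (by rw [abs_neg, abs_of_pos hr]) h1

end ExteriorBall

section Chart

variable {γ : ℝ → ℂ} {L : ℝ}

lemma IsLoop.contDiff_tub (h : IsLoop γ L) :
    ContDiff ℝ (⊤ : ℕ∞) fun p : ℝ × ℝ => tub γ p.1 p.2 := by
  have h1 := h.smooth
  have h2 := h.smooth.deriv_smooth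
  have h3 : ContDiff ℝ (⊤ : ℕ∞) fun t : ℝ => (t : ℂ) := ofRealCLM.contDiff
  exact (h1.comp contDiff_fst).add
    ((h3.comp contDiff_snd).mul (contDiff_const.mul (h2.comp contDiff_fst)))

lemma IsLoop.deriv_ne_zero (h : IsLoop γ L) (s : ℝ) : deriv γ s ≠ 0 := by
  rw [← norm_pos_iff, h.arclength]; exact one_pos

lemma IsLoop.fderiv_tub (h : IsLoop γ L) (s t : ℝ) (v : ℝ × ℝ) :
    fderiv ℝ (fun p : ℝ × ℝ => tub γ p.1 p.2) (s, t) v =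
      deriv γ s * (((1 - curv γ s * t) * v.1 : ℝ) + (v.2 : ℝ) * I) := by
  have h1 := hasJet_line ((h.contDiff_tub.of_le two_le_smooth).contDiffAt (x := (s, t))) v
  have h2 := h.tub_jet (hasJet_line_id s v.1) (hasJet_line_id t v.2)
  exact (h1.unique (h2.congr (Eventually.of_forall fun r => by simp))).2.1

/-- Smooth tubular coordinates near a point strictly inside the segment from a foot. -/
theorem IsLoop.exists_chart (h : IsLoop γ L) {s t : ℝ}
    (hf : |t| = infDist (tub γ s t) (range γ)) {θ : ℝ} (h0 : 0 ≤ θ) (h1 : θ < 1) :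
    ∃ σ ρ : ℂ → ℝ, ContDiffAt ℝ 2 σ (tub γ s (θ * t)) ∧ ContDiffAt ℝ 2 ρ (tub γ s (θ * t)) ∧
      σ (tub γ s (θ * t)) = s ∧ ρ (tub γ s (θ * t)) = θ * t ∧
      ∀ᶠ z in 𝓝 (tub γ s (θ * t)), tub γ (σ z) (ρ z) = z ∧ |ρ z| = infDist z (range γ) := by
  set z₀ := tub γ s (θ * t) with hz₀
  set G : ℝ × ℝ → ℂ := fun p => tub γ p.1 p.2 with hG
  have ha : 0 < 1 - curv γ s * (θ * t) := by
    have := h.one_sub_curv_nonneg hf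
    nlinarith
  have hGs : ContDiff ℝ (⊤ : ℕ∞) G := h.contDiff_tub
  have hker : Function.Injective (fderiv ℝ G (s, θ * t)) := by
    rw [injective_iff_map_eq_zero]
    intro v hv
    rw [h.fderiv_tub] at hv
    have h2 := (mul_eq_zero.1 hv).resolve_left (h.deriv_ne_zero s)
    have hre := congrArg Complex.re h2
    have him := congrArg Complex.im h2
    simp at hre him
    rcases hre with hre | hre
    · exact absurd hre (by nlinarith)
    · exact Prod.ext hre him
  let e' : (ℝ × ℝ) ≃L[ℝ] ℂ := (LinearMap.linearEquivOfInjective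
    (fderiv ℝ G (s, θ * t) : (ℝ × ℝ) →ₗ[ℝ] ℂ) hker (by simp)).toContinuousLinearEquiv
  have he' : HasFDerivAt G (e' : (ℝ × ℝ) →L[ℝ] ℂ) (s, θ * t) := by
    have h2 := (hGs.differentiable (by simp)).differentiableAt (x := (s, θ * t)) |>.hasFDerivAt
    have h3 : (e' : (ℝ × ℝ) →L[ℝ] ℂ) = fderiv ℝ G (s, θ * t) := by ext <;> rfl
    rw [h3]; exact h2
  have hG2 : ContDiffAt ℝ 2 G (s, θ * t) := (hGs.of_le two_le_smooth).contDiffAt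
  set e := hG2.toOpenPartialHomeomorph G he' (by simp) with he
  have hsrc : (s, θ * t) ∈ e.source := hG2.mem_toOpenPartialHomeomorph_source he' (by simp)
  have hcoe : (e : ℝ × ℝ → ℂ) = G := hG2.toOpenPartialHomeomorph_coe he' (by simp)
  have hsymm : e.symm z₀ = (s, θ * t) := by
    have := e.left_inv hsrc
    rwa [hcoe] at this
  have hinv : ContDiffAt ℝ 2 e.symm z₀ := hG2.to_localInverse he' (by simp)
  refine ⟨fun z => (e.symm z).1, fun z => (e.symm z).2, contDiffAt_fst.comp z₀ hinv,
    contDiffAt_snd.comp z₀ hinv, by simp only [hsymm], by simp only [hsymm], ?_⟩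
  obtain ⟨c, hc0, hc⟩ := h.chord_arc
  obtain ⟨η, hη, hball⟩ := Metric.isOpen_iff.1 e.open_source _ hsrc
  have hcont := h.smooth.continuous
  have hcont' := h.smooth.deriv_smooth.continuous
  have hT : ContinuousAt (fun p : ℂ × ℝ => ip (p.1 - γ p.2) (I * deriv γ p.2)) (z₀, s) := by
    unfold ip; fun_prop
  have hT0 : ip (z₀ - γ s) (I * deriv γ s) = θ * t := by
    have hu := h.unit s
    simp [hz₀, tub, ip]
    linear_combination (θ * t) * hu
  obtain ⟨η₁, hη₁, hT1⟩ := Metric.continuousAt_iff.1 hT η hη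
  simp only [hT0] at hT1
  set κ := min η η₁ with hκ
  have hκ0 : 0 < κ := lt_min hη hη₁
  have hev : ∀ᶠ z in 𝓝 z₀, 4 * |θ * t| * ‖z - z₀‖ + 4 * ‖z - z₀‖ ^ 2 < (1 - θ) * (c * κ) ^ 2 := by
    have : ContinuousAt (fun z => 4 * |θ * t| * ‖z - z₀‖ + 4 * ‖z - z₀‖ ^ 2) z₀ := by fun_prop
    refine this.eventually (eventually_lt_nhds ?_)
    simp; exact mul_pos (by linarith) (by positivity)
  filter_upwards [hev, Metric.ball_mem_nhds z₀ hη₁] with z hz hz1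
  obtain ⟨s', hs', hzs, hts⟩ := h.exists_foot z s
  set t' := ip (z - γ s') (I * deriv γ s') with ht'
  have h2 : ‖z₀ - γ s'‖ ≤ |θ * t| + 2 * ‖z - z₀‖ := by
    have h3 : ‖z - γ s'‖ = infDist z (range γ) := by rw [← hts, ← h.tub_dist s' t', ← hzs]
    have h4 : infDist z (range γ) ≤ dist z (γ s) := infDist_le_dist_of_mem (mem_range_self s)
    have h5 : dist z (γ s) ≤ ‖z - z₀‖ + |θ * t| := by
      rw [← h.tub_dist s (θ * t), ← hz₀, ← dist_eq_norm, ← dist_eq_norm]; exact dist_triangle _ _ _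
    have h6 : ‖z₀ - γ s'‖ ≤ ‖z - z₀‖ + ‖z - γ s'‖ := by
      rw [norm_sub_rev z z₀]
      exact norm_sub_le_norm_sub_add_norm_sub _ _ _
    linarith
  have h3 := h.tub_gap hf h0 s'
  rw [← hz₀] at h3
  have h4 := hc s (s' - s) hs'
  rw [add_sub_cancel] at h4
  have h5 : |s' - s| < κ := by
    by_contra! hge
    have h6 : c * κ ≤ ‖γ s' - γ s‖ := (mul_le_mul_of_nonneg_left hge hc0.le).trans h4
    have h7 : (c * κ) ^ 2 ≤ ‖γ s' - γ s‖ ^ 2 := pow_le_pow_left₀ (by positivity) h6 2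
    have h8 : ‖z₀ - γ s'‖ ^ 2 ≤ (|θ * t| + 2 * ‖z - z₀‖) ^ 2 := pow_le_pow_left₀ (norm_nonneg _) h2 2
    have h9 := mul_le_mul_of_nonneg_left h7 (by linarith : 0 ≤ 1 - θ)
    rw [← sq_abs (θ * t)] at h3
    nlinarith
  have h6 : dist t' (θ * t) < η := by
    refine hT1 (x := (z, s')) ?_
    rw [Prod.dist_eq]
    exact max_lt hz1 ((Real.dist_eq s' s).symm ▸ h5.trans_le (min_le_right _ _))
  have h7 : (s', t') ∈ e.source := by
    refine hball ?_
    rw [mem_ball, Prod.dist_eq]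
    exact max_lt ((Real.dist_eq s' s).symm ▸ h5.trans_le (min_le_left _ _)) h6
  have h8 : e.symm z = (s', t') := by
    have h9 := e.left_inv h7
    rw [hcoe] at h9
    rwa [hzs]
  simp only [h8]
  exact ⟨hzs.symm, hts⟩

end Chart

section LocalSolutions

lemma gradW_contDiff {W : ℂ → ℝ} (hW : ContDiff ℝ (⊤ : ℕ∞) W) : ContDiff ℝ (⊤ : ℕ∞) (gradW W) := by
  have h1 := hW.fderiv_dir 1
  have h2 := hW.fderiv_dir I
  have h3 : ContDiff ℝ (⊤ : ℕ∞) fun t : ℝ => (t : ℂ) := ofRealCLM.contDiff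
  exact (h3.comp h1).add ((h3.comp h2).mul contDiff_const)

lemma ip_gradW (W : ℂ → ℝ) (z v : ℂ) : ip (gradW W z) v = fderiv ℝ W z v := by
  have h1 : v = v.re • (1 : ℂ) + v.im • I := by apply Complex.ext <;> simp
  conv_rhs => rw [h1, map_add, map_smul, map_smul]
  simp [ip, gradW]; ring

/-- A quadratic map with prescribed jet at the origin. -/
def quadMap (z₀ A P Q : ℂ) (x : ℂ) : ℂ :=
  z₀ + (x.re : ℂ) * A + (x.re : ℂ) ^ 2 * P + (x.im : ℂ) ^ 2 * Q

lemma quadMap_contDiff (z₀ A P Q : ℂ) : ContDiff ℝ (⊤ : ℕ∞) (quadMap z₀ A P Q) := by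
  have h1 : ContDiff ℝ (⊤ : ℕ∞) fun x : ℂ => (x.re : ℂ) := ofRealCLM.contDiff.comp reCLM.contDiff
  have h2 : ContDiff ℝ (⊤ : ℕ∞) fun x : ℂ => (x.im : ℂ) := ofRealCLM.contDiff.comp imCLM.contDiff
  unfold quadMap
  fun_prop

lemma quadMap_jet (z₀ A P Q x e : ℂ) : HasJet (fun s : ℝ => quadMap z₀ A P Q (x + s • e))
    (quadMap z₀ A P Q x) (e.re * A + 2 * x.re * e.re * P + 2 * x.im * e.im * Q)
    (2 * ((e.re : ℂ) ^ 2 * P + (e.im : ℂ) ^ 2 * Q)) := by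
  have hl := hasJet_line_id x e
  have hr := (hl.clm reCLM).clm ofRealCLM
  have hi := (hl.clm imCLM).clm ofRealCLM
  refine ((((hasJet_const z₀).add (hr.cmul (hasJet_const A))).add
    ((hr.cmul hr).cmul (hasJet_const P))).add ((hi.cmul hi).cmul (hasJet_const Q))).cast
      (fun s => ?_) ?_ ?_ ?_
  · simp [quadMap]; ring
  · simp [quadMap]; ring
  · simp; ring
  · simp; ring

lemma lapC_quadMap (z₀ A P Q x : ℂ) : lapC (quadMap z₀ A P Q) x = 2 * (P + Q) := by
  have hc := ((quadMap_contDiff z₀ A P Q).of_le two_le_smooth).contDiffAt (x := x)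
  rw [lapC_eq, (dd_eq_of_hasJet hc (quadMap_jet z₀ A P Q x 1)).2,
    (dd_eq_of_hasJet hc (quadMap_jet z₀ A P Q x I)).2]
  simp; ring

lemma quadMap_sub_le {z₀ A P Q x : ℂ} (hx : ‖x‖ ≤ 2) :
    ‖quadMap z₀ A P Q x - z₀‖ ≤ 2 * ‖A‖ + 4 * (‖P‖ + ‖Q‖) := by
  have h1 : |x.re| ≤ 2 := (abs_re_le_norm x).trans hx
  have h2 : |x.im| ≤ 2 := (abs_im_le_norm x).trans hx
  have e : quadMap z₀ A P Q x - z₀ = x.re * A + ((x.re : ℂ) ^ 2 * P + (x.im : ℂ) ^ 2 * Q) := by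
    simp [quadMap]; ring
  rw [e]
  refine (norm_add_le _ _).trans ?_
  refine add_le_add ?_ ((norm_add_le _ _).trans ?_)
  · rw [norm_mul, norm_real]; gcongr; exact h1
  · rw [norm_mul, norm_mul, norm_pow, norm_pow, norm_real, norm_real, mul_add]
    have : (2 : ℝ) ^ 2 = 4 := by norm_num
    rw [← this]
    gcongr
    · exact h1
    · exact h2

/-- Solutions of `Δu = l ∇W(u)` on the unit disc, close to given harmonic quadratic maps. -/
theorem exists_quad_solution {W : ℂ → ℝ} (hW : ContDiff ℝ (⊤ : ℕ∞) W) (z₀ : ℂ) :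
    ∃ C > 0, ∃ l₀ > 0, ∀ l : ℝ, 0 < l → l ≤ l₀ → ∀ A b : ℂ, ∃ u : ℂ → ℂ, ContDiff ℝ (⊤ : ℕ∞) u ∧
      (∀ x, ‖u x - quadMap z₀ A (b + l • (gradW W z₀ / 4)) (-b + l • (gradW W z₀ / 4)) x‖ ≤
        C * l * (2 * ‖A‖ + 8 * ‖b‖ + 2 * l * ‖gradW W z₀‖)) ∧
      ∀ x, ‖x‖ < 1 → ‖u x - z₀‖ ≤ 1 → lapC u x = l • gradW W (u x) := by
  let χ : ContDiffBump z₀ := ⟨1, 2, one_pos, one_lt_two⟩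
  let F : ℂ → ℂ := fun z => χ z • gradW W z
  have hF : ContDiff ℝ (⊤ : ℕ∞) F := χ.contDiff.smul (gradW_contDiff hW)
  have hFs : HasCompactSupport F := χ.hasCompactSupport.smul_right
  obtain ⟨K, hK⟩ := hF.lipschitzWith_of_hasCompactSupport hFs (by simp)
  have hF1 : ∀ z, ‖z - z₀‖ ≤ 1 → F z = gradW W z := fun z hz => by
    simp only [F]
    rw [χ.one_of_mem_closedBall (by simpa [dist_eq_norm] using hz), one_smul]
  obtain ⟨C, hC, l₀, hl₀, H⟩ := exists_local_solution hF hK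
  refine ⟨C, hC, l₀, hl₀, fun l hl hll A b => ?_⟩
  set G := gradW W z₀ with hG
  have hn : ‖l • (G / 4)‖ = l * ‖G‖ / 4 := by
    rw [norm_smul, Real.norm_of_nonneg hl.le, norm_div]; norm_num; ring
  obtain ⟨u, hu, hu1, hu2⟩ := H l hl hll _ (quadMap_contDiff z₀ A (b + l • (G / 4)) (-b + l • (G / 4)))
    z₀ (2 * ‖A‖ + 8 * ‖b‖ + 2 * l * ‖G‖) fun x hx => by
      refine (quadMap_sub_le hx).trans ?_
      have h1 := norm_add_le b (l • (G / 4))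
      have h2 := norm_add_le (-b) (l • (G / 4))
      rw [norm_neg] at h2
      rw [hn] at h1 h2
      linarith
  refine ⟨u, hu, hu1, fun x hx hx1 => ?_⟩
  rw [hu2 x hx, lapC_quadMap, hF1 _ hx1, hF1 z₀ (by simp), ← hG, smul_sub]
  simp only [real_smul]; ring

end LocalSolutions

section SmallDisc

lemma sub_quad_le_of_dd {f : ℂ → ℝ} (hf : ContDiffAt ℝ 2 f 0) (h0 : fderiv ℝ f 0 = 0) {k : ℝ}
    (hk : 0 < k) (hdd : ∀ e, dd f e 0 ≤ -k * ‖e‖ ^ 2) : ∀ᶠ x in 𝓝 (0 : ℂ), x ≠ 0 → f x < f 0 := by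
  have hD : DifferentiableAt ℝ (fderiv ℝ f) 0 :=
    ((hf.fderiv_right (m := 1) (by norm_num)).differentiableAt (by simp))
  have hD' : ∀ e, dd f e 0 = fderiv ℝ (fderiv ℝ f) 0 e e := by
    intro e
    have : HasFDerivAt (fun y => fderiv ℝ f y e) ((fderiv ℝ (fderiv ℝ f) 0).flip e) 0 := by
      simpa using hD.hasFDerivAt.clm_apply (hasFDerivAt_const e (0 : ℂ))
    rw [dd, this.fderiv]; rfl
  have hlo := (hasFDerivAt_iff_isLittleO_nhds_zero.1 hD.hasFDerivAt).bound (half_pos hk)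
  have hd : ∀ᶠ y in 𝓝 (0 : ℂ), DifferentiableAt ℝ f y := by
    filter_upwards [hf.eventually (by simp)] with y hy using hy.differentiableAt (by simp)
  obtain ⟨δ, hδ, hb⟩ := Metric.eventually_nhds_iff_ball.1 (hlo.and hd)
  filter_upwards [ball_mem_nhds (0 : ℂ) hδ] with x hx hx0
  have hxs : ∀ s ∈ Icc (0 : ℝ) 1, s • x ∈ ball (0 : ℂ) δ := by
    intro s hs
    rw [mem_ball_zero_iff, norm_smul, Real.norm_of_nonneg hs.1]
    rw [mem_ball_zero_iff] at hx
    nlinarith [hs.2, norm_nonneg x]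
  have hg : ∀ s ∈ Icc (0 : ℝ) 1, HasDerivAt (fun s : ℝ => f (s • x)) (fderiv ℝ f (s • x) x) s := by
    intro s hs
    have h1 : HasDerivAt (fun s : ℝ => s • x) x s := by
      exact ((hasDerivAt_id s).smul_const x).congr_deriv (by simp)
    exact (hb _ (hxs s hs)).2.hasFDerivAt.comp_hasDerivAt s h1
  have hanti : StrictAntiOn (fun s : ℝ => f (s • x)) (Icc 0 1) := by
    refine strictAntiOn_of_deriv_neg (convex_Icc 0 1)
      (fun s hs => (hg s hs).continuousAt.continuousWithinAt) fun s hs => ?_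
    rw [interior_Icc] at hs
    rw [(hg s ⟨hs.1.le, hs.2.le⟩).deriv]
    have h1 := (hb _ (hxs s ⟨hs.1.le, hs.2.le⟩)).1
    rw [zero_add, h0, sub_zero] at h1
    have h2 := ContinuousLinearMap.le_opNorm (fderiv ℝ f (s • x) - fderiv ℝ (fderiv ℝ f) 0 (s • x)) (s • x)
    have h3 := hdd (s • x)
    rw [hD'] at h3
    have h4 := (le_abs_self _).trans (h2.trans (mul_le_mul_of_nonneg_right h1 (norm_nonneg _)))
    rw [sub_apply] at h4
    have h5 : 0 < ‖s • x‖ := norm_pos_iff.2 (smul_ne_zero hs.1.ne' hx0)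
    have h5' : 0 < k * ‖s • x‖ ^ 2 := by positivity
    have h6 : fderiv ℝ f (s • x) (s • x) < 0 := by nlinarith
    rw [map_smul, smul_eq_mul] at h6
    by_contra! h7
    nlinarith [hs.1]
  have := hanti (left_mem_Icc.2 zero_le_one) (right_mem_Icc.2 zero_le_one) one_pos
  simpa using this

/-- The maximum principle applied to small solutions near a point of a tubular chart. -/
lemma MaxPrinciple.small_disc {Γ : Set ℂ} {τ : ℝ → ℂ} {W : ℂ → ℝ} {δ₁ m : ℝ}
    (hmax : MaxPrinciple Γ τ W δ₁ m) {σ ρ : ℂ → ℝ} {z₀ : ℂ} (hσ : ContDiffAt ℝ 2 σ z₀)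
    (hρ : ContDiffAt ℝ 2 ρ z₀) (hlt : |ρ z₀| < δ₁)
    (hch : ∀ᶠ z in 𝓝 z₀, tub τ (σ z) (ρ z) = z ∧ |ρ z| = infDist z Γ) :
    ∃ r > 0, r ≤ 1 ∧ ContinuousOn (fun z => σ z + m * ρ z ^ 2 / 2) (ball z₀ r) ∧
      ∀ l : ℝ, 0 < l → ∀ u : ℂ → ℂ, ContDiff ℝ (⊤ : ℕ∞) u →
      (∀ x, ‖x‖ ≤ 1 → u x ∈ ball z₀ r) → (∀ x, ‖x‖ < 1 → lapC u x = l • gradW W (u x)) →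
      ∃ x, ‖x‖ = 1 ∧ σ (u 0) + m * ρ (u 0) ^ 2 / 2 ≤ σ (u x) + m * ρ (u x) ^ 2 / 2 := by
  have e1 : ∀ᶠ z in 𝓝 z₀, ContinuousAt σ z := by
    filter_upwards [hσ.eventually (by simp)] with z hz using hz.continuousAt
  have e2 : ∀ᶠ z in 𝓝 z₀, ContinuousAt ρ z := by
    filter_upwards [hρ.eventually (by simp)] with z hz using hz.continuousAt
  have e3 : ∀ᶠ z in 𝓝 z₀, |ρ z| < δ₁ := hρ.continuousAt.abs.eventually (eventually_lt_nhds hlt)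
  obtain ⟨r, hr, hb⟩ := Metric.eventually_nhds_iff_ball.1 (e1.and (e2.and (e3.and hch)))
  refine ⟨min r 1, by positivity, min_le_right _ _, fun z hz => ?_, fun l hl u hu hur hlap => ?_⟩
  · obtain ⟨h1, h2, -⟩ := hb z (ball_subset_ball (min_le_left _ _) hz)
    exact (h1.add ((continuousAt_const.mul (h2.pow 2)).div_const 2)).continuousWithinAt
  have hur' : ∀ x, ‖x‖ ≤ 1 → u x ∈ ball z₀ r := fun x hx =>
    ball_subset_ball (min_le_left _ _) (hur x hx)
  have hcl : closure (ball (0 : ℂ) 1) = closedBall 0 1 := closure_ball _ one_ne_zero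
  have hfr : frontier (ball (0 : ℂ) 1) = sphere 0 1 := frontier_ball _ one_ne_zero
  have hsc : SimplyConnectedSpace ↥(ball (0 : ℂ) 1) := by
    have := (convex_ball (0 : ℂ) 1).contractibleSpace ⟨0, mem_ball_self one_pos⟩
    infer_instance
  have hcσ : ContinuousOn (fun x => σ (u x)) (closedBall 0 1) := fun x hx =>
    ((hb _ (hur' x (by simpa using hx))).1.comp hu.continuous.continuousAt).continuousWithinAt
  have hcρ : ContinuousOn (fun x => ρ (u x)) (closedBall 0 1) := fun x hx =>
    ((hb _ (hur' x (by simpa using hx))).2.1.comp hu.continuous.continuousAt).continuousWithinAt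
  have hch' : ContinuousOn (fun x => σ (u x) + m * ρ (u x) ^ 2 / 2) (closedBall 0 1) :=
    hcσ.add ((continuousOn_const.mul (hcρ.pow 2)).div_const 2)
  have hε : ((1 / Real.sqrt l) ^ 2)⁻¹ = l := by
    rw [div_pow, Real.sq_sqrt hl.le]; simp
  have key := (hmax (ball 0 1) (1 / Real.sqrt l) u (fun x => ρ (u x)) (fun x => σ (u x)) isOpen_ball
    isBounded_ball ⟨0, mem_ball_self one_pos⟩ hsc (by positivity) hu.contDiffOn
    hu.continuous.continuousOn (fun x hx => by rw [hε]; exact hlap x (by simpa using hx))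
    (fun x hx => by
      rw [hcl] at hx
      obtain ⟨-, -, h3, h4⟩ := hb _ (hur' x (by simpa using hx))
      rw [← h4.2]; exact h3.le)
    (by
      rw [hcl]
      refine ⟨hcρ, hcσ, fun x hx => ?_⟩
      obtain ⟨-, -, -, h4⟩ := hb _ (hur' x (by simpa using hx))
      exact ⟨h4.1.symm, h4.2⟩)).2
  rw [hcl, hfr] at key
  have hne : (sphere (0 : ℂ) 1).Nonempty := NormedSpace.sphere_nonempty.2 zero_le_one
  obtain ⟨x, hx, hxs⟩ := (isCompact_sphere (0 : ℂ) 1).exists_sSup_image_eq hne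
    (hch'.mono sphere_subset_closedBall)
  refine ⟨x, by simpa using hx, ?_⟩
  rw [hxs] at key
  rw [← key]
  exact le_csSup ((isCompact_closedBall (0 : ℂ) 1).bddAbove_image hch') ⟨0, by simp, rfl⟩

end SmallDisc

section ChartJets

variable {γ : ℝ → ℂ} {L m : ℝ} {σ ρ : ℂ → ℝ} {z₀ : ℂ}

/-- Jets of `σ + m ρ² / 2` along a map, in tubular coordinates. -/
lemma IsLoop.chart_jet (h : IsLoop γ L) (hσ : ContDiffAt ℝ 2 σ z₀) (hρ : ContDiffAt ℝ 2 ρ z₀)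
    (hch : ∀ᶠ z in 𝓝 z₀, tub γ (σ z) (ρ z) = z) {w : ℂ → ℂ} (hw : ContDiffAt ℝ 2 w 0)
    (hw0 : w 0 = z₀) {e V A : ℂ} (hj : HasJet (fun r : ℝ => w (0 + r • e)) z₀ V A) :
    ∃ p a q b : ℝ, fderiv ℝ (fun x => σ (w x) + m * ρ (w x) ^ 2 / 2) 0 e = p + m * ρ z₀ * q ∧
      dd (fun x => σ (w x) + m * ρ (w x) ^ 2 / 2) e 0 = a + m * q ^ 2 + m * ρ z₀ * b ∧
      V = deriv γ (σ z₀) * (((1 - curv γ (σ z₀) * ρ z₀) * p : ℝ) + (q : ℝ) * I) ∧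
      A = deriv γ (σ z₀) * ((((1 - curv γ (σ z₀) * ρ z₀) * a - 2 * curv γ (σ z₀) * q * p
        - deriv (curv γ) (σ z₀) * ρ z₀ * p ^ 2 : ℝ) : ℂ) +
        ((b + (1 - curv γ (σ z₀) * ρ z₀) * curv γ (σ z₀) * p ^ 2 : ℝ) : ℂ) * I) := by
  subst hw0
  have hcσ : ContDiffAt ℝ 2 (fun x => σ (w x)) 0 := hσ.comp 0 hw
  have hcρ : ContDiffAt ℝ 2 (fun x => ρ (w x)) 0 := hρ.comp 0 hw
  have j1 := hasJet_line hcσ e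
  have j2 := hasJet_line hcρ e
  have hc : Continuous fun r : ℝ => (0 : ℂ) + r • e := by fun_prop
  have hcw : Tendsto (fun r : ℝ => w (0 + r • e)) (𝓝 0) (𝓝 (w 0)) := by
    have h1 : ContinuousAt w (0 + (0 : ℝ) • e) := by simpa using hw.continuousAt
    have := ContinuousAt.comp (f := fun r : ℝ => (0 : ℂ) + r • e) (x := (0 : ℝ)) h1 hc.continuousAt
    simpa [ContinuousAt, Function.comp_def] using this
  have j3 := (h.tub_jet j1 j2).congr (g := fun r : ℝ => w (0 + r • e)) (by
    filter_upwards [hcw.eventually hch] with r hr using hr)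
  obtain ⟨-, h2, h3⟩ := hj.unique j3
  have hhc : ContDiffAt ℝ 2 (fun x => σ (w x) + m * ρ (w x) ^ 2 / 2) 0 :=
    hcσ.add ((contDiffAt_const.mul (hcρ.pow 2)).div_const 2)
  have j4 := (j1.add ((hasJet_const (m / 2)).mul (j2.mul j2))).cast
    (g := fun r : ℝ => σ (w (0 + r • e)) + m * ρ (w (0 + r • e)) ^ 2 / 2)
    (fun r => by ring) rfl rfl rfl
  obtain ⟨h5, h6⟩ := dd_eq_of_hasJet hhc j4
  exact ⟨_, _, _, _, h5.trans (by ring), h6.trans (by ring), h2, h3⟩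

lemma IsLoop.deriv_mul_inj (h : IsLoop γ L) {s a b c d : ℝ}
    (he : deriv γ s * ((a : ℂ) + (b : ℂ) * I) = deriv γ s * ((c : ℂ) + (d : ℂ) * I)) :
    a = c ∧ b = d := by
  have := mul_left_cancel₀ (h.deriv_ne_zero s) he
  rw [Complex.ext_iff] at this
  simpa using this

lemma IsLoop.frame (h : IsLoop γ L) (s : ℝ) (F : ℂ) :
    F = deriv γ s * ((ip F (deriv γ s) : ℝ) + (ip F (I * deriv γ s) : ℝ) * I) := by
  have h1 := h.unit s
  apply Complex.ext
  · simp [ip]; linear_combination (-F.re) * h1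
  · simp [ip]; linear_combination (-F.im) * h1

end ChartJets

section Extraction

variable {Γ : Set ℂ} {τ : ℝ → ℂ} {W : ℂ → ℝ} {δ₁ m : ℝ} {σ ρ : ℂ → ℝ} {z₀ : ℂ}

/-- The maximum principle forces the gradient of the phase function to point along `∇W`. -/
lemma MaxPrinciple.fderiv_nonneg (hmax : MaxPrinciple Γ τ W δ₁ m) (hW : ContDiff ℝ (⊤ : ℕ∞) W)
    (hσ : ContDiffAt ℝ 2 σ z₀) (hρ : ContDiffAt ℝ 2 ρ z₀) (hlt : |ρ z₀| < δ₁)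
    (hch : ∀ᶠ z in 𝓝 z₀, tub τ (σ z) (ρ z) = z ∧ |ρ z| = infDist z Γ) :
    0 ≤ fderiv ℝ (fun z => σ z + m * ρ z ^ 2 / 2) z₀ (gradW W z₀) := by
  obtain ⟨r, hr, hr1, -, hdisc⟩ := hmax.small_disc hσ hρ hlt hch
  obtain ⟨C, hC, l₀, hl₀, hex⟩ := exists_quad_solution hW z₀
  set G := gradW W z₀ with hG
  set K := 2 * C * ‖G‖ with hK
  have hsol : ∀ᶠ l in 𝓝[>] (0 : ℝ), ∃ a b : ℂ, ‖a‖ ≤ K * l ^ 2 ∧ ‖b - l • (G / 4)‖ ≤ K * l ^ 2 ∧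
      σ (z₀ + a) + m * ρ (z₀ + a) ^ 2 / 2 ≤ σ (z₀ + b) + m * ρ (z₀ + b) ^ 2 / 2 := by
    have hev : ∀ᶠ l in 𝓝[>] (0 : ℝ), l * ‖G‖ / 4 + K * l ^ 2 < r := by
      have : Tendsto (fun l : ℝ => l * ‖G‖ / 4 + K * l ^ 2) (𝓝[>] 0) (𝓝 (0 * ‖G‖ / 4 + K * 0 ^ 2)) :=
        ((by fun_prop : Continuous fun l : ℝ => l * ‖G‖ / 4 + K * l ^ 2).tendsto 0).mono_left
          nhdsWithin_le_nhds
      exact this.eventually (eventually_lt_nhds (by simpa using hr))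
    filter_upwards [hev, Ioc_mem_nhdsGT hl₀] with l hl hl0
    obtain ⟨u, hu, hu1, hu2⟩ := hex l hl0.1 hl0.2 0 0
    have hb : ∀ x, ‖u x - (z₀ + (‖x‖ ^ 2 * l) • (G / 4))‖ ≤ K * l ^ 2 := by
      intro x
      refine (le_of_eq ?_).trans ((hu1 x).trans (le_of_eq ?_))
      · congr 2
        rw [← normSq_eq_norm_sq, normSq_apply]
        simp [quadMap]; ring
      · simp [K]; ring
    have hb2 : ∀ x, ‖x‖ ≤ 1 → u x ∈ ball z₀ r := by
      intro x hx
      rw [mem_ball, dist_eq_norm]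
      have e : u x - z₀ = (u x - (z₀ + (‖x‖ ^ 2 * l) • (G / 4))) + (‖x‖ ^ 2 * l) • (G / 4) := by ring
      rw [e]
      refine (norm_add_le _ _).trans_lt ?_
      have h2 : ‖(‖x‖ ^ 2 * l) • (G / 4)‖ ≤ l * ‖G‖ / 4 := by
        rw [norm_smul, Real.norm_of_nonneg (mul_nonneg (sq_nonneg _) hl0.1.le), norm_div]
        have h4 : ‖(4 : ℂ)‖ = 4 := by norm_num
        have : ‖x‖ ^ 2 ≤ 1 := pow_le_one₀ (norm_nonneg _) hx
        rw [h4]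
        nlinarith [mul_nonneg hl0.1.le (norm_nonneg G)]
      linarith [hb x]
    obtain ⟨x, hx, hle⟩ := hdisc l hl0.1 u hu hb2 fun x hx => hu2 x hx (by
      have := (hb2 x hx.le); rw [mem_ball, dist_eq_norm] at this; linarith)
    refine ⟨u 0 - z₀, u x - z₀, by simpa using hb 0, ?_, by simpa using hle⟩
    have := hb x
    rw [hx] at this
    simpa [sub_sub] using this
  have hsol' : ∀ l : ℝ, ∃ p : ℂ × ℂ, (∃ a b : ℂ, ‖a‖ ≤ K * l ^ 2 ∧ ‖b - l • (G / 4)‖ ≤ K * l ^ 2 ∧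
      σ (z₀ + a) + m * ρ (z₀ + a) ^ 2 / 2 ≤ σ (z₀ + b) + m * ρ (z₀ + b) ^ 2 / 2) →
      (‖p.1‖ ≤ K * l ^ 2 ∧ ‖p.2 - l • (G / 4)‖ ≤ K * l ^ 2 ∧
      σ (z₀ + p.1) + m * ρ (z₀ + p.1) ^ 2 / 2 ≤ σ (z₀ + p.2) + m * ρ (z₀ + p.2) ^ 2 / 2) := by
    intro l
    by_cases h : (∃ a b : ℂ, ‖a‖ ≤ K * l ^ 2 ∧ ‖b - l • (G / 4)‖ ≤ K * l ^ 2 ∧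
      σ (z₀ + a) + m * ρ (z₀ + a) ^ 2 / 2 ≤ σ (z₀ + b) + m * ρ (z₀ + b) ^ 2 / 2)
    · obtain ⟨a, b, hab⟩ := h
      exact ⟨(a, b), fun _ => hab⟩
    · exact ⟨0, fun h' => absurd h' h⟩
  choose P hP using hsol'
  have hP' : ∀ᶠ l in 𝓝[>] (0 : ℝ), ‖(P l).1‖ ≤ K * l ^ 2 ∧ ‖(P l).2 - l • (G / 4)‖ ≤ K * l ^ 2 ∧
      σ (z₀ + (P l).1) + m * ρ (z₀ + (P l).1) ^ 2 / 2 ≤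
        σ (z₀ + (P l).2) + m * ρ (z₀ + (P l).2) ^ 2 / 2 := by
    filter_upwards [hsol] with l hl using hP l hl
  have hpos : ∀ᶠ l in 𝓝[>] (0 : ℝ), 0 < l := self_mem_nhdsWithin
  have hlim0 : ∀ f : ℝ → ℝ, Continuous f → f 0 = 0 → Tendsto f (𝓝[>] 0) (𝓝 0) := by
    intro f hf h0
    have := hf.tendsto 0
    rw [h0] at this
    exact this.mono_left nhdsWithin_le_nhds
  have l1 : Tendsto (fun l => l⁻¹ • (P l).1) (𝓝[>] (0 : ℝ)) (𝓝 0) := by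
    rw [tendsto_zero_iff_norm_tendsto_zero]
    refine squeeze_zero' (Eventually.of_forall fun _ => norm_nonneg _) ?_
      (hlim0 (fun l => K * l) (by fun_prop) (by simp))
    filter_upwards [hP', hpos] with l hl hl0
    rw [norm_smul, norm_inv, Real.norm_of_nonneg hl0.le, inv_mul_le_iff₀ hl0]
    linarith [hl.1]
  have l2 : Tendsto (fun l => l⁻¹ • (P l).2) (𝓝[>] (0 : ℝ)) (𝓝 (G / 4)) := by
    rw [tendsto_iff_norm_sub_tendsto_zero]
    refine squeeze_zero' (Eventually.of_forall fun _ => norm_nonneg _) ?_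
      (hlim0 (fun l => K * l) (by fun_prop) (by simp))
    filter_upwards [hP', hpos] with l hl hl0
    have : l⁻¹ • (P l).2 - G / 4 = l⁻¹ • ((P l).2 - l • (G / 4)) := by
      rw [smul_sub, inv_smul_smul₀ hl0.ne']
    rw [this, norm_smul, norm_inv, Real.norm_of_nonneg hl0.le, inv_mul_le_iff₀ hl0]
    linarith [hl.2.1]
  have d1 : ∀ (f : ℝ → ℂ) (v : ℂ), Tendsto (fun l => l⁻¹ • f l) (𝓝[>] (0 : ℝ)) (𝓝 v) →
      Tendsto f (𝓝[>] (0 : ℝ)) (𝓝 0) := by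
    intro f v hf
    have := (hlim0 (fun l => l) continuous_id rfl).smul hf
    rw [zero_smul] at this
    refine this.congr' ?_
    filter_upwards [hpos] with l hl using smul_inv_smul₀ hl.ne' _
  have hd : HasFDerivWithinAt (fun z => σ z + m * ρ z ^ 2 / 2)
      (fderiv ℝ (fun z => σ z + m * ρ z ^ 2 / 2) z₀) univ z₀ := by
    have : ContDiffAt ℝ 2 (fun z => σ z + m * ρ z ^ 2 / 2) z₀ :=
      hσ.add ((contDiffAt_const.mul (hρ.pow 2)).div_const 2)
    exact (this.differentiableAt (by simp)).hasFDerivAt.hasFDerivWithinAt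
  have t1 := hd.lim (d1 _ _ l1) (Eventually.of_forall fun _ => mem_univ _) l1
  have t2 := hd.lim (d1 _ _ l2) (Eventually.of_forall fun _ => mem_univ _) l2
  have := le_of_tendsto_of_tendsto t1 t2 (by
    filter_upwards [hP', hpos] with l hl hl0
    exact smul_le_smul_of_nonneg_left (sub_le_sub_right hl.2.2 _) (inv_nonneg.2 hl0.le))
  have e4 : G / 4 = (1 / 4 : ℝ) • G := by rw [real_smul]; push_cast; ring
  rw [map_zero, e4, map_smul, smul_eq_mul] at this
  linarith

end Extraction

section Extraction

variable {Γ : Set ℂ} {τ : ℝ → ℂ} {W : ℂ → ℝ} {δ₁ m : ℝ} {σ ρ : ℂ → ℝ} {z₀ : ℂ}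

/-- The phase function has no strict local maximum along harmonic quadratic maps. -/
lemma MaxPrinciple.not_strict_max (hmax : MaxPrinciple Γ τ W δ₁ m) (hW : ContDiff ℝ (⊤ : ℕ∞) W)
    (hσ : ContDiffAt ℝ 2 σ z₀) (hρ : ContDiffAt ℝ 2 ρ z₀) (hlt : |ρ z₀| < δ₁)
    (hch : ∀ᶠ z in 𝓝 z₀, tub τ (σ z) (ρ z) = z ∧ |ρ z| = infDist z Γ) (v b : ℂ) :
    ¬ ∀ᶠ x in 𝓝 (0 : ℂ), x ≠ 0 → σ (quadMap z₀ v b (-b) x) + m * ρ (quadMap z₀ v b (-b) x) ^ 2 / 2 <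
      σ z₀ + m * ρ z₀ ^ 2 / 2 := by
  intro hcon
  obtain ⟨r, hr, hr1, hcont, hdisc⟩ := hmax.small_disc hσ hρ hlt hch
  obtain ⟨C, hC, l₀, hl₀, hex⟩ := exists_quad_solution hW z₀
  set hh : ℂ → ℝ := fun z => σ z + m * ρ z ^ 2 / 2 with hhh
  set G := gradW W z₀ with hG
  have hq0 : ∀ A P Q, quadMap z₀ A P Q 0 = z₀ := fun A P Q => by simp [quadMap]
  have hqc : Continuous (quadMap z₀ v b (-b)) := (quadMap_contDiff z₀ v b (-b)).continuous
  have e1 : ∀ᶠ x in 𝓝 (0 : ℂ), quadMap z₀ v b (-b) x ∈ ball z₀ (r / 2) :=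
    hqc.continuousAt.eventually (by rw [hq0]; exact ball_mem_nhds _ (half_pos hr))
  obtain ⟨d, hd, hdb⟩ := Metric.eventually_nhds_iff_ball.1 (hcon.and e1)
  set k : ℝ := d / 2 with hk
  have hk0 : 0 < k := half_pos hd
  have hkd : ∀ x : ℂ, ‖x‖ ≤ 1 → k • x ∈ ball (0 : ℂ) d := by
    intro x hx
    rw [mem_ball_zero_iff, norm_smul, Real.norm_of_nonneg hk0.le]
    nlinarith
  have hscale : ∀ x : ℂ, quadMap z₀ (k • v) (k ^ 2 • b) (-(k ^ 2 • b)) x =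
      quadMap z₀ v b (-b) (k • x) := by
    intro x; simp [quadMap]; ring
  set K : ℝ := C * (2 * ‖k • v‖ + 8 * ‖k ^ 2 • b‖ + 2 * l₀ * ‖G‖) + ‖G‖ / 4 with hK
  have hK0 : 0 ≤ K := by positivity
  set l : ℕ → ℝ := fun n => min l₀ (r / (2 * (K + 1))) / (n + 1) with hl
  set c := min l₀ (r / (2 * (K + 1))) with hc
  have hc0 : 0 < c := by positivity
  have hln : ∀ n, 0 < l n ∧ l n ≤ c := fun n =>
    ⟨by positivity, div_le_self hc0.le (by linarith [Nat.cast_nonneg (α := ℝ) n])⟩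
  have hlim : Tendsto l atTop (𝓝 0) := tendsto_const_div_atTop_nhds_zero_nat c |>.comp
    (tendsto_add_atTop_nat 1) |>.congr (fun n => by simp [l, hc])
  have hstep : ∀ n, ∃ u : ℂ → ℂ, (∀ x, ‖x‖ ≤ 1 → ‖u x - quadMap z₀ v b (-b) (k • x)‖ ≤ K * l n) ∧
      (∀ x, ‖x‖ ≤ 1 → u x ∈ ball z₀ r) ∧ ∃ x, ‖x‖ = 1 ∧ hh (u 0) ≤ hh (u x) := by
    intro n
    have hl1 : l n ≤ l₀ := (hln n).2.trans (min_le_left _ _)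
    obtain ⟨u, hu, hu1, hu2⟩ := hex (l n) (hln n).1 hl1 (k • v) (k ^ 2 • b)
    have hb : ∀ x, ‖x‖ ≤ 1 → ‖u x - quadMap z₀ v b (-b) (k • x)‖ ≤ K * l n := by
      intro x hx
      have e : u x - quadMap z₀ v b (-b) (k • x) =
          (u x - quadMap z₀ (k • v) (k ^ 2 • b + l n • (G / 4)) (-(k ^ 2 • b) + l n • (G / 4)) x)
            + (‖x‖ ^ 2 * l n) • (G / 4) := by
        rw [← hscale, ← normSq_eq_norm_sq, normSq_apply]
        simp [quadMap]; ring
      rw [e]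
      refine (norm_add_le _ _).trans ?_
      have h2 : ‖(‖x‖ ^ 2 * l n) • (G / 4)‖ ≤ l n * (‖G‖ / 4) := by
        rw [norm_smul, Real.norm_of_nonneg (mul_nonneg (sq_nonneg _) (hln n).1.le), norm_div]
        have h4 : ‖(4 : ℂ)‖ = 4 := by norm_num
        have : ‖x‖ ^ 2 ≤ 1 := pow_le_one₀ (norm_nonneg _) hx
        rw [h4]
        nlinarith [mul_nonneg (hln n).1.le (norm_nonneg G)]
      have h3 : C * l n * (2 * ‖k • v‖ + 8 * ‖k ^ 2 • b‖ + 2 * l n * ‖G‖) ≤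
          C * l n * (2 * ‖k • v‖ + 8 * ‖k ^ 2 • b‖ + 2 * l₀ * ‖G‖) := by
        have := (hln n).1
        gcongr
      have h4 := hu1 x
      simp only [hK]
      nlinarith
    have hb2 : ∀ x, ‖x‖ ≤ 1 → u x ∈ ball z₀ r := by
      intro x hx
      have h1 := (hdb _ (hkd x hx)).2
      rw [mem_ball, dist_eq_norm] at h1 ⊢
      have h2 : K * l n < r / 2 := by
        have : l n ≤ r / (2 * (K + 1)) := (hln n).2.trans (min_le_right _ _)
        rw [le_div_iff₀ (by positivity)] at this
        nlinarith [(hln n).1]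
      calc ‖u x - z₀‖ = ‖(u x - quadMap z₀ v b (-b) (k • x)) +
            (quadMap z₀ v b (-b) (k • x) - z₀)‖ := by ring_nf
        _ ≤ _ := norm_add_le _ _
        _ < r := by linarith [hb x hx]
    exact ⟨u, hb, hb2, hdisc (l n) (hln n).1 u hu hb2 fun x hx => hu2 x hx (by
      have := (hb2 x hx.le); rw [mem_ball, dist_eq_norm] at this; linarith)⟩
  choose u hu1 hu2 x hx1 hx2 using hstep
  obtain ⟨y, hy, f, hf, hxy⟩ := (isCompact_sphere (0 : ℂ) 1).tendsto_subseq (x := x)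
    (fun n => by simpa using hx1 n)
  have hy1 : ‖y‖ = 1 := by simpa using hy
  have hKl : Tendsto (fun n => K * l n) atTop (𝓝 0) := by simpa using hlim.const_mul K
  have lim : ∀ (w : ℕ → ℂ) (y : ℂ), (∀ n, ‖w n‖ ≤ 1) → ‖y‖ ≤ 1 → Tendsto (w ∘ f) atTop (𝓝 y) →
      Tendsto (fun n => hh (u (f n) (w (f n)))) atTop (𝓝 (hh (quadMap z₀ v b (-b) (k • y)))) := by
    intro w y hw hy hwy
    have h1 : Tendsto (fun n => u (f n) (w (f n)) - quadMap z₀ v b (-b) (k • w (f n))) atTop (𝓝 0) :=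
      squeeze_zero_norm (fun n => hu1 (f n) _ (hw _)) (hKl.comp hf.tendsto_atTop)
    have h2 : Tendsto (fun n => quadMap z₀ v b (-b) (k • w (f n))) atTop
        (𝓝 (quadMap z₀ v b (-b) (k • y))) :=
      (hqc.tendsto _).comp (hwy.const_smul k)
    have h3 := h1.add h2
    simp only [sub_add_cancel, zero_add] at h3
    have h4 : quadMap z₀ v b (-b) (k • y) ∈ ball z₀ r :=
      ball_subset_ball (half_le_self hr.le) (hdb _ (hkd y hy)).2
    exact ((hcont.continuousAt (isOpen_ball.mem_nhds h4)).tendsto).comp h3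
  have t1 := lim (fun _ => 0) 0 (by simp) (by simp) tendsto_const_nhds
  have t2 := lim x y (fun n => (hx1 n).le) hy1.le hxy
  have h5 := le_of_tendsto_of_tendsto' t1 t2 fun n => hx2 (f n)
  rw [smul_zero, hq0] at h5
  have hky : k • y ≠ 0 := smul_ne_zero hk0.ne' (norm_ne_zero_iff.1 (by rw [hy1]; exact one_ne_zero))
  exact absurd ((hdb _ (hkd y hy1.le)).1 hky) (not_lt.2 h5)

/-- The pointwise inequalities implied by the maximum principle at an interior chart point. -/
lemma MaxPrinciple.chart_ineq (hmax : MaxPrinciple Γ τ W δ₁ m) (hW : ContDiff ℝ (⊤ : ℕ∞) W) {L : ℝ}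
    (h : IsLoop τ L)
    (hσ : ContDiffAt ℝ 2 σ z₀) (hρ : ContDiffAt ℝ 2 ρ z₀) (hlt : |ρ z₀| < δ₁)
    (hch : ∀ᶠ z in 𝓝 z₀, tub τ (σ z) (ρ z) = z ∧ |ρ z| = infDist z Γ) {s t κ κ' : ℝ}
    (hs : s = σ z₀) (ht : t = ρ z₀) (hκ : κ = curv τ s) (hκ' : κ' = deriv (curv τ) s)
    (ha : 0 < 1 - κ * t) :
    0 ≤ ip (gradW W z₀) (deriv τ s) + (1 - κ * t) * m * t * ip (gradW W z₀) (I * deriv τ s) ∧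
    0 ≤ (1 - κ * t) * m + κ' * m ^ 2 * t ^ 3 - 2 * κ * m * t - m ^ 3 * t ^ 3 * (1 - κ * t) ^ 2 * κ := by
  have hch' : ∀ᶠ z in 𝓝 z₀, tub τ (σ z) (ρ z) = z := hch.mono fun z hz => hz.1
  have hhc : ContDiffAt ℝ 2 (fun z => σ z + m * ρ z ^ 2 / 2) z₀ :=
    hσ.add ((contDiffAt_const.mul (hρ.pow 2)).div_const 2)
  set a := 1 - κ * t with haa
  constructor
  · have h0 := hmax.fderiv_nonneg hW hσ hρ hlt hch
    set G := gradW W z₀ with hG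
    have hq : quadMap z₀ G 0 0 0 = z₀ := by simp [quadMap]
    have hc := ((quadMap_contDiff z₀ G 0 0).of_le two_le_smooth).contDiffAt (x := 0)
    have hj := (quadMap_jet z₀ G 0 0 0 1).cast (fun _ => rfl) hq rfl rfl
    obtain ⟨p, A, q, b, h1, -, h3, -⟩ := h.chart_jet (m := m) hσ hρ hch' hc hq hj
    rw [← hs, ← ht, ← hκ, ← haa] at h3
    have h4 : G = deriv τ s * (((a * p : ℝ) : ℂ) + (q : ℂ) * I) := by simpa using h3
    have h5 := (h.frame s G).symm.trans h4
    obtain ⟨h6, h7⟩ := h.deriv_mul_inj h5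
    have h8 : fderiv ℝ (fun x => σ (quadMap z₀ G 0 0 x) + m * ρ (quadMap z₀ G 0 0 x) ^ 2 / 2) 0 1 =
        fderiv ℝ (fun z => σ z + m * ρ z ^ 2 / 2) z₀ G := by
      have e1 : HasFDerivAt (fun z => σ z + m * ρ z ^ 2 / 2)
          (fderiv ℝ (fun z => σ z + m * ρ z ^ 2 / 2) z₀) (quadMap z₀ G 0 0 0) := by
        rw [hq]; exact (hhc.differentiableAt (by simp)).hasFDerivAt
      have e2 := (hc.differentiableAt (by simp)).hasFDerivAt
      have e3 := (e1.comp (0 : ℂ) e2).fderiv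
      have e4 : fderiv ℝ (quadMap z₀ G 0 0) 0 1 = G := by
        have := (dd_eq_of_hasJet hc hj).1
        simpa using this
      rw [Function.comp_def] at e3
      rw [e3, ContinuousLinearMap.comp_apply, e4]
    rw [← h8, h1, ← ht] at h0
    rw [h6, h7]
    nlinarith
  · by_contra! hneg
    set N := a * m + κ' * m ^ 2 * t ^ 3 - 2 * κ * m * t - m ^ 3 * t ^ 3 * a ^ 2 * κ with hN
    set f := N / a with hf
    have hf0 : f < 0 := div_neg_of_neg_of_pos hneg ha
    have hfa : f * a = N := div_mul_cancel₀ _ ha.ne'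
    set v : ℂ := deriv τ s * (((a * (-(m * t)) : ℝ) : ℂ) + ((1 : ℝ) : ℂ) * I) with hv
    set b : ℂ := deriv τ s * (((a * (-f / 4) : ℝ) : ℂ) + ((0 : ℝ) : ℂ) * I) with hb
    refine hmax.not_strict_max hW hσ hρ hlt hch v b ?_
    have hq : quadMap z₀ v b (-b) 0 = z₀ := by simp [quadMap]
    have hc := ((quadMap_contDiff z₀ v b (-b)).of_le two_le_smooth).contDiffAt (x := 0)
    have hjet : ∀ e : ℂ, fderiv ℝ (fun x => σ (quadMap z₀ v b (-b) x) +
          m * ρ (quadMap z₀ v b (-b) x) ^ 2 / 2) 0 e = 0 ∧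
        dd (fun x => σ (quadMap z₀ v b (-b) x) + m * ρ (quadMap z₀ v b (-b) x) ^ 2 / 2) e 0 =
          f / 2 * ‖e‖ ^ 2 := by
      intro e
      have hj := (quadMap_jet z₀ v b (-b) 0 e).cast (fun _ => rfl) hq rfl rfl
      obtain ⟨p, A, q, B, h1, h2, h3, h4⟩ := h.chart_jet (m := m) hσ hρ hch' hc hq hj
      rw [← hs, ← ht, ← hκ, ← haa] at h3
      rw [← hs, ← ht, ← hκ, ← hκ', ← haa] at h4
      rw [← ht] at h1 h2
      have h5 : deriv τ s * (((e.re * (a * (-(m * t))) : ℝ) : ℂ) + ((e.re : ℝ) : ℂ) * I) =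
          deriv τ s * (((a * p : ℝ) : ℂ) + (q : ℂ) * I) := by
        rw [← h3, hv]; push_cast; simp; ring
      have h6 : deriv τ s * (((2 * (e.re ^ 2 - e.im ^ 2) * (a * (-f / 4)) : ℝ) : ℂ) + ((0 : ℝ) : ℂ) * I)
          = deriv τ s * (((a * A - 2 * κ * q * p - κ' * t * p ^ 2 : ℝ) : ℂ) +
            ((B + a * κ * p ^ 2 : ℝ) : ℂ) * I) := by
        rw [← h4, hb]; push_cast; ring
      obtain ⟨h7, h8⟩ := h.deriv_mul_inj h5
      obtain ⟨h9, h10⟩ := h.deriv_mul_inj h6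
      have hp : p = -(m * t) * e.re := by
        apply mul_left_cancel₀ ha.ne'; linarith
      refine ⟨by rw [h1, hp, ← h8]; ring, ?_⟩
      rw [h2, ← normSq_eq_norm_sq, normSq_apply]
      apply mul_left_cancel₀ ha.ne'
      have hB : B = -(a * κ * p ^ 2) := by linarith
      have hA : a * A = 2 * (e.re ^ 2 - e.im ^ 2) * (a * (-f / 4)) + 2 * κ * q * p + κ' * t * p ^ 2 := by
        linarith
      have e1 : a * (A + m * q ^ 2 + m * t * B) = a * A + a * m * q ^ 2 + a * m * t * B := by ring
      rw [e1, hA, hB, hp, ← h8]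
      have hfa' : f * a = a * m + κ' * m ^ 2 * t ^ 3 - 2 * κ * m * t - m ^ 3 * t ^ 3 * a ^ 2 * κ := hfa
      linear_combination (-e.re ^ 2) * hfa'
    have hcc : ContDiffAt ℝ 2 (fun x => σ (quadMap z₀ v b (-b) x) +
        m * ρ (quadMap z₀ v b (-b) x) ^ 2 / 2) 0 := by
      have h1 : ContDiffAt ℝ 2 (fun z => σ z + m * ρ z ^ 2 / 2) (quadMap z₀ v b (-b) 0) := by rwa [hq]
      exact h1.comp (0 : ℂ) hc
    have := sub_quad_le_of_dd hcc (by ext e <;> simp [(hjet _).1]) (k := -f / 2) (by linarith)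
      fun e => by rw [(hjet e).2]; apply le_of_eq; ring
    simpa only [hq] using this

end Extraction

section Reflection

variable {γ : ℝ → ℂ} {L : ℝ} {Γ : Set ℂ} {W : ℂ → ℝ} {δ₁ m : ℝ}

lemma deriv_reflect (γ : ℝ → ℂ) : deriv (fun s => γ (-s)) = fun s => -deriv γ (-s) := by
  ext s; exact deriv_comp_neg γ s

lemma IsLoop.reflect (h : IsLoop γ L) : IsLoop (fun s => γ (-s)) L where
  Lpos := h.Lpos
  smooth := h.smooth.comp contDiff_neg
  periodic := fun s => by
    have := h.periodic.sub_eq (-s)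
    simp only [← this]; ring_nf
  arclength := fun s => by rw [deriv_reflect]; simpa using h.arclength (-s)
  inj := fun s t hst => by
    obtain ⟨k, hk⟩ := h.inj _ _ hst
    exact ⟨-k, by push_cast; linarith⟩

lemma tub_reflect (γ : ℝ → ℂ) (s t : ℝ) : tub (fun s => γ (-s)) s t = tub γ (-s) (-t) := by
  simp [tub, deriv_reflect]

lemma range_reflect (γ : ℝ → ℂ) : range (fun s => γ (-s)) = range γ :=
  neg_surjective.range_comp γ

lemma curv_reflect (γ : ℝ → ℂ) : curv (fun s => γ (-s)) = fun s => -curv γ (-s) := by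
  ext s
  have : deriv (deriv fun s => γ (-s)) s = deriv (deriv γ) (-s) := by
    rw [deriv_reflect]
    have h1 : deriv (fun s => -deriv γ (-s)) s = -deriv (fun s => deriv γ (-s)) s := by
      simp
    rw [h1, deriv_comp_neg, neg_neg]
  rw [curv, curv, this, deriv_reflect]
  simp [ip]; ring

lemma deriv_curv_reflect (γ : ℝ → ℂ) (s : ℝ) :
    deriv (curv (fun s => γ (-s))) s = deriv (curv γ) (-s) := by
  rw [curv_reflect]
  have h1 : deriv (fun s => -curv γ (-s)) s = -deriv (fun s => curv γ (-s)) s := by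
    simp
  rw [h1, deriv_comp_neg, neg_neg]

lemma PhaseDecomp.reflect {s : Set ℂ} {u : ℂ → ℂ} {t φ : ℂ → ℝ}
    (h : PhaseDecomp Γ γ s u t φ) :
    PhaseDecomp Γ (fun s => γ (-s)) s u (fun x => -t x) (fun x => -φ x) := by
  refine ⟨h.1.neg, h.2.1.neg, fun x hx => ?_⟩
  obtain ⟨h1, h2⟩ := h.2.2 x hx
  refine ⟨?_, by rw [abs_neg, h2]⟩
  rw [h1, deriv_reflect]; simp

lemma MaxPrinciple.reflect (h : MaxPrinciple Γ γ W δ₁ m) :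
    MaxPrinciple Γ (fun s => γ (-s)) W δ₁ m := by
  intro ω ε u t φ h1 h2 h3 h4 h5 h6 h7 h8 h9 h10
  have h11 : PhaseDecomp Γ γ (closure ω) u (fun x => -t x) (fun x => -φ x) := by
    simpa using h10.reflect
  have key := h ω ε u _ _ h1 h2 h3 h4 h5 h6 h7 h8 h9 h11
  have e1 : ∀ S : Set ℂ, (fun x => φ x - m * t x ^ 2 / 2) '' S =
      -((fun x => -φ x + m * (-t x) ^ 2 / 2) '' S) := by
    intro S
    rw [← Set.image_neg_eq_neg, image_image]
    congr 1; ext x; ring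
  have e2 : ∀ S : Set ℂ, (fun x => φ x + m * t x ^ 2 / 2) '' S =
      -((fun x => -φ x - m * (-t x) ^ 2 / 2) '' S) := by
    intro S
    rw [← Set.image_neg_eq_neg, image_image]
    congr 1; ext x; ring
  have e3 : ∀ S : Set ℝ, sSup (-S) = -sInf S := fun S => by rw [Real.sInf_def]; simp
  rw [e1, e1, e2, e2, e3, e3, Real.sInf_def, Real.sInf_def, neg_neg, neg_neg]
  exact ⟨congrArg _ key.2, congrArg _ key.1⟩

end Reflection

section TubeInequalities

variable {γ : ℝ → ℂ} {L : ℝ} {W : ℂ → ℝ} {δ₁ m : ℝ}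

lemma MaxPrinciple.tube_ineq (hmax : MaxPrinciple (range γ) γ W δ₁ m)
    (hW : ContDiff ℝ (⊤ : ℕ∞) W) (h : IsLoop γ L) (hδ : 0 < δ₁) {s t κ κ' : ℝ} (hlt : |t| ≤ δ₁)
    (hf : |t| = infDist (tub γ s t) (range γ)) (hκ : κ = curv γ s) (hκ' : κ' = deriv (curv γ) s) :
    0 ≤ ip (gradW W (tub γ s t)) (deriv γ s) +
      (1 - κ * t) * m * t * ip (gradW W (tub γ s t)) (I * deriv γ s) ∧
    0 ≤ (1 - κ * t) * m + κ' * m ^ 2 * t ^ 3 - 2 * κ * m * t - m ^ 3 * t ^ 3 * (1 - κ * t) ^ 2 * κ := by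
  have ha : 0 ≤ 1 - κ * t := by rw [hκ]; exact h.one_sub_curv_nonneg hf
  have key : ∀ θ ∈ Ico (0 : ℝ) 1, 0 ≤ ip (gradW W (tub γ s (θ * t))) (deriv γ s) +
      (1 - κ * (θ * t)) * m * (θ * t) * ip (gradW W (tub γ s (θ * t))) (I * deriv γ s) ∧
    0 ≤ (1 - κ * (θ * t)) * m + κ' * m ^ 2 * (θ * t) ^ 3 - 2 * κ * m * (θ * t)
      - m ^ 3 * (θ * t) ^ 3 * (1 - κ * (θ * t)) ^ 2 * κ := by
    intro θ hθ
    obtain ⟨σ, ρ, hσ, hρ, hs, ht, hch⟩ := h.exists_chart hf hθ.1 hθ.2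
    refine hmax.chart_ineq hW h hσ hρ ?_ hch hs.symm ht.symm hκ hκ' ?_
    · rw [ht, abs_mul, abs_of_nonneg hθ.1]
      exact (mul_le_mul_of_nonneg_left hlt hθ.1).trans_lt (mul_lt_of_lt_one_left hδ hθ.2)
    · nlinarith [hθ.1, hθ.2]
  have hFc := (gradW_contDiff hW).continuous
  have htc : Continuous fun θ : ℝ => tub γ s (θ * t) := by
    unfold tub; fun_prop
  have hipc : ∀ w : ℂ, Continuous fun θ : ℝ => ip (gradW W (tub γ s (θ * t))) w := by
    intro w
    have := hFc.comp htc
    exact ((continuous_re.comp this).mul continuous_const).add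
      ((continuous_im.comp this).mul continuous_const)
  have lim : ∀ f : ℝ → ℝ, Continuous f → (∀ θ ∈ Ico (0 : ℝ) 1, 0 ≤ f θ) → 0 ≤ f 1 := by
    intro f hf hf0
    have h1 : Tendsto f (𝓝[<] 1) (𝓝 (f 1)) := (hf.tendsto 1).mono_left nhdsWithin_le_nhds
    refine ge_of_tendsto h1 ?_
    filter_upwards [Ico_mem_nhdsLT (zero_lt_one' ℝ)] with θ hθ using hf0 θ hθ
  have i1 := hipc (deriv γ s)
  have i2 := hipc (I * deriv γ s)
  constructor
  · simpa only [one_mul] using lim _ (by fun_prop) fun θ hθ => (key θ hθ).1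
  · simpa only [one_mul] using lim _ (by fun_prop) fun θ hθ => (key θ hθ).2

/-- All pointwise inequalities on the tube implied by the maximum principle. -/
theorem MaxPrinciple.tube_ineqs (hmax : MaxPrinciple (range γ) γ W δ₁ m)
    (hW : ContDiff ℝ (⊤ : ℕ∞) W) (h : IsLoop γ L) (hδ : 0 < δ₁) (hm : 0 < m) {s t κ κ' : ℝ}
    (hlt : |t| ≤ δ₁)
    (hf : |t| = infDist (tub γ s t) (range γ)) (hκ : κ = curv γ s) (hκ' : κ' = deriv (curv γ) s) :
    2 / 3 ≤ 1 - κ * t ∧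
    |ip (gradW W (tub γ s t)) (deriv γ s)| ≤
      (1 - κ * t) * m * (t * ip (gradW W (tub γ s t)) (I * deriv γ s)) ∧
    |κ' * m ^ 2 * t ^ 3| ≤ (1 - κ * t) * m - 2 * κ * m * t - m ^ 3 * t ^ 3 * (1 - κ * t) ^ 2 * κ := by
  obtain ⟨h1, h2⟩ := hmax.tube_ineq hW h hδ hlt hf hκ hκ'
  have hf' : |-t| = infDist (tub (fun s => γ (-s)) (-s) (-t)) (range fun s => γ (-s)) := by
    rw [tub_reflect, range_reflect, neg_neg, neg_neg, abs_neg, hf]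
  have hmax' := hmax.reflect
  rw [← range_reflect γ] at hmax'
  obtain ⟨h3, h4⟩ := hmax'.tube_ineq (κ := -κ) (κ' := κ') hW h.reflect hδ (by rwa [abs_neg]) hf'
    (by simp only [curv_reflect, neg_neg, hκ]) (by rw [deriv_curv_reflect, neg_neg, hκ'])
  simp only [tub_reflect, deriv_reflect, neg_neg] at h3
  have e1 : ∀ G w : ℂ, ip G (-w) = -ip G w := fun G w => by simp [ip]; ring
  simp only [mul_neg, e1] at h3
  refine ⟨?_, abs_le.2 ⟨by linarith, by linarith⟩, abs_le.2 ⟨by linarith, by linarith⟩⟩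
  rcases le_or_gt (κ * t) 0 with hc | hc
  · linarith
  · have h5 : 0 ≤ m ^ 3 * t ^ 2 * (1 - κ * t) ^ 2 * (κ * t) := by positivity
    have h6 : 0 ≤ m * (1 - 3 * (κ * t)) := by nlinarith
    have h7 := nonneg_of_mul_nonneg_right h6 hm
    linarith

end TubeInequalities

section Profile

/-- A small even convex function with controlled first derivative. -/
lemma exists_corrector {C δ : ℝ} (hC0 : 0 < C) (hδ : 0 < δ) :
    ∃ k k₁ k₂ : ℝ → ℝ, ContDiff ℝ (⊤ : ℕ∞) k ∧ (∀ t, HasDerivAt k (k₁ t) t) ∧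
      (∀ t, HasDerivAt k₁ (k₂ t) t) ∧ k 0 = 0 ∧ (∀ t, 0 ≤ k t) ∧ ∃ c > 0,
      (∀ t, |t| ≤ δ → |k₁ t| ≤ 1) ∧ (∀ t, c ≤ k₂ t - C * |k₁ t|) ∧
      ∀ t z, 0 ≤ t * z → c * (t * z) ≤ k₁ t * z := by
  obtain ⟨Λ, hΛ, hΛ0⟩ : ∃ Λ : ℝ, Λ = C ^ 2 + 1 ∧ 0 < Λ := ⟨_, rfl, by positivity⟩
  obtain ⟨η, hη, hη0⟩ : ∃ η : ℝ, η = 1 / (2 * Λ * δ * Real.exp (Λ * δ ^ 2) + 1) ∧ 0 < η :=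
    ⟨_, rfl, by positivity⟩
  have hη1 : 2 * Λ * η * δ * Real.exp (Λ * δ ^ 2) ≤ 1 := by
    have : η * (2 * Λ * δ * Real.exp (Λ * δ ^ 2) + 1) = 1 := by rw [hη]; field_simp
    nlinarith
  set E : ℝ → ℝ := fun t => Real.exp (Λ * t ^ 2) with hE
  have hEd : ∀ t, HasDerivAt E (2 * Λ * t * E t) t := by
    intro t
    have h1 : HasDerivAt (fun t : ℝ => Λ * t ^ 2) (Λ * (2 * t)) t := by
      simpa using (hasDerivAt_pow 2 t).const_mul Λ
    exact h1.exp.congr_deriv (by simp only [hE]; ring)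
  have hE1 : ∀ t, 1 ≤ E t := fun t => Real.one_le_exp (by positivity)
  set k₁ : ℝ → ℝ := fun t => η * (2 * Λ * t * E t) with hk₁
  set k₂ : ℝ → ℝ := fun t => η * (2 * Λ * E t + 2 * Λ * t * (2 * Λ * t * E t)) with hk₂
  have hk1 : ∀ t, |t| ≤ δ → |k₁ t| ≤ 1 := by
    intro t ht
    have h1 : E t ≤ Real.exp (Λ * δ ^ 2) := by
      have : t ^ 2 ≤ δ ^ 2 := sq_le_sq' (by linarith [(abs_le.1 ht).1]) (abs_le.1 ht).2
      exact Real.exp_le_exp.2 (by gcongr)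
    have h2 : |k₁ t| = 2 * Λ * η * |t| * E t := by
      rw [hk₁]; simp only []
      rw [abs_mul, abs_mul, abs_mul, abs_of_pos hη0, abs_of_pos (by positivity : 0 < 2 * Λ),
        abs_of_pos (lt_of_lt_of_le one_pos (hE1 t))]; ring
    rw [h2]
    refine le_trans ?_ hη1
    have := hE1 t
    gcongr
  have hk2 : ∀ t, η * Λ ≤ k₂ t - C * |k₁ t| := by
    intro t
    have h2 : |k₁ t| = 2 * Λ * η * |t| * E t := by
      rw [hk₁]; simp only []
      rw [abs_mul, abs_mul, abs_mul, abs_of_pos hη0, abs_of_pos (by positivity : 0 < 2 * Λ),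
        abs_of_pos (lt_of_lt_of_le one_pos (hE1 t))]; ring
    have h3 : k₂ t - C * |k₁ t| = η * Λ * E t * (2 + 4 * Λ * |t| ^ 2 - 2 * C * |t|) := by
      rw [h2, sq_abs]; simp only [hk₂]; ring
    have h4 : 1 ≤ 2 + 4 * Λ * |t| ^ 2 - 2 * C * |t| := by
      rw [hΛ]; nlinarith [sq_nonneg (1 - C * |t|), sq_nonneg (C * |t|), sq_nonneg |t|]
    rw [h3]
    rw [mul_assoc]
    exact le_mul_of_one_le_right (by positivity) (one_le_mul_of_one_le_of_one_le (hE1 t) h4)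
  refine ⟨fun t => η * (E t - 1), k₁, k₂, ?_, fun t => ((hEd t).sub_const 1).const_mul η, fun t => ?_,
    by simp [hE], fun t => mul_nonneg hη0.le (by linarith [hE1 t]), η * Λ, by positivity, hk1, hk2,
    fun t z h1 => ?_⟩
  · simp only [hE]; fun_prop
  · have := (((hasDerivAt_id t).const_mul (2 * Λ)).mul (hEd t)).const_mul η
    exact this.congr_deriv (by simp [hk₂])
  · have h3 : k₁ t * z = 2 * (η * Λ) * E t * (t * z) := by simp only [hk₁]; ring
    rw [h3]
    have : η * Λ ≤ 2 * (η * Λ) * E t := by nlinarith [hE1 t, mul_pos hη0 hΛ0]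
    exact mul_le_mul_of_nonneg_right this h1

/-- A correction of `m t² / 2` making the second order form strictly positive. -/
theorem exists_profile {K₀ K₁ δ m : ℝ} (hK₀ : 0 < K₀) (hK₁ : 0 < K₁) (hδ : 0 < δ) (hm : 0 < m) :
    ∃ P P₁ P₂ : ℝ → ℝ, ContDiff ℝ (⊤ : ℕ∞) P ∧ (∀ t, HasDerivAt P (P₁ t) t) ∧
      (∀ t, HasDerivAt P₁ (P₂ t) t) ∧ P 0 = 0 ∧ (∀ t, 0 ≤ P t) ∧ ∃ N > 0, ∃ c > 0,
      (∀ t, |t| ≤ δ → |P₁ t| ≤ N) ∧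
      ∀ κ κ' t i a, |κ| ≤ K₀ → |κ'| ≤ K₁ → |t| ≤ δ → a = 1 - κ * t → i * a = 1 → 2 / 3 ≤ a →
        |κ' * m ^ 2 * t ^ 3| ≤ a * m - 2 * κ * m * t - m ^ 3 * t ^ 3 * a ^ 2 * κ →
        c ≤ i * κ' * t * P₁ t ^ 2 - 2 * i * κ * P₁ t - P₁ t ^ 3 * a * κ + P₂ t ∧
        ∀ l X Y, 0 ≤ l → |X| ≤ a * m * (t * Y) → c * (l * (t * Y)) ≤ l * (i * X + P₁ t * Y) := by
  set a₁ := 1 + K₀ * δ with ha₁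
  set C := (3 / 2) * K₁ * δ * (2 * m * δ + 1) + 3 * K₀ + a₁ * K₀ * (3 * m ^ 2 * δ ^ 2 + 3 * m * δ + 1)
    with hC
  have hC0 : 0 < C := by positivity
  obtain ⟨k₀, k₁, k₂, hks, hkd, hkd', hk0, hkn, c, hc, hk1, hk2, hkc⟩ := exists_corrector hC0 hδ
  refine ⟨fun t => m * t ^ 2 / 2 + k₀ t, fun t => m * t + k₁ t, fun t => m + k₂ t, ?_, ?_, ?_,
    by simp [hk0], fun t => by have := hkn t; positivity, m * δ + 1, by positivity, c, hc, ?_, ?_⟩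
  · fun_prop
  · intro t
    have h1 : HasDerivAt (fun t : ℝ => m * t ^ 2 / 2) (m * t) t := by
      have := ((hasDerivAt_pow 2 t).const_mul m).div_const 2
      exact this.congr_deriv (by simp; ring)
    exact h1.add (hkd t)
  · intro t
    have h1 : HasDerivAt (fun t : ℝ => m * t) m t := by simpa using (hasDerivAt_id t).const_mul m
    exact h1.add (hkd' t)
  · intro t ht
    refine (abs_add_le _ _).trans (add_le_add ?_ (hk1 t ht))
    rw [abs_mul, abs_of_pos hm]; gcongr
  · intro κ κ' t i a hκ hκ' ht ha hi ha2 hD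
    have hi0 : 0 < i := by
      by_contra! h
      nlinarith
    have hi1 : i ≤ 3 / 2 := by nlinarith
    have haa : a ≤ a₁ := by
      have : |κ * t| ≤ K₀ * δ := by rw [abs_mul]; gcongr
      rw [ha]; linarith [(abs_le.1 this).1]
    have ha0 : 0 < a := by linarith
    constructor
    · set k := k₁ t with hk
      have hf : 0 ≤ m + i * κ' * m ^ 2 * t ^ 3 - 2 * i * κ * m * t - m ^ 3 * t ^ 3 * a * κ := by
        have h1 := (abs_le.1 hD).1
        have h2 : m + i * κ' * m ^ 2 * t ^ 3 - 2 * i * κ * m * t - m ^ 3 * t ^ 3 * a * κ =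
          i * (a * m - 2 * κ * m * t - m ^ 3 * t ^ 3 * a ^ 2 * κ + κ' * m ^ 2 * t ^ 3) := by
          linear_combination (-m + m ^ 3 * t ^ 3 * a * κ) * hi
        rw [h2]; exact mul_nonneg hi0.le (by linarith)
      set D := i * κ' * t * (2 * m * t + k) - 2 * i * κ - a * κ * (3 * m ^ 2 * t ^ 2 + 3 * m * t * k + k ^ 2)
        with hD'
      have hkk : |k| ≤ 1 := hk1 t ht
      have hDC : |D| ≤ C := by
        have b1 : |i * κ' * t * (2 * m * t + k)| ≤ (3 / 2) * K₁ * δ * (2 * m * δ + 1) := by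
          rw [abs_mul, abs_mul, abs_mul, abs_of_pos hi0]
          have : |2 * m * t + k| ≤ 2 * m * δ + 1 := by
            refine (abs_add_le _ _).trans (add_le_add ?_ hkk)
            rw [abs_mul, abs_of_pos (by positivity : 0 < 2 * m)]; gcongr
          gcongr
        have b2 : |2 * i * κ| ≤ 3 * K₀ := by
          rw [abs_mul, abs_of_pos (by positivity : 0 < 2 * i)]
          have : 2 * i ≤ 3 := by linarith
          gcongr
        have b3 : |a * κ * (3 * m ^ 2 * t ^ 2 + 3 * m * t * k + k ^ 2)| ≤
            a₁ * K₀ * (3 * m ^ 2 * δ ^ 2 + 3 * m * δ + 1) := by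
          rw [abs_mul, abs_mul, abs_of_pos ha0]
          have : |3 * m ^ 2 * t ^ 2 + 3 * m * t * k + k ^ 2| ≤ 3 * m ^ 2 * δ ^ 2 + 3 * m * δ * 1 + 1 ^ 2 := by
            refine (abs_add_le _ _).trans (add_le_add ((abs_add_le _ _).trans (add_le_add ?_ ?_)) ?_)
            · rw [abs_mul, abs_pow, abs_of_pos (by positivity : 0 < 3 * m ^ 2)]; gcongr
            · rw [abs_mul, abs_mul, abs_of_pos (by positivity : 0 < 3 * m)]; gcongr
            · rw [abs_pow]; gcongr
          rw [mul_one, one_pow] at this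
          gcongr
        refine (abs_sub _ _).trans ?_
        have := abs_sub (i * κ' * t * (2 * m * t + k)) (2 * i * κ)
        rw [hC]
        linarith
      have e : i * κ' * t * (m * t + k) ^ 2 - 2 * i * κ * (m * t + k) - (m * t + k) ^ 3 * a * κ +
          (m + k₂ t) = (m + i * κ' * m ^ 2 * t ^ 3 - 2 * i * κ * m * t - m ^ 3 * t ^ 3 * a * κ) +
            k₂ t + D * k := by rw [hD']; ring
      have h1 : -(C * |k|) ≤ D * k := by
        have : |D * k| ≤ C * |k| := by rw [abs_mul]; gcongr
        linarith [(abs_le.1 this).1]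
      have h2 := hk2 t
      show _ ≤ i * κ' * t * (m * t + k) ^ 2 - 2 * i * κ * (m * t + k) - (m * t + k) ^ 3 * a * κ +
          (m + k₂ t)
      rw [e]; linarith
    · intro l X Y hl hX
      have h1 : 0 ≤ t * Y := by
        have := (abs_nonneg X).trans hX
        exact nonneg_of_mul_nonneg_right (by linarith) (by positivity : 0 < a * m)
      have h2 : 0 ≤ i * X + m * (t * Y) := by
        have h3 := (abs_le.1 hX).1
        have : i * X + m * (t * Y) = i * (X + a * m * (t * Y)) := by
          linear_combination (-m * (t * Y)) * hi
        rw [this]; exact mul_nonneg hi0.le (by linarith)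
      have h4 := hkc t Y h1
      have h5 : c * (t * Y) ≤ i * X + (m * t + k₁ t) * Y := by linarith
      calc _ = l * (c * (t * Y)) := by ring
        _ ≤ _ := mul_le_mul_of_nonneg_left h5 hl

end Profile

/-- `|∇h|²` for a real function `h`. -/
def gradNormSq (h : ℂ → ℝ) (x : ℂ) : ℝ := fderiv ℝ h x 1 ^ 2 + fderiv ℝ h x I ^ 2

lemma gradNormSq_nonneg (h : ℂ → ℝ) (x : ℂ) : 0 ≤ gradNormSq h x := by unfold gradNormSq; positivity

/-- `t` times the normal component of `∇W` at the point of polar coordinates `(φ, t)`. -/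
def forcing (γ : ℝ → ℂ) (W : ℂ → ℝ) (u : ℂ → ℂ) (t φ : ℂ → ℝ) (x : ℂ) : ℝ :=
  t x * ip (gradW W (u x)) (I * deriv γ (φ x))

/-- A solution together with its tubular coordinates. -/
structure PolarSol (γ : ℝ → ℂ) (W : ℂ → ℝ) (Ω : Set ℂ) (δ₁ l : ℝ) (u : ℂ → ℂ) (t φ : ℂ → ℝ) :
    Prop where
  isOpen : IsOpen Ω
  bounded : IsBounded Ω
  lpos : 0 < l
  smooth_u : ContDiff ℝ (⊤ : ℕ∞) u
  smooth_t : ContDiffOn ℝ (⊤ : ℕ∞) t Ω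
  smooth_φ : ContDiffOn ℝ (⊤ : ℕ∞) φ Ω
  cont_t : ContinuousOn t (closure Ω)
  cont_φ : ContinuousOn φ (closure Ω)
  polar : ∀ x ∈ closure Ω, u x = tub γ (φ x) (t x)
  dist : ∀ x ∈ closure Ω, |t x| = infDist (u x) (range γ)
  le : ∀ x ∈ closure Ω, |t x| ≤ δ₁
  pde : ∀ x ∈ Ω, lapC u x = l • gradW W (u x)

/-- The quadratic form estimate behind the strict subharmonicity of `φ + P(t)`. -/
lemma strict_algebra_aux {K₀ K₁ δ N c kG kq κ κ' s q r i a D E X Y l a1 a2 b1 b2 cG cg : ℝ}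
    (hK₀ : 0 < K₀) (hδ : 0 < δ) (hN : 0 < N) (hc : 0 < c)
    (hkG : kG = 3 / 2 * K₁ * δ + N * (1 + K₀ * δ) * K₀) (hkq : kq = 2 * N * kG + 3 * K₀)
    (hκ : |κ| ≤ K₀) (hκ' : |κ'| ≤ K₁) (hs : |s| ≤ δ) (hq : |q| ≤ N) (ha : a = 1 - κ * s)
    (ha1 : 2 / 3 ≤ a) (hi : i * a = 1)
    (hcG : cG = i * κ' * s - q * a * κ) (hcg : cg = -2 * q * cG + 2 * i * κ)
    (e1 : a * D = l * X + 2 * κ * (a1 * b1 + a2 * b2) + κ' * s * (a1 ^ 2 + a2 ^ 2))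
    (e2 : E = l * Y - a * κ * (a1 ^ 2 + a2 ^ 2)) :
    |cG| ≤ kG ∧ |cg| ≤ kq ∧ D + (q * E + r * (b1 ^ 2 + b2 ^ 2)) = l * (i * X + q * Y) +
      (i * κ' * s * q ^ 2 - 2 * i * κ * q - q ^ 3 * a * κ + r) * (b1 ^ 2 + b2 ^ 2) +
      cg * ((a1 + q * b1) * b1 + (a2 + q * b2) * b2) +
      cG * ((a1 + q * b1) ^ 2 + (a2 + q * b2) ^ 2) := by
  have hi0 : 0 < i := by
    by_contra! hneg
    nlinarith
  have hi1 : i ≤ 3 / 2 := by nlinarith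
  have hK₁ : 0 ≤ K₁ := (abs_nonneg _).trans hκ'
  have haa : a ≤ 1 + K₀ * δ := by
    have : |κ * s| ≤ K₀ * δ := by rw [abs_mul]; gcongr
    rw [ha]; linarith [(abs_le.1 this).1]
  have ha0 : 0 < a := by linarith
  have bG : |cG| ≤ kG := by
    rw [hcG, hkG]
    refine (abs_sub _ _).trans (add_le_add ?_ ?_)
    · rw [abs_mul, abs_mul, abs_of_pos hi0]; gcongr
    · rw [abs_mul, abs_mul, abs_of_pos ha0]; gcongr
  refine ⟨bG, ?_, ?_⟩
  · rw [hcg, hkq]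
    refine (abs_add_le _ _).trans (add_le_add ?_ ?_)
    · have h2 : |q| * |cG| ≤ N * kG := by gcongr
      have h3 : |(-2 : ℝ) * q * cG| = 2 * (|q| * |cG|) := by
        rw [abs_mul, abs_mul]; norm_num; ring
      rw [h3]; linarith
    · rw [abs_mul, abs_of_pos (by positivity : 0 < 2 * i)]
      have : 2 * i ≤ 3 := by linarith
      gcongr
  · have hD : D = i * (l * X + 2 * κ * (a1 * b1 + a2 * b2) + κ' * s * (a1 ^ 2 + a2 ^ 2)) := by
      rw [← e1]; linear_combination (-D) * hi
    rw [hD, e2, hcg, hcG]; ring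

lemma cross_term_bound {c k z : ℝ} (hc : 0 < c) (hz : |z| ≤ k) (g b : ℝ) :
    -(c / 2 * b ^ 2 + k ^ 2 / (2 * c) * g ^ 2) ≤ z * (g * b) := by
  have h2 : c / 2 * b ^ 2 + k ^ 2 / (2 * c) * g ^ 2 + z * (g * b) =
    ((c * b + z * g) ^ 2 + (k ^ 2 - z ^ 2) * g ^ 2) / (2 * c) := by field_simp; ring
  have h3 : z ^ 2 ≤ k ^ 2 := sq_le_sq' (by linarith [(abs_le.1 hz).1]) (abs_le.1 hz).2
  have h4 : 0 ≤ ((c * b + z * g) ^ 2 + (k ^ 2 - z ^ 2) * g ^ 2) / (2 * c) := by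
    have : 0 ≤ k ^ 2 - z ^ 2 := by linarith
    positivity
  linarith

lemma shifted_sq_bound {N q : ℝ} (hq : |q| ≤ N) (α b : ℝ) :
    α ^ 2 ≤ 2 * (α + q * b) ^ 2 + 2 * N ^ 2 * b ^ 2 := by
  have hq2 : q ^ 2 ≤ N ^ 2 := sq_le_sq' (by linarith [(abs_le.1 hq).1]) (abs_le.1 hq).2
  nlinarith [sq_nonneg (α + 2 * q * b), mul_le_mul_of_nonneg_right hq2 (sq_nonneg b)]

lemma strict_algebra_final {N c kG kq A C c' G Q T D p k2 k3 : ℝ} (hc : 0 < c) (hA0 : 0 < A)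
    (hA : A = kG + kq ^ 2 / (2 * c)) (hC : C = A + 1)
    (hc0 : 0 < c') (c1 : c' ≤ C * c / 4) (c2 : c' ≤ C / 2) (c3 : c' * (2 * N ^ 2) ≤ C * c / 4)
    (hQ0 : 0 ≤ Q) (hG0 : 0 ≤ G) (hT : 0 ≤ T) (hp : p ≤ 2 * G + 2 * N ^ 2 * Q)
    (h2 : -(kG * G) ≤ k2) (h3 : -(c / 2 * Q + kq ^ 2 / (2 * c) * G) ≤ k3)
    (hD : c * T + c * Q + k3 + k2 ≤ D) :
    c' * (p + Q + T) ≤ C * D + C ^ 2 * G := by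
  have hCp : 0 < C := by linarith
  have k4 : c * T + c / 2 * Q - A * G ≤ D := by
    rw [hA]; linarith
  calc c' * (p + Q + T)
      ≤ c' * (2 * G + 2 * N ^ 2 * Q + Q + T) := by gcongr
    _ = c' * (2 * G) + (c' * (2 * N ^ 2) + c') * Q + c' * T := by ring
    _ ≤ C / 2 * (2 * G) + (C * c / 4 + C * c / 4) * Q + C * c / 4 * T := by gcongr
    _ ≤ C * (c * T + c / 2 * Q - A * G) + C ^ 2 * G := by
      have h5 : C ^ 2 = C * A + C := by rw [hC]; ring
      have : 0 ≤ C * c * T := by positivity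
      rw [h5]; linarith
    _ ≤ _ := by gcongr

section Polar

variable {γ : ℝ → ℂ} {L : ℝ} {W : ℂ → ℝ} {Ω : Set ℂ} {δ₁ l m : ℝ} {u : ℂ → ℂ} {t φ : ℂ → ℝ} {x : ℂ}

lemma PolarSol.reflect (h : PolarSol γ W Ω δ₁ l u t φ) :
    PolarSol (fun s => γ (-s)) W Ω δ₁ l u (fun x => -t x) (fun x => -φ x) where
  isOpen := h.isOpen
  bounded := h.bounded
  lpos := h.lpos
  smooth_u := h.smooth_u
  smooth_t := h.smooth_t.neg
  smooth_φ := h.smooth_φ.neg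
  cont_t := h.cont_t.neg
  cont_φ := h.cont_φ.neg
  polar := fun x hx => by rw [tub_reflect, neg_neg, neg_neg]; exact h.polar x hx
  dist := fun x hx => by rw [abs_neg, range_reflect]; exact h.dist x hx
  le := fun x hx => by rw [abs_neg]; exact h.le x hx
  pde := h.pde

lemma PolarSol.contDiffAt_t (h : PolarSol γ W Ω δ₁ l u t φ) (hx : x ∈ Ω) : ContDiffAt ℝ 2 t x :=
  (h.smooth_t.contDiffAt (h.isOpen.mem_nhds hx)).of_le two_le_smooth

lemma PolarSol.contDiffAt_φ (h : PolarSol γ W Ω δ₁ l u t φ) (hx : x ∈ Ω) : ContDiffAt ℝ 2 φ x :=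
  (h.smooth_φ.contDiffAt (h.isOpen.mem_nhds hx)).of_le two_le_smooth

/-- First and second order relations in tubular coordinates. -/
lemma IsLoop.polar_relations (hγ : IsLoop γ L) (hu : ContDiffAt ℝ 2 u x) (ht : ContDiffAt ℝ 2 t x)
    (hφ : ContDiffAt ℝ 2 φ x) (he : ∀ᶠ y in 𝓝 x, u y = tub γ (φ y) (t y)) :
    (∀ e, fderiv ℝ u x e = deriv γ (φ x) *
      (((1 - curv γ (φ x) * t x) * fderiv ℝ φ x e : ℝ) + (fderiv ℝ t x e : ℝ) * I)) ∧
    lapC u x = deriv γ (φ x) * ((((1 - curv γ (φ x) * t x) * lapR φ x - 2 * curv γ (φ x) *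
      (fderiv ℝ φ x 1 * fderiv ℝ t x 1 + fderiv ℝ φ x I * fderiv ℝ t x I)
      - deriv (curv γ) (φ x) * t x * gradNormSq φ x : ℝ) : ℂ) +
      ((lapR t x + (1 - curv γ (φ x) * t x) * curv γ (φ x) * gradNormSq φ x : ℝ) : ℂ) * I) := by
  have hj : ∀ e, _ := fun e => (hγ.tub_jet (hasJet_line hφ e) (hasJet_line ht e)).congr
    (g := fun s : ℝ => u (x + s • e)) (by
      have hc : ContinuousAt (fun s : ℝ => x + s • e) 0 := by fun_prop
      have h2 : ∀ᶠ y in 𝓝 (x + (0 : ℝ) • e), u y = tub γ (φ y) (t y) := by simpa using he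
      filter_upwards [hc.eventually h2] with s hs using hs.symm)
  have hd := fun e => dd_eq_of_hasJet hu (hj e)
  refine ⟨fun e => (hd e).1, ?_⟩
  rw [lapC_eq, (hd 1).2, (hd I).2, lapR_eq, lapR_eq, gradNormSq]
  push_cast; ring

/-- The equations satisfied by the tubular coordinates of a solution. -/
lemma PolarSol.equations (h : PolarSol γ W Ω δ₁ l u t φ) (hγ : IsLoop γ L) (hx : x ∈ Ω) :
    (∀ e, fderiv ℝ u x e = deriv γ (φ x) *
      (((1 - curv γ (φ x) * t x) * fderiv ℝ φ x e : ℝ) + (fderiv ℝ t x e : ℝ) * I)) ∧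
    (1 - curv γ (φ x) * t x) * lapR φ x = l * ip (gradW W (u x)) (deriv γ (φ x)) +
      2 * curv γ (φ x) * (fderiv ℝ φ x 1 * fderiv ℝ t x 1 + fderiv ℝ φ x I * fderiv ℝ t x I) +
      deriv (curv γ) (φ x) * t x * gradNormSq φ x ∧
    lapR t x = l * ip (gradW W (u x)) (I * deriv γ (φ x)) -
      (1 - curv γ (φ x) * t x) * curv γ (φ x) * gradNormSq φ x := by
  have he : ∀ᶠ y in 𝓝 x, u y = tub γ (φ y) (t y) := by
    filter_upwards [h.isOpen.mem_nhds hx] with y hy using h.polar y (subset_closure hy)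
  obtain ⟨h1, h2⟩ := hγ.polar_relations ((h.smooth_u.of_le two_le_smooth).contDiffAt)
    (h.contDiffAt_t hx) (h.contDiffAt_φ hx) he
  refine ⟨h1, ?_⟩
  rw [h.pde x hx] at h2
  have h3 : deriv γ (φ x) * (((l * ip (gradW W (u x)) (deriv γ (φ x)) : ℝ) : ℂ) +
      ((l * ip (gradW W (u x)) (I * deriv γ (φ x)) : ℝ) : ℂ) * I) = deriv γ (φ x) * ((((1 - curv γ (φ x) * t x) * lapR φ x - 2 * curv γ (φ x) *
      (fderiv ℝ φ x 1 * fderiv ℝ t x 1 + fderiv ℝ φ x I * fderiv ℝ t x I)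
      - deriv (curv γ) (φ x) * t x * gradNormSq φ x : ℝ) : ℂ) +
      ((lapR t x + (1 - curv γ (φ x) * t x) * curv γ (φ x) * gradNormSq φ x : ℝ) : ℂ) * I) := by
    refine Eq.trans ?_ h2
    conv_rhs => rw [hγ.frame (φ x) (gradW W (u x))]
    rw [real_smul]; push_cast; ring
  obtain ⟨h4, h5⟩ := hγ.deriv_mul_inj h3
  exact ⟨by linarith, by linarith⟩

/-- Pointwise inequalities along a solution. -/
lemma PolarSol.tube (h : PolarSol γ W Ω δ₁ l u t φ) (hγ : IsLoop γ L)
    (hmax : MaxPrinciple (range γ) γ W δ₁ m) (hW : ContDiff ℝ (⊤ : ℕ∞) W) (hδ : 0 < δ₁) (hm : 0 < m)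
    (hx : x ∈ closure Ω) :
    2 / 3 ≤ 1 - curv γ (φ x) * t x ∧
    |ip (gradW W (u x)) (deriv γ (φ x))| ≤ (1 - curv γ (φ x) * t x) * m * forcing γ W u t φ x ∧
    |deriv (curv γ) (φ x) * m ^ 2 * t x ^ 3| ≤ (1 - curv γ (φ x) * t x) * m -
      2 * curv γ (φ x) * m * t x - m ^ 3 * t x ^ 3 * (1 - curv γ (φ x) * t x) ^ 2 * curv γ (φ x) ∧
    0 ≤ forcing γ W u t φ x := by
  have h1 := hmax.tube_ineqs hW hγ hδ hm (h.le x hx) (by rw [← h.polar x hx]; exact h.dist x hx)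
    rfl rfl
  rw [← h.polar x hx] at h1
  refine ⟨h1.1, h1.2.1, h1.2.2, ?_⟩
  have h2 := (abs_nonneg _).trans h1.2.1
  exact nonneg_of_mul_nonneg_right h2 (by have := h1.1; positivity)

lemma gradNormSq_comp {f : ℂ → ℝ} (hf : ContDiffAt ℝ 2 f x) {V : ℝ → ℝ} {V' : ℝ}
    (hV : HasDerivAt V V' (f x)) (e : ℂ) :
    fderiv ℝ (fun y => V (f y)) x e = V' * fderiv ℝ f x e := by
  have h1 : HasFDerivAt f (fderiv ℝ f x) x := (hf.differentiableAt (by simp)).hasFDerivAt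
  have := (hV.comp_hasFDerivAt x h1).fderiv
  rw [Function.comp_def] at this
  rw [this]; simp

/-- Uniform strict subharmonicity of a function of the tubular coordinates. -/
theorem exists_strict {K₀ K₁ : ℝ} (hK₀ : 0 < K₀) (hK₁ : 0 < K₁) (hδ : 0 < δ₁) (hm : 0 < m) :
    ∃ P : ℝ → ℝ, ContDiff ℝ (⊤ : ℕ∞) P ∧ P 0 = 0 ∧ (∀ t, 0 ≤ P t) ∧ ∃ C > 0, ∃ c > 0,
      ∀ (γ : ℝ → ℂ) (L : ℝ) (W : ℂ → ℝ), IsLoop γ L → (∀ s, |curv γ s| ≤ K₀) →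
      (∀ s, |deriv (curv γ) s| ≤ K₁) → MaxPrinciple (range γ) γ W δ₁ m → ContDiff ℝ (⊤ : ℕ∞) W →
      ∀ (Ω : Set ℂ) (l : ℝ) (u : ℂ → ℂ) (t φ : ℂ → ℝ), PolarSol γ W Ω δ₁ l u t φ → ∀ x ∈ Ω,
      c * (gradNormSq φ x + gradNormSq t x + l * forcing γ W u t φ x) ≤
        C * lapR (fun y => φ y + P (t y)) x + C ^ 2 * gradNormSq (fun y => φ y + P (t y)) x := by
  obtain ⟨P, P₁, P₂, hP, hP1, hP2, hP0, hPn, N, hN, c, hc, hPN, H⟩ := exists_profile hK₀ hK₁ hδ hm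
  obtain ⟨kG, hkG⟩ : ∃ k, k = 3 / 2 * K₁ * δ₁ + N * (1 + K₀ * δ₁) * K₀ := ⟨_, rfl⟩
  obtain ⟨kq, hkq⟩ : ∃ k, k = 2 * N * kG + 3 * K₀ := ⟨_, rfl⟩
  obtain ⟨A, hA⟩ : ∃ k, k = kG + kq ^ 2 / (2 * c) := ⟨_, rfl⟩
  have hG0 : 0 < kG := by rw [hkG]; positivity
  have hA0 : 0 < A := by rw [hA]; positivity
  obtain ⟨C, hC⟩ : ∃ k, k = A + 1 := ⟨_, rfl⟩
  have hC0 : 0 < C := by linarith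
  obtain ⟨c', hc'⟩ : ∃ k, k = min (C * c / 4) (min (C / 2) (C * c / (8 * N ^ 2))) := ⟨_, rfl⟩
  have hc0 : 0 < c' := by rw [hc']; positivity
  refine ⟨P, hP, hP0, hPn, C, hC0, c', hc0, ?_⟩
  intro γ L W hγ hκ0 hκ1 hmax hW Ω l u t φ h x hx
  obtain ⟨-, e1, e2⟩ := h.equations hγ hx
  obtain ⟨t1, t2, t3, t4⟩ := h.tube hγ hmax hW hδ hm (subset_closure hx)
  have ht := h.le x (subset_closure hx)
  have hct := h.contDiffAt_t hx
  have hcφ := h.contDiffAt_φ hx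
  have hdP : deriv P = P₁ := funext fun s => (hP1 s).deriv
  have hdP2 : deriv P₁ = P₂ := funext fun s => (hP2 s).deriv
  have hcP : ContDiffAt ℝ 2 (fun y => P (t y)) x :=
    ((hP.of_le two_le_smooth).contDiffAt).comp x hct
  have e3 : lapR (fun y => φ y + P (t y)) x =
      lapR φ x + (P₁ (t x) * lapR t x + P₂ (t x) * gradNormSq t x) := by
    rw [lapR_add hcφ hcP, lapR_scomp hct hP, hdP, hdP2]; rfl
  have e4 : ∀ e, fderiv ℝ (fun y => φ y + P (t y)) x e =
      fderiv ℝ φ x e + P₁ (t x) * fderiv ℝ t x e := by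
    intro e
    have h1 : HasFDerivAt (fun y => φ y + P (t y)) _ x :=
      (hcφ.differentiableAt (by simp)).hasFDerivAt.add (hcP.differentiableAt (by simp)).hasFDerivAt
    rw [h1.fderiv, add_apply, gradNormSq_comp hct (hP1 (t x))]
  rw [e3]
  simp only [forcing] at t2 t4 ⊢
  simp only [gradNormSq, e4] at e1 e2 ⊢
  obtain ⟨a, ha⟩ : ∃ a, a = 1 - curv γ (φ x) * t x := ⟨_, rfl⟩
  rw [← ha] at e1 e2 t1 t2 t3
  have hi : a⁻¹ * a = 1 := inv_mul_cancel₀ (by linarith)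
  obtain ⟨H1, H2⟩ := H _ _ (t x) a⁻¹ a (hκ0 (φ x)) (hκ1 (φ x)) ht ha hi t1 t3
  have H3 := H2 l _ _ h.lpos.le t2
  obtain ⟨bG, bg, key⟩ := strict_algebra_aux (r := P₂ (t x)) hK₀ hδ hN hc hkG hkq (hκ0 (φ x))
    (hκ1 (φ x)) ht (hPN _ ht) ha t1 hi rfl rfl e1 e2
  have s1 := shifted_sq_bound (hPN _ ht) (fderiv ℝ φ x 1) (fderiv ℝ t x 1)
  have s2 := shifted_sq_bound (hPN _ ht) (fderiv ℝ φ x I) (fderiv ℝ t x I)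
  have b1 := cross_term_bound hc bg (fderiv ℝ φ x 1 + P₁ (t x) * fderiv ℝ t x 1) (fderiv ℝ t x 1)
  have b2 := cross_term_bound hc bg (fderiv ℝ φ x I + P₁ (t x) * fderiv ℝ t x I) (fderiv ℝ t x I)
  rw [key]
  refine strict_algebra_final (N := N) hc hA0 hA hC hc0 (hc' ▸ min_le_left _ _)
    (hc' ▸ (min_le_right _ _).trans (min_le_left _ _)) ?_ (by positivity) (by positivity)
    (mul_nonneg h.lpos.le t4) (by linarith) ?_ (k3 := _) ?_
    (add_le_add (add_le_add (add_le_add H3 (mul_le_mul_of_nonneg_right H1 (by positivity)))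
      le_rfl) le_rfl)
  · have : c' ≤ C * c / (8 * N ^ 2) := hc' ▸ (min_le_right _ _).trans (min_le_right _ _)
    rw [le_div_iff₀ (by positivity)] at this
    linarith
  · rw [← neg_mul]
    exact mul_le_mul_of_nonneg_right (abs_le.1 bG).1 (by positivity)
  · linarith

end Polar

section MaxTools

/-- Maximum principle, with lower touching functions. -/
lemma le_of_touching {Ω : Set ℂ} (hΩ : IsOpen Ω) (hb : IsBounded Ω) {f : ℂ → ℝ} {M : ℝ}
    (hf : ContinuousOn f (closure Ω)) (hfr : ∀ x ∈ frontier Ω, f x ≤ M)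
    (H : ∀ x ∈ Ω, M < f x → ∃ g : ℂ → ℝ, g x = f x ∧ (∀ᶠ y in 𝓝 x, g y ≤ f y) ∧
      ContDiffAt ℝ 2 g x ∧ (fderiv ℝ g x 1 = 0 → fderiv ℝ g x I = 0 → 0 < lapR g x)) :
    ∀ x ∈ closure Ω, f x ≤ M := by
  intro x hx
  obtain ⟨z, hz, hzm⟩ := (hb.isCompact_closure).exists_isMaxOn ⟨x, hx⟩ hf
  by_contra! hlt
  have hMz : M < f z := hlt.trans_le (hzm hx)
  have hzΩ : z ∈ Ω := by
    by_contra hn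
    exact absurd (hfr z ⟨hz, by rwa [hΩ.interior_eq]⟩) (not_le.2 hMz)
  obtain ⟨g, hg, hgf, hg2, hgl⟩ := H z hzΩ hMz
  have hmax : IsLocalMax g z := by
    filter_upwards [hgf, hΩ.mem_nhds hzΩ] with y hy hyΩ
    exact hy.trans ((hzm (subset_closure hyΩ)).trans hg.ge)
  obtain ⟨h1, h2, h3⟩ := lapR_nonpos_of_isLocalMax hg2 hmax
  exact absurd (hgl h1 h2) (not_lt.2 h3)

/-- Maximum principle for strictly subharmonic functions. -/
lemma le_of_lapR_pos {Ω : Set ℂ} (hΩ : IsOpen Ω) (hb : IsBounded Ω) {f : ℂ → ℝ} {M : ℝ}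
    (hf : ContinuousOn f (closure Ω)) (hfr : ∀ x ∈ frontier Ω, f x ≤ M)
    (H : ∀ x ∈ Ω, ContDiffAt ℝ 2 f x ∧ (fderiv ℝ f x 1 = 0 → fderiv ℝ f x I = 0 → 0 < lapR f x)) :
    ∀ x ∈ closure Ω, f x ≤ M :=
  le_of_touching hΩ hb hf hfr fun x hx _ =>
    ⟨f, rfl, Eventually.of_forall fun _ => le_rfl, (H x hx).1, (H x hx).2⟩

lemma scomp_at {f : ℂ → ℝ} {x : ℂ} (hf : ContDiffAt ℝ 2 f x) {V V' : ℝ → ℝ} {c : ℝ}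
    (hVs : ContDiffAt ℝ 2 V (f x)) (hV : ∀ᶠ r in 𝓝 (f x), HasDerivAt V (V' r) r)
    (hV' : HasDerivAt V' c (f x)) :
    (∀ e, fderiv ℝ (fun y => V (f y)) x e = V' (f x) * fderiv ℝ f x e) ∧
    lapR (fun y => V (f y)) x = V' (f x) * lapR f x + c * gradNormSq f x := by
  have hVf : ContDiffAt ℝ 2 (fun y => V (f y)) x := hVs.comp x hf
  have h := fun e => dd_eq_of_hasJet hVf ((hasJet_line hf e).scomp hV hV')
  refine ⟨fun e => by rw [(h e).1, smul_eq_mul, mul_comm], ?_⟩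
  rw [lapR_eq, (h 1).2, (h I).2, lapR_eq, gradNormSq]
  simp only [smul_eq_mul]; ring

lemma lapR_exp {f : ℂ → ℝ} {x : ℂ} (hf : ContDiffAt ℝ 2 f x) (C : ℝ) :
    lapR (fun y => Real.exp (C * f y)) x =
      Real.exp (C * f x) * (C * lapR f x + C ^ 2 * gradNormSq f x) := by
  have h1 : ∀ r : ℝ, HasDerivAt (fun r => Real.exp (C * r)) (C * Real.exp (C * r)) r := fun r =>
    (((hasDerivAt_id r).const_mul C).exp).congr_deriv (by simp; ring)
  have := (scomp_at hf (V := fun r => Real.exp (C * r)) (V' := fun r => C * Real.exp (C * r))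
    (by fun_prop) (Eventually.of_forall h1) ((h1 (f x)).const_mul C)).2
  rw [this]; ring

/-- The squared distance to a point. -/
def distSq (c x : ℂ) : ℝ := ‖x - c‖ ^ 2

lemma distSq_eq (c x : ℂ) : distSq c x = (x.re - c.re) ^ 2 + (x.im - c.im) ^ 2 := by
  rw [distSq, norm_sq_re_im]; simp

lemma distSq_contDiff (c : ℂ) : ContDiff ℝ (⊤ : ℕ∞) (distSq c) := by
  unfold distSq
  exact (contDiff_id.sub contDiff_const).norm_sq ℝ

lemma distSq_contDiffAt (c x : ℂ) : ContDiffAt ℝ 2 (distSq c) x :=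
  ((distSq_contDiff c).of_le two_le_smooth).contDiffAt

lemma distSq_jet (c x e : ℂ) : fderiv ℝ (distSq c) x e = 2 * ip (x - c) e ∧
    dd (distSq c) e x = 2 * ‖e‖ ^ 2 := by
  refine dd_eq_of_hasJet (distSq_contDiffAt c x) ?_ (v := distSq c x)
  have h := hasJet_line_id x e
  have h1 := (h.clm reCLM).sub (hasJet_const (c.re))
  have h2 := (h.clm imCLM).sub (hasJet_const (c.im))
  refine ((h1.mul h1).add (h2.mul h2)).cast (fun s => ?_) ?_ ?_ ?_
  · rw [distSq_eq]; simp; ring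
  · rw [distSq_eq]; simp; ring
  · simp [ip]; ring
  · rw [norm_sq_re_im]; simp; ring

lemma lapR_distSq (c x : ℂ) : lapR (distSq c) x = 4 := by
  rw [lapR_eq, (distSq_jet c x 1).2, (distSq_jet c x I).2]; norm_num

lemma gradNormSq_distSq (c x : ℂ) : gradNormSq (distSq c) x = 4 * distSq c x := by
  rw [gradNormSq, (distSq_jet c x 1).1, (distSq_jet c x I).1, distSq_eq]; simp [ip]; ring

lemma distSq_pos {c x : ℂ} (h : x ≠ c) : 0 < distSq c x := by
  have : 0 < ‖x - c‖ := norm_pos_iff.2 (sub_ne_zero.2 h)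
  unfold distSq; positivity

/-- The exterior barrier is superharmonic. -/
lemma lapR_inv_distSq {c x : ℂ} (h : x ≠ c) : ContDiffAt ℝ 2 (fun y => -(distSq c y)⁻¹) x ∧
    lapR (fun y => -(distSq c y)⁻¹) x = -4 / distSq c x ^ 2 := by
  have hp := distSq_pos h
  have hd : ∀ r : ℝ, r ≠ 0 → HasDerivAt (fun r : ℝ => -r⁻¹) ((r ^ 2)⁻¹) r := fun r hr =>
    ((hasDerivAt_inv hr).neg).congr_deriv (by simp)
  have hd2 : HasDerivAt (fun r : ℝ => (r ^ 2)⁻¹) (-2 / distSq c x ^ 3) (distSq c x) := by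
    refine ((hasDerivAt_pow 2 (distSq c x)).fun_inv (by positivity)).congr_deriv ?_
    field_simp; norm_num; ring
  have hV : ContDiffAt ℝ 2 (fun r : ℝ => -r⁻¹) (distSq c x) := (contDiffAt_inv ℝ hp.ne').neg
  refine ⟨hV.comp x (distSq_contDiffAt c x), ?_⟩
  rw [(scomp_at (distSq_contDiffAt c x) hV ?_ hd2).2, lapR_distSq, gradNormSq_distSq]
  · field_simp; ring
  · filter_upwards [isOpen_ne.mem_nhds hp.ne'] with r hr using hd r hr

/-- The logarithm is harmonic. -/
lemma lapR_log_distSq {c x : ℂ} (h : x ≠ c) : ContDiffAt ℝ 2 (fun y => Real.log (distSq c y)) x ∧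
    lapR (fun y => Real.log (distSq c y)) x = 0 := by
  have hp := distSq_pos h
  have hV : ContDiffAt ℝ 2 Real.log (distSq c x) := Real.contDiffAt_log.2 hp.ne'
  refine ⟨hV.comp x (distSq_contDiffAt c x), ?_⟩
  rw [(scomp_at (distSq_contDiffAt c x) hV (V' := fun r => r⁻¹) ?_ (hasDerivAt_inv hp.ne')).2,
    lapR_distSq, gradNormSq_distSq]
  · field_simp; ring
  · filter_upwards [isOpen_ne.mem_nhds hp.ne'] with r hr using Real.hasDerivAt_log hr

end MaxTools

/-- A solution in tubular coordinates, with Dirichlet condition `t = 0`, `φ = ζ`. -/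
structure DirSol (γ : ℝ → ℂ) (W : ℂ → ℝ) (Ω : Set ℂ) (δ₁ : ℝ) (ζ : ℂ → ℝ) (l : ℝ) (u : ℂ → ℂ)
    (t φ : ℂ → ℝ) : Prop extends PolarSol γ W Ω δ₁ l u t φ where
  bdry_t : ∀ x ∈ frontier Ω, t x = 0
  bdry_φ : ∀ x ∈ frontier Ω, φ x = ζ x

/-- The standing assumptions on the target curve, the potential, the domain and the boundary
datum. -/
structure Setting (γ : ℝ → ℂ) (L : ℝ) (W : ℂ → ℝ) (Ω : Set ℂ) (δ₁ m : ℝ) (ζ : ℂ → ℝ) : Prop where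
  loop : IsLoop γ L
  maxp : MaxPrinciple (range γ) γ W δ₁ m
  smooth_W : ContDiff ℝ (⊤ : ℕ∞) W
  δpos : 0 < δ₁
  mpos : 0 < m
  isOpen : IsOpen Ω
  bounded : IsBounded Ω
  nonempty : Ω.Nonempty
  sc : SimplyConnectedSpace ↥Ω
  smooth_bd : ∃ σ L', IsLoop σ L' ∧ range σ = frontier Ω
  smooth_ζ : ContDiff ℝ (⊤ : ℕ∞) ζ
  harm : ∀ x ∈ Ω, lapR ζ x = 0

section Dir

variable {γ : ℝ → ℂ} {L : ℝ} {W : ℂ → ℝ} {Ω : Set ℂ} {δ₁ l m : ℝ} {u : ℂ → ℂ} {t φ ζ : ℂ → ℝ} {x : ℂ}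

lemma lapR_neg (f : ℂ → ℝ) (x : ℂ) : lapR (fun y => -f y) x = -lapR f x := by
  have h : ∀ e, (fun y => fderiv ℝ (fun y => -f y) y e) = fun y => -(fderiv ℝ f y e) := fun e => by
    funext y; simp
  simp only [lapR, h]; simp; ring

lemma Setting.reflect (S : Setting γ L W Ω δ₁ m ζ) :
    Setting (fun s => γ (-s)) L W Ω δ₁ m (fun x => -ζ x) where
  loop := S.loop.reflect
  maxp := by
    have := S.maxp.reflect
    rwa [range_reflect]
  smooth_W := S.smooth_W
  δpos := S.δpos
  mpos := S.mpos
  isOpen := S.isOpen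
  bounded := S.bounded
  nonempty := S.nonempty
  sc := S.sc
  smooth_bd := S.smooth_bd
  smooth_ζ := S.smooth_ζ.neg
  harm := fun x hx => by rw [lapR_neg, S.harm x hx, neg_zero]

lemma DirSol.reflect (h : DirSol γ W Ω δ₁ ζ l u t φ) :
    DirSol (fun s => γ (-s)) W Ω δ₁ (fun x => -ζ x) l u (fun x => -t x) (fun x => -φ x) where
  toPolarSol := h.toPolarSol.reflect
  bdry_t := fun x hx => by rw [h.bdry_t x hx, neg_zero]
  bdry_φ := fun x hx => by rw [h.bdry_φ x hx]

lemma DirSol.phase_le (h : DirSol γ W Ω δ₁ ζ l u t φ) (S : Setting γ L W Ω δ₁ m ζ) {Z : ℝ}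
    (hZ : ∀ x ∈ closure Ω, |ζ x| ≤ Z) (hx : x ∈ closure Ω) : φ x ≤ Z := by
  have hl := h.lpos
  have hdec : PhaseDecomp (range γ) γ (closure Ω) u t φ :=
    ⟨h.cont_t, h.cont_φ, fun x hx => ⟨h.polar x hx, h.dist x hx⟩⟩
  have hε : (((Real.sqrt l)⁻¹) ^ 2)⁻¹ = l := by
    rw [inv_pow, inv_inv, Real.sq_sqrt hl.le]
  have H := (S.maxp Ω (Real.sqrt l)⁻¹ u t φ h.isOpen h.bounded S.nonempty S.sc (by positivity)
    h.smooth_u.contDiffOn h.smooth_u.continuous.continuousOn (fun x hx => by rw [hε]; exact h.pde x hx)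
    (fun x hx => by rw [← h.dist x hx]; exact h.le x hx) hdec).2
  have hc : ContinuousOn (fun x => φ x + m * t x ^ 2 / 2) (closure Ω) :=
    h.cont_φ.add ((continuousOn_const.mul (h.cont_t.pow 2)).div_const _)
  have h1 : φ x + m * t x ^ 2 / 2 ≤ sSup ((fun x => φ x + m * t x ^ 2 / 2) '' closure Ω) :=
    le_csSup (h.bounded.isCompact_closure.image_of_continuousOn hc).bddAbove ⟨x, hx, rfl⟩
  rw [H] at h1
  have h2 : sSup ((fun x => φ x + m * t x ^ 2 / 2) '' frontier Ω) ≤ Z := by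
    refine Real.sSup_le ?_ ((abs_nonneg _).trans (hZ x hx))
    rintro _ ⟨y, hy, rfl⟩
    simp only [h.bdry_t y hy, h.bdry_φ y hy]
    have := (abs_le.1 (hZ y (frontier_subset_closure hy))).2
    simpa using this
  have := S.mpos
  have : 0 ≤ m * t x ^ 2 / 2 := by positivity
  linarith

lemma DirSol.abs_phase_le (h : DirSol γ W Ω δ₁ ζ l u t φ) (S : Setting γ L W Ω δ₁ m ζ) {Z : ℝ}
    (hZ : ∀ x ∈ closure Ω, |ζ x| ≤ Z) (hx : x ∈ closure Ω) : |φ x| ≤ Z :=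
  abs_le.2 ⟨by linarith [h.reflect.phase_le S.reflect (fun y hy => by rw [abs_neg]; exact hZ y hy) hx],
    h.phase_le S hZ hx⟩

lemma Setting.exists_bound_of_continuous (S : Setting γ L W Ω δ₁ m ζ) {f : ℂ → ℝ}
    (hf : Continuous f) : ∃ Z > 0, ∀ x ∈ closure Ω, |f x| ≤ Z := by
  obtain ⟨Z, hZ⟩ := S.bounded.isCompact_closure.exists_bound_of_continuousOn hf.continuousOn
  exact ⟨max Z 1, by positivity, fun x hx => (hZ x hx).trans (le_max_left _ _)⟩

lemma Setting.exists_curv_bounds (S : Setting γ L W Ω δ₁ m ζ) :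
    ∃ K > 0, (∀ s, |curv γ s| ≤ K) ∧ ∀ s, |deriv (curv γ) s| ≤ K := by
  obtain ⟨K, hK, h1⟩ := S.loop.exists_bound S.loop.curv_smooth.continuous S.loop.curv_periodic
  obtain ⟨K', hK', h2⟩ := S.loop.exists_bound S.loop.curv_smooth.deriv_smooth.continuous
    (IsLoop.deriv_periodic S.loop.curv_periodic)
  exact ⟨max K K', by positivity, fun s => (h1 s).trans (le_max_left _ _),
    fun s => (h2 s).trans (le_max_right _ _)⟩

/-- A uniformly bounded, uniformly strictly subharmonic function of the tubular coordinates. -/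
theorem Setting.exists_aux (S : Setting γ L W Ω δ₁ m ζ) :
    ∃ (P : ℝ → ℝ) (C : ℝ), ContDiff ℝ (⊤ : ℕ∞) P ∧ P 0 = 0 ∧ (∀ s, 0 ≤ P s) ∧ 0 < C ∧
      ∃ c > 0, ∃ B > 0, ∀ l u t φ, DirSol γ W Ω δ₁ ζ l u t φ →
        ContinuousOn (fun y => Real.exp (C * (φ y + P (t y)))) (closure Ω) ∧
        ContDiffOn ℝ (⊤ : ℕ∞) (fun y => Real.exp (C * (φ y + P (t y)))) Ω ∧
        (∀ x ∈ closure Ω, Real.exp (C * (φ x + P (t x))) ≤ B) ∧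
        ∀ x ∈ Ω, c * (gradNormSq φ x + gradNormSq t x + l * forcing γ W u t φ x) ≤
          lapR (fun y => Real.exp (C * (φ y + P (t y)))) x := by
  obtain ⟨K, hK, hκ, hκ'⟩ := S.exists_curv_bounds
  obtain ⟨P, hP, hP0, hPn, C, hC, c, hc, H⟩ := exists_strict hK hK S.δpos S.mpos
  obtain ⟨Z, hZ0, hZ⟩ := S.exists_bound_of_continuous S.smooth_ζ.continuous
  obtain ⟨N, hN⟩ := (isCompact_Icc (a := -δ₁) (b := δ₁)).exists_bound_of_continuousOn
    hP.continuous.continuousOn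
  refine ⟨P, C, hP, hP0, hPn, hC, Real.exp (-(C * Z)) * c, by positivity, Real.exp (C * (Z + N)),
    by positivity, fun l u t φ h => ⟨?_, ?_, fun x hx => ?_, fun x hx => ?_⟩⟩
  · exact (continuousOn_const.mul (h.cont_φ.add (hP.continuous.comp_continuousOn h.cont_t))).rexp
  · exact (contDiffOn_const.mul (h.smooth_φ.add (hP.comp_contDiffOn h.smooth_t))).exp
  · have h1 := h.phase_le S hZ hx
    have h2 := (le_abs_self _).trans (hN (t x) (abs_le.1 (h.le x hx)))
    gcongr
  · have h1 := H γ L W S.loop hκ hκ' S.maxp S.smooth_W Ω l u t φ h.toPolarSol x hx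
    have hc2 : ContDiffAt ℝ 2 (fun y => φ y + P (t y)) x :=
      (h.contDiffAt_φ hx).add (((hP.of_le two_le_smooth).contDiffAt).comp x (h.contDiffAt_t hx))
    rw [lapR_exp hc2]
    have h2 := (abs_le.1 (h.abs_phase_le S hZ (subset_closure hx))).1
    have h3 := hPn (t x)
    have h4 : Real.exp (-(C * Z)) ≤ Real.exp (C * (φ x + P (t x))) := by
      rw [← mul_neg]; gcongr; linarith
    have h5 := (h.tube S.loop S.maxp S.smooth_W S.δpos S.mpos (subset_closure hx)).2.2.2
    have h6 : 0 ≤ c * (gradNormSq φ x + gradNormSq t x + l * forcing γ W u t φ x) := by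
      have := gradNormSq_nonneg φ x
      have := gradNormSq_nonneg t x
      have := h.lpos
      positivity
    calc _ = Real.exp (-(C * Z)) * (c * (gradNormSq φ x + gradNormSq t x +
          l * forcing γ W u t φ x)) := by ring
      _ ≤ _ := mul_le_mul h4 h1 h6 (by positivity)

end Dir

section Barrier

variable {γ : ℝ → ℂ} {L : ℝ} {W : ℂ → ℝ} {Ω : Set ℂ} {δ₁ l m : ℝ} {u : ℂ → ℂ} {t φ ζ : ℂ → ℝ} {x : ℂ}

lemma PolarSol.exists_sign (h : PolarSol γ W Ω δ₁ l u t φ) (hγ : IsLoop γ L)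
    (hmax : MaxPrinciple (range γ) γ W δ₁ m) (hW : ContDiff ℝ (⊤ : ℕ∞) W) (hδ : 0 < δ₁) (hm : 0 < m)
    {K : ℝ} (hK : ∀ s, |curv γ s| ≤ K) (hx : x ∈ Ω) :
    ∃ s : ℝ, |s| ≤ 1 ∧ s * t x = |t x| ∧ -((1 + K * δ₁) * K * gradNormSq φ x) ≤ s * lapR t x := by
  obtain ⟨-, -, e2⟩ := h.equations hγ hx
  obtain ⟨t1, -, -, t4⟩ := h.tube hγ hmax hW hδ hm (subset_closure hx)
  have ht := h.le x (subset_closure hx)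
  have hκ := hK (φ x)
  have hK0 := (abs_nonneg _).trans hκ
  have hl := h.lpos
  simp only [forcing] at t4
  obtain ⟨s, hs, hst, hsY⟩ : ∃ s : ℝ, |s| ≤ 1 ∧ s * t x = |t x| ∧
      0 ≤ s * ip (gradW W (u x)) (I * deriv γ (φ x)) := by
    rcases lt_trichotomy (t x) 0 with h0 | h0 | h0
    · exact ⟨-1, by norm_num, by rw [abs_of_neg h0]; ring, by nlinarith⟩
    · exact ⟨0, by norm_num, by simp [h0], by simp⟩
    · exact ⟨1, by norm_num, by rw [abs_of_pos h0]; ring, by nlinarith⟩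
  refine ⟨s, hs, hst, ?_⟩
  have h1 : 1 - curv γ (φ x) * t x ≤ 1 + K * δ₁ := by
    have : |curv γ (φ x) * t x| ≤ K * δ₁ := by rw [abs_mul]; gcongr
    linarith [(abs_le.1 this).1]
  have h2 : |s * ((1 - curv γ (φ x) * t x) * curv γ (φ x))| ≤ 1 * ((1 + K * δ₁) * K) := by
    rw [abs_mul, abs_mul, abs_of_pos (by linarith : 0 < 1 - curv γ (φ x) * t x)]
    have := h.lpos
    gcongr
  have h3 := mul_le_mul_of_nonneg_right (abs_le.1 h2).2 (gradNormSq_nonneg φ x)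
  have h4 : 0 ≤ l * (s * ip (gradW W (u x)) (I * deriv γ (φ x))) := by positivity
  rw [e2]
  linarith

lemma exterior_barrier_le {c x y : ℂ} {r : ℝ} (hr : 0 < r) (hy : ‖y - c‖ = r) (hx : r ≤ ‖x - c‖) :
    (r ^ 2)⁻¹ + -(distSq c x)⁻¹ ≤ 2 / r ^ 3 * ‖x - y‖ := by
  have h1 : ‖x - c‖ ≤ ‖x - y‖ + r := by
    rw [← hy]; exact (norm_sub_le_norm_sub_add_norm_sub x y c)
  unfold distSq
  generalize ‖x - c‖ = d at *
  generalize ‖x - y‖ = n at *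
  have hd : 0 < d := hr.trans_le hx
  have h2 : (d - r) * (d + r) * r ≤ n * (2 * d ^ 2) := by
    have : (d + r) * r ≤ 2 * d ^ 2 := by nlinarith
    calc (d - r) * (d + r) * r = (d - r) * ((d + r) * r) := by ring
      _ ≤ n * (2 * d ^ 2) := mul_le_mul (by linarith) this (by positivity) (by linarith)
  have h3 : (r ^ 2)⁻¹ + -(d ^ 2)⁻¹ = ((d - r) * (d + r) * r) / (r ^ 3 * d ^ 2) := by
    field_simp; ring
  rw [h3, div_le_iff₀ (by positivity)]
  calc _ ≤ n * (2 * d ^ 2) := h2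
    _ = _ := by field_simp

/-- One-sided boundary barrier estimate. -/
theorem Setting.barrier_half (S : Setting γ L W Ω δ₁ m ζ) :
    ∃ C > 0, ∃ η > 0, ∃ K > 0, ∀ l u t φ, DirSol γ W Ω δ₁ ζ l u t φ →
      ∀ y ∈ frontier Ω, ∀ x ∈ closure Ω,
      Real.exp (C * φ x) + η * |t x| ≤ Real.exp (C * ζ x) + K * ‖x - y‖ := by
  obtain ⟨k, hk, hκ, -⟩ := S.exists_curv_bounds
  obtain ⟨P, C, hP, hP0, hPn, hC, c, hc, B, hB, H⟩ := S.exists_aux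
  obtain ⟨σ, L', hσ, hσr⟩ := S.smooth_bd
  obtain ⟨r, hr, hext⟩ := exists_exterior_balls S.isOpen S.bounded S.nonempty hσ hσr
  obtain ⟨M₀, hM₀, hM⟩ := S.exists_bound_of_continuous
    (f := fun x => Real.exp (C * ζ x) * (C ^ 2 * gradNormSq ζ x)) (by
      have h1 := (S.smooth_ζ.fderiv_dir 1).continuous
      have h2 := (S.smooth_ζ.fderiv_dir I).continuous
      have h3 := S.smooth_ζ.continuous
      unfold gradNormSq
      fun_prop)
  obtain ⟨R, hR⟩ := S.bounded.closure.subset_closedBall 0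
  have hRn : ∀ x ∈ closure Ω, ‖x‖ ≤ R := fun x hx => by simpa using hR hx
  obtain ⟨x₀, hx₀⟩ := S.nonempty
  have hR0 : 0 ≤ R := (norm_nonneg _).trans (hRn x₀ (subset_closure hx₀))
  obtain ⟨D, hD⟩ : ∃ D, D = 2 * R + r := ⟨_, rfl⟩
  have hD0 : 0 < D := by rw [hD]; positivity
  obtain ⟨K, hK⟩ : ∃ K, K = (M₀ + 1) * D ^ 4 / 4 := ⟨_, rfl⟩
  have hK0 : 0 < K := by rw [hK]; positivity
  obtain ⟨η, hη⟩ : ∃ η, η = c / ((1 + k * δ₁) * k) := ⟨_, rfl⟩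
  have hδ := S.δpos
  have hη0 : 0 < η := by rw [hη]; positivity
  have hηk : η * ((1 + k * δ₁) * k) = c := by rw [hη]; field_simp
  refine ⟨C, hC, η, hη0, K * (2 / r ^ 3), by positivity, fun l u t φ h y hy x hx => ?_⟩
  obtain ⟨w1, w2, w3, w4⟩ := H l u t φ h
  obtain ⟨e, hye, hxe⟩ := hext y hy
  have hne : ∀ x ∈ closure Ω, x ≠ e := fun x hx hxe' => by
    have := hxe x hx; rw [hxe'] at this; simp at this; linarith
  have hde : ∀ x ∈ closure Ω, distSq e x ≤ D ^ 2 := fun x hx => by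
    have h1 : ‖x - e‖ ≤ ‖x - y‖ + ‖y - e‖ := norm_sub_le_norm_sub_add_norm_sub x y e
    have h2 := norm_sub_le x y
    have h3 := hRn x hx
    have h4 := hRn y (frontier_subset_closure hy)
    unfold distSq
    gcongr; linarith
  obtain ⟨w, hw⟩ : ∃ w : ℂ → ℝ, w = fun y => Real.exp (C * (φ y + P (t y))) := ⟨_, rfl⟩
  simp only [← hw] at w1 w2 w4
  have hζc := S.smooth_ζ.continuous
  have key : ∀ x ∈ closure Ω, (w x + η * |t x|) - (Real.exp (C * ζ x) +
      K * ((r ^ 2)⁻¹ + -(distSq e x)⁻¹)) ≤ 0 := by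
    refine le_of_touching S.isOpen S.bounded ?_ ?_ ?_
    · have hdc : ContinuousOn (fun x => (distSq e x)⁻¹) (closure Ω) :=
        (distSq_contDiff e).continuous.continuousOn.inv₀ fun x hx => (distSq_pos (hne x hx)).ne'
      have h1 : ContinuousOn (fun x => |t x|) (closure Ω) := h.cont_t.abs
      fun_prop
    · intro z hz
      have h1 : r ^ 2 ≤ distSq e z := by
        have := hxe z (frontier_subset_closure hz)
        unfold distSq; gcongr
      have h2 : (distSq e z)⁻¹ ≤ (r ^ 2)⁻¹ := by gcongr
      have h3 : 0 ≤ K * ((r ^ 2)⁻¹ + -(distSq e z)⁻¹) := mul_nonneg hK0.le (by linarith)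
      simp only [hw, h.bdry_t z hz, h.bdry_φ z hz, hP0, add_zero, abs_zero, mul_zero]
      linarith
    · intro z hz _
      obtain ⟨s, hs, hst, hsl⟩ := h.exists_sign S.loop S.maxp S.smooth_W S.δpos S.mpos hκ hz
      have c1 : ContDiffAt ℝ 2 w z :=
        (w2.contDiffAt (S.isOpen.mem_nhds hz)).of_le two_le_smooth
      have c2 := h.contDiffAt_t hz
      have c2' : ContDiffAt ℝ 2 (fun y => (s * η) * t y) z := contDiffAt_const.mul c2
      have c3 : ContDiffAt ℝ 2 ζ z := (S.smooth_ζ.of_le two_le_smooth).contDiffAt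
      have c3' : ContDiffAt ℝ 2 (fun y => Real.exp (C * ζ y)) z := (contDiffAt_const.mul c3).exp
      obtain ⟨c4, l4⟩ := lapR_inv_distSq (hne z (subset_closure hz))
      have c4' : ContDiffAt ℝ 2 (fun y => (r ^ 2)⁻¹ + -(distSq e y)⁻¹) z := contDiffAt_const.add c4
      have c4'' : ContDiffAt ℝ 2 (fun y => K * ((r ^ 2)⁻¹ + -(distSq e y)⁻¹)) z :=
        contDiffAt_const.mul c4'
      refine ⟨fun y => (w y + (s * η) * t y) - (Real.exp (C * ζ y) +
        K * ((r ^ 2)⁻¹ + -(distSq e y)⁻¹)), ?_, ?_, (c1.add c2').sub (c3'.add c4''), ?_⟩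
      · simp only [← hst]; ring
      · refine Eventually.of_forall fun y => ?_
        have h1 : s * t y ≤ |t y| := by
          refine (le_abs_self _).trans ?_
          rw [abs_mul]
          exact mul_le_of_le_one_left (abs_nonneg _) hs
        have h2 : s * η * t y ≤ η * |t y| := by
          rw [mul_comm s η, mul_assoc]; gcongr
        linarith
      · intro _ _
        rw [lapR_sub (c1.add c2') (c3'.add c4''), lapR_add c1 c2', lapR_add c3' c4'',
          lapR_const_mul _ c2, lapR_const_mul _ c4', lapR_add contDiffAt_const c4, l4,
          lapR_exp c3, S.harm z hz]
        have h1 := w4 z hz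
        have h2 := (abs_le.1 (hM z (subset_closure hz))).2
        have h3 := (h.tube S.loop S.maxp S.smooth_W S.δpos S.mpos (subset_closure hz)).2.2.2
        have h4 := gradNormSq_nonneg t z
        have h5 := h.lpos
        have h6 : -(c * gradNormSq φ z) ≤ η * (s * lapR t z) := by
          rw [← hηk, mul_assoc, ← mul_neg]; gcongr
        have h7 : 0 ≤ c * (gradNormSq t z + l * forcing γ W u t φ z) := by positivity
        have h8 : 0 < distSq e z := distSq_pos (hne z (subset_closure hz))
        have h9 : M₀ + 1 ≤ K * (4 / distSq e z ^ 2) := by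
          rw [hK]
          have : distSq e z ^ 2 ≤ D ^ 4 := by
            calc distSq e z ^ 2 ≤ (D ^ 2) ^ 2 := by gcongr; exact hde z (subset_closure hz)
              _ = D ^ 4 := by ring
          have h10 : 1 ≤ D ^ 4 / distSq e z ^ 2 := by
            rw [le_div_iff₀ (by positivity)]; linarith
          calc M₀ + 1 = (M₀ + 1) * 1 := by ring
            _ ≤ (M₀ + 1) * (D ^ 4 / distSq e z ^ 2) := by gcongr
            _ = _ := by field_simp
        have h11 : lapR (fun _ : ℂ => (r ^ 2)⁻¹) z = 0 := by simp [lapR]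
        rw [h11]
        have h12 : K * (0 + -4 / distSq e z ^ 2) = -(K * (4 / distSq e z ^ 2)) := by ring
        rw [h12]
        linarith
  have h1 := key x hx
  have h2 := exterior_barrier_le hr hye (hxe x hx)
  have h3 : Real.exp (C * φ x) ≤ w x := by
    rw [hw]
    have := hPn (t x)
    simp only
    gcongr; linarith
  have h4 : K * ((r ^ 2)⁻¹ + -(distSq e x)⁻¹) ≤ K * (2 / r ^ 3 * ‖x - y‖) := by gcongr
  linarith

/-- Boundary barrier estimate. -/
theorem Setting.barrier (S : Setting γ L W Ω δ₁ m ζ) :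
    ∃ K > 0, ∀ l u t φ, DirSol γ W Ω δ₁ ζ l u t φ →
      ∀ y ∈ frontier Ω, ∀ x ∈ closure Ω, |φ x - ζ x| ≤ K * ‖x - y‖ ∧ |t x| ≤ K * ‖x - y‖ := by
  obtain ⟨C, hC, η, hη, K, hK, H⟩ := S.barrier_half
  obtain ⟨C', hC', η', hη', K', hK', H'⟩ := S.reflect.barrier_half
  obtain ⟨Z, hZ0, hZ⟩ := S.exists_bound_of_continuous S.smooth_ζ.continuous
  have aux : ∀ C K p q n : ℝ, 0 < C → |q| ≤ Z → Real.exp (C * p) ≤ Real.exp (C * q) + K * n →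
      0 ≤ K * n → p - q ≤ Real.exp (C * Z) / C * K * n := by
    intro C K p q n hC hq h hn
    have h1 : C * (p - q) + 1 ≤ Real.exp (C * (p - q)) := Real.add_one_le_exp _
    have h2 : Real.exp (C * p) = Real.exp (C * q) * Real.exp (C * (p - q)) := by
      rw [← Real.exp_add]; congr 1; ring
    have h3 := Real.exp_pos (C * q)
    have h4 : Real.exp (C * q) * (C * (p - q)) ≤ K * n := by
      have := mul_le_mul_of_nonneg_left h1 h3.le
      linarith
    have h5 : 1 ≤ Real.exp (C * Z) * Real.exp (C * q) := by
      rw [← Real.exp_add]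
      exact Real.one_le_exp (by nlinarith [(abs_le.1 hq).1])
    rcases le_or_gt (p - q) 0 with h0 | h0
    · refine h0.trans ?_
      have := Real.exp_pos (C * Z)
      rw [mul_assoc]; positivity
    · have h6 : C * (p - q) ≤ Real.exp (C * Z) * (K * n) :=
        calc C * (p - q) = 1 * (C * (p - q)) := by ring
          _ ≤ (Real.exp (C * Z) * Real.exp (C * q)) * (C * (p - q)) := by gcongr
          _ = Real.exp (C * Z) * (Real.exp (C * q) * (C * (p - q))) := by ring
          _ ≤ _ := by gcongr
      have h7 : p - q ≤ Real.exp (C * Z) * (K * n) / C := by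
        rw [le_div_iff₀ hC]; linarith
      exact h7.trans (le_of_eq (by ring))
  obtain ⟨K₁, hK₁⟩ : ∃ k, k = Real.exp (C * Z) / C * K := ⟨_, rfl⟩
  obtain ⟨K₂, hK₂⟩ : ∃ k, k = Real.exp (C' * Z) / C' * K' := ⟨_, rfl⟩
  have hK₁0 : 0 < K₁ := by rw [hK₁]; positivity
  have hK₂0 : 0 < K₂ := by rw [hK₂]; positivity
  obtain ⟨K₃, hK₃⟩ : ∃ k, k = (K + Real.exp (C * Z) * C * K₂) / η := ⟨_, rfl⟩
  have hK₃0 : 0 < K₃ := by rw [hK₃]; positivity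
  refine ⟨K₁ + K₂ + K₃, by positivity, fun l u t φ h y hy x hx => ?_⟩
  have h1 := H l u t φ h y hy x hx
  have h2 := H' l u _ _ h.reflect y hy x hx
  have hn := norm_nonneg (x - y)
  generalize ‖x - y‖ = n at *
  have hz := hZ x hx
  have hat := abs_nonneg (t x)
  have a1 : φ x - ζ x ≤ K₁ * n := hK₁ ▸ aux C K _ _ n hC hz (by nlinarith) (by positivity)
  have a2 : ζ x - φ x ≤ K₂ * n := by
    have := aux C' K' (-φ x) (-ζ x) n hC' (by rwa [abs_neg]) (by rw [abs_neg] at h2; nlinarith)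
      (by positivity)
    rw [hK₂]; linarith
  have a3 : |t x| ≤ K₃ * n := by
    have h3 : C * (φ x - ζ x) + 1 ≤ Real.exp (C * (φ x - ζ x)) := Real.add_one_le_exp _
    have h4 : Real.exp (C * φ x) = Real.exp (C * ζ x) * Real.exp (C * (φ x - ζ x)) := by
      rw [← Real.exp_add]; congr 1; ring
    have h5 := Real.exp_pos (C * ζ x)
    have h6 : Real.exp (C * ζ x) ≤ Real.exp (C * Z) := by
      gcongr; exact (abs_le.1 hz).2
    have h7 : Real.exp (C * ζ x) * (C * (ζ x - φ x)) ≤ Real.exp (C * Z) * (C * (K₂ * n)) := by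
      calc _ ≤ Real.exp (C * ζ x) * (C * (K₂ * n)) := by gcongr
        _ ≤ _ := by gcongr
    have h8 := mul_le_mul_of_nonneg_left h3 h5.le
    have h9 : |t x| * η ≤ (K + Real.exp (C * Z) * C * K₂) * n := by linarith
    rw [hK₃, div_mul_eq_mul_div, le_div_iff₀ hη]
    exact h9
  have p1 : 0 ≤ K₁ * n := by positivity
  have p2 : 0 ≤ K₂ * n := by positivity
  have p3 : 0 ≤ K₃ * n := by positivity
  refine ⟨abs_le.2 ⟨by linarith, by linarith⟩, by linarith⟩

end Barrier

section Bernstein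

lemma lapR_cutoff {x₀ x : ℂ} {r : ℝ} :
    (∀ e, fderiv ℝ (fun y => 1 - distSq x₀ y / r ^ 2) x e = -(2 * ip (x - x₀) e) / r ^ 2) ∧
    lapR (fun y => 1 - distSq x₀ y / r ^ 2) x = -4 / r ^ 2 ∧
    ContDiffAt ℝ 2 (fun y => 1 - distSq x₀ y / r ^ 2) x := by
  have hd := distSq_contDiffAt x₀ x
  have h1 : ∀ s : ℝ, HasDerivAt (fun s : ℝ => 1 - s / r ^ 2) (-(1 / r ^ 2)) s := fun s =>
    ((hasDerivAt_id s).div_const _).const_sub 1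
  have hV : ContDiffAt ℝ 2 (fun s : ℝ => 1 - s / r ^ 2) (distSq x₀ x) := by fun_prop
  obtain ⟨a, b⟩ := scomp_at hd hV (Eventually.of_forall h1) (hasDerivAt_const _ _)
  refine ⟨fun e => ?_, ?_, hV.comp x hd⟩
  · rw [a, (distSq_jet x₀ x e).1]; ring
  · rw [b, lapR_distSq]; ring

lemma bernstein_algebra {η η1 η2 E E1 E2 S LE LV M α β Λ c k ρ : ℝ} (hη0 : 0 ≤ η) (hη1 : η ≤ 1)
    (hρ : 0 < ρ) (hgη : η1 ^ 2 + η2 ^ 2 ≤ 4 / ρ) (E0 : 0 ≤ E) (S0 : 0 ≤ S)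
    (gE : E1 ^ 2 + E2 ^ 2 ≤ 4 * S * E) (lE : S - α * E - β * E ^ 2 ≤ LE) (lV : c * E - k ≤ LV)
    (hM : η ^ 2 * E ≤ M) (hα : 0 ≤ α) (hβ : 0 ≤ β) (hΛ : 0 < Λ) (hk : 0 < k)
    (hΛc : Λ * c = α + β * M + 72 / ρ) :
    0 < η ^ 2 * LE + E * (2 * η * (-4 / ρ) + 2 * (η1 ^ 2 + η2 ^ 2)) +
      2 * ((2 * η * η1) * E1 + (2 * η * η2) * E2) + Λ * (LV + k * 4) := by
  have hq : |4 * η * (η1 * E1 + η2 * E2)| ≤ η ^ 2 * S + 16 * (η1 ^ 2 + η2 ^ 2) * E := by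
    refine abs_le_of_sq_le_sq ?_ (by positivity)
    have h3 : (η1 * E1 + η2 * E2) ^ 2 ≤ (η1 ^ 2 + η2 ^ 2) * (E1 ^ 2 + E2 ^ 2) := by
      nlinarith [sq_nonneg (η1 * E2 - η2 * E1)]
    have h4 : (η1 ^ 2 + η2 ^ 2) * (E1 ^ 2 + E2 ^ 2) ≤ (η1 ^ 2 + η2 ^ 2) * (4 * S * E) := by gcongr
    have h5 : 16 * η ^ 2 * (η1 * E1 + η2 * E2) ^ 2 ≤
        16 * η ^ 2 * ((η1 ^ 2 + η2 ^ 2) * (4 * S * E)) := by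
      gcongr; exact h3.trans h4
    have h6 := sq_nonneg (η ^ 2 * S - 16 * (η1 ^ 2 + η2 ^ 2) * E)
    linarith
  have hq' := (abs_le.1 hq).1
  have i1 : 16 * (η1 ^ 2 + η2 ^ 2) * E ≤ 64 / ρ * E := by
    have : 16 * (η1 ^ 2 + η2 ^ 2) ≤ 64 / ρ :=
      (mul_le_mul_of_nonneg_left hgη (by norm_num : (0:ℝ) ≤ 16)).trans (le_of_eq (by ring))
    gcongr
  have i2 : η ^ 2 * (S - α * E - β * E ^ 2) ≤ η ^ 2 * LE := by gcongr
  have hη2 : η ^ 2 ≤ 1 := pow_le_one₀ hη0 hη1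
  have i3 : η ^ 2 * (α * E) ≤ α * E := mul_le_of_le_one_left (by positivity) hη2
  have i4 : η ^ 2 * (β * E ^ 2) ≤ β * M * E := by
    calc _ = β * (η ^ 2 * E) * E := by ring
      _ ≤ _ := by gcongr
  have i5 : 8 / ρ * E * η ≤ 8 / ρ * E := mul_le_of_le_one_right (by positivity) hη1
  have i6 : 0 ≤ E * (2 * (η1 ^ 2 + η2 ^ 2)) := by positivity
  have i7 : Λ * (c * E - k + k * 4) ≤ Λ * (LV + k * 4) := by gcongr
  have i8 : Λ * (c * E - k + k * 4) = (α + β * M + 72 / ρ) * E + Λ * k * 3 := by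
    rw [← hΛc]; ring
  have i9 : 0 < Λ * k * 3 := by positivity
  have i10 : E * (2 * η * (-4 / ρ) + 2 * (η1 ^ 2 + η2 ^ 2)) =
    E * (2 * (η1 ^ 2 + η2 ^ 2)) - 8 / ρ * E * η := by ring
  have i11 : (α + β * M + 72 / ρ) * E = α * E + β * M * E + 64 / ρ * E + 8 / ρ * E := by ring
  rw [i10]
  linarith

/-- Interior estimate of Bernstein type. -/
theorem bernstein_estimate {E V S : ℂ → ℝ} {x₀ : ℂ} {r α β c k ν : ℝ} (hr : 0 < r) (hα : 0 ≤ α)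
    (hβ : 0 ≤ β) (hc : 0 < c) (hk : 0 < k)
    (hE : ∀ x ∈ closedBall x₀ r, ContDiffAt ℝ 2 E x ∧ 0 ≤ E x ∧ 0 ≤ S x ∧
      gradNormSq E x ≤ 4 * S x * E x ∧ S x - α * E x - β * E x ^ 2 ≤ lapR E x)
    (hV : ∀ x ∈ closedBall x₀ r, ContDiffAt ℝ 2 V x ∧ c * E x - k ≤ lapR V x)
    (hν : ∀ y ∈ closedBall x₀ r, ∀ z ∈ closedBall x₀ r, V y - V z ≤ ν) :
    ∃ M, E x₀ ≤ M ∧ M ≤ (α + β * M + 72 / r ^ 2) / c * (ν + k * r ^ 2) := by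
  have hEc : ContinuousOn E (closedBall x₀ r) := fun x hx =>
    (hE x hx).1.continuousAt.continuousWithinAt
  have hVc : ContinuousOn V (closedBall x₀ r) := fun x hx =>
    (hV x hx).1.continuousAt.continuousWithinAt
  have hdc := (distSq_contDiff x₀).continuous
  obtain ⟨η, hη⟩ : ∃ η : ℂ → ℝ, η = fun y => 1 - distSq x₀ y / r ^ 2 := ⟨_, rfl⟩
  have hηc : Continuous η := by rw [hη]; fun_prop
  have hx₀ : x₀ ∈ closedBall x₀ r := mem_closedBall_self hr.le
  have hdle : ∀ y ∈ closedBall x₀ r, distSq x₀ y ≤ r ^ 2 := fun y hy => by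
    have := mem_closedBall_iff_norm.1 hy
    unfold distSq; gcongr
  have hd0 : ∀ y, 0 ≤ distSq x₀ y := fun y => by unfold distSq; positivity
  obtain ⟨z, hz, hzm⟩ := (isCompact_closedBall x₀ r).exists_isMaxOn ⟨x₀, hx₀⟩
    (f := fun y => η y ^ 2 * E y) (by fun_prop)
  obtain ⟨M, hM⟩ : ∃ M, M = η z ^ 2 * E z := ⟨_, rfl⟩
  have hMm : ∀ y ∈ closedBall x₀ r, η y ^ 2 * E y ≤ M := fun y hy => hM ▸ hzm hy
  have hM0 : 0 ≤ M := by
    rw [hM]; have := (hE z hz).2.1; positivity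
  refine ⟨M, ?_, ?_⟩
  · have := hMm x₀ hx₀
    have h1 : η x₀ = 1 := by simp [hη, distSq]
    rw [h1] at this; linarith
  obtain ⟨Λ, hΛ⟩ : ∃ Λ, Λ = (α + β * M + 72 / r ^ 2) / c := ⟨_, rfl⟩
  have hΛ0 : 0 < Λ := by rw [hΛ]; positivity
  have hΛc : Λ * c = α + β * M + 72 / r ^ 2 := by rw [hΛ]; field_simp
  rw [← hΛ]
  have key : ∀ y ∈ closure (ball x₀ r), η y ^ 2 * E y + Λ * (V y + k * distSq x₀ y) ≤
      Λ * (V z + ν + k * r ^ 2) := by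
    refine le_of_lapR_pos isOpen_ball isBounded_ball ?_ ?_ ?_
    · rw [closure_ball _ hr.ne']; fun_prop
    · intro y hy
      have hy1 : ‖y - x₀‖ = r := by
        rw [frontier_ball _ hr.ne'] at hy; exact mem_sphere_iff_norm.1 hy
      have hy2 : y ∈ closedBall x₀ r := mem_closedBall_iff_norm.2 hy1.le
      have h1 : distSq x₀ y = r ^ 2 := by rw [distSq, hy1]
      have h2 : η y = 0 := by simp only [hη, h1]; field_simp; ring
      have := hν y hy2 z hz
      rw [h2, h1, zero_pow two_ne_zero, zero_mul, zero_add]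
      gcongr; linarith
    · intro y hy
      have hy2 := ball_subset_closedBall hy
      obtain ⟨cE, E0, S0, gE, lE⟩ := hE y hy2
      obtain ⟨cV, lV⟩ := hV y hy2
      obtain ⟨η1, η2, cη⟩ := lapR_cutoff (x₀ := x₀) (x := y) (r := r)
      rw [← hη] at η2 cη
      simp only [← hη] at η1
      have cη2 : ContDiffAt ℝ 2 (fun y => η y ^ 2) y := cη.pow 2
      have h2 : ∀ s : ℝ, HasDerivAt (fun s : ℝ => s ^ 2) (2 * s) s := fun s =>
        (hasDerivAt_pow 2 s).congr_deriv (by simp)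
      have h2' : HasDerivAt (fun s : ℝ => 2 * s) 2 (η y) :=
        ((hasDerivAt_id (η y)).const_mul 2).congr_deriv (by simp)
      obtain ⟨p1, p2⟩ := scomp_at cη (V := fun s => s ^ 2) (by fun_prop)
        (Eventually.of_forall h2) h2'
      have cd := distSq_contDiffAt x₀ y
      have ckd : ContDiffAt ℝ 2 (fun y => k * distSq x₀ y) y := contDiffAt_const.mul cd
      have c1 := cη2.mul cE
      have c2 := cV.add ckd
      have c3 : ContDiffAt ℝ 2 (fun y => Λ * (V y + k * distSq x₀ y)) y := contDiffAt_const.mul c2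
      refine ⟨c1.add c3, fun _ _ => ?_⟩
      have eq1 : lapR (fun y => η y ^ 2 * E y + Λ * (V y + k * distSq x₀ y)) y =
          η y ^ 2 * lapR E y + E y * (2 * η y * (-4 / r ^ 2) + 2 * gradNormSq η y) +
          2 * ((2 * η y * fderiv ℝ η y 1) * fderiv ℝ E y 1 +
            (2 * η y * fderiv ℝ η y I) * fderiv ℝ E y I) + Λ * (lapR V y + k * 4) := by
        rw [lapR_add c1 c3, lapR_mul cη2 cE, p2, p1, p1, η2, lapR_const_mul _ c2, lapR_add cV ckd,
          lapR_const_mul _ cd, lapR_distSq]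
      rw [eq1]
      have hη0 : 0 ≤ η y := by
        have := hdle y hy2
        have h3 : distSq x₀ y / r ^ 2 ≤ 1 := by rw [div_le_one (by positivity)]; exact this
        simp only [hη]; linarith
      have hη1 : η y ≤ 1 := by
        have := hd0 y
        have h3 : 0 ≤ distSq x₀ y / r ^ 2 := by positivity
        simp only [hη]; linarith
      have gη : gradNormSq η y ≤ 4 / r ^ 2 := by
        have h3 : gradNormSq η y = 4 * distSq x₀ y / r ^ 4 := by
          rw [gradNormSq, η1, η1, distSq_eq]; simp [ip]; ring
        rw [h3, div_le_div_iff₀ (by positivity) (by positivity)]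
        have := hdle y hy2
        nlinarith [sq_nonneg r]
      exact bernstein_algebra hη0 hη1 (by positivity) gη E0 S0 gE lE lV (hMm y hy2) hα hβ hΛ0 hk hΛc
  have hfin := key z (by rwa [closure_ball _ hr.ne'])
  rw [← hM] at hfin
  have := hd0 z
  have : 0 ≤ Λ * (k * distSq x₀ z) := by positivity
  linarith

end Bernstein

section Bochner

lemma fderiv_dir_comm {f : ℂ → ℂ} (hf : ContDiff ℝ (⊤ : ℕ∞) f) (a b x : ℂ) :
    fderiv ℝ (fun y => fderiv ℝ f y a) x b = fderiv ℝ (fun y => fderiv ℝ f y b) x a := by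
  have hs : IsSymmSndFDerivAt ℝ f x := hf.contDiffAt.isSymmSndFDerivAt (by simp [two_le_smooth])
  have hd : DifferentiableAt ℝ (fderiv ℝ f) x :=
    ((hf.fderiv_right (m := 1) (by rw [one_add_one_eq_two]; exact two_le_smooth)).differentiable (by simp)).differentiableAt
  have h : ∀ a b, fderiv ℝ (fun y => fderiv ℝ f y a) x b = fderiv ℝ (fderiv ℝ f) x b a := by
    intro a b
    rw [fderiv_clm_apply hd (differentiableAt_const a)]
    simp
  rw [h, h]
  exact hs b a

/-- Squared norm of the Hessian. -/
def hessSq (u : ℂ → ℂ) (x : ℂ) : ℝ :=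
  ‖fderiv ℝ (fun y => fderiv ℝ u y 1) x 1‖ ^ 2 + ‖fderiv ℝ (fun y => fderiv ℝ u y 1) x I‖ ^ 2 +
  (‖fderiv ℝ (fun y => fderiv ℝ u y I) x 1‖ ^ 2 + ‖fderiv ℝ (fun y => fderiv ℝ u y I) x I‖ ^ 2)

lemma hessSq_nonneg (u : ℂ → ℂ) (x : ℂ) : 0 ≤ hessSq u x := by unfold hessSq; positivity

lemma gradSq_nonneg (u : ℂ → ℂ) (x : ℂ) : 0 ≤ gradSq u x := by unfold gradSq; positivity

lemma norm_lapC_sq_le (u : ℂ → ℂ) (x : ℂ) : ‖lapC u x‖ ^ 2 ≤ 2 * hessSq u x := by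
  unfold lapC hessSq
  have h1 := norm_add_le (fderiv ℝ (fun y => fderiv ℝ u y 1) x 1)
    (fderiv ℝ (fun y => fderiv ℝ u y I) x I)
  have h2 := norm_nonneg (fderiv ℝ (fun y => fderiv ℝ u y 1) x 1 +
    fderiv ℝ (fun y => fderiv ℝ u y I) x I)
  have h3 := sq_nonneg (‖fderiv ℝ (fun y => fderiv ℝ u y 1) x 1‖ -
    ‖fderiv ℝ (fun y => fderiv ℝ u y I) x I‖)
  have h4 := sq_nonneg ‖fderiv ℝ (fun y => fderiv ℝ u y 1) x I‖
  have h5 := sq_nonneg ‖fderiv ℝ (fun y => fderiv ℝ u y I) x 1‖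
  have h6 := pow_le_pow_left₀ h2 h1 2
  linarith

lemma normSq_jet {v : ℂ → ℂ} {x : ℂ} (hv : ContDiffAt ℝ 2 v x) (e : ℂ) :
    fderiv ℝ (fun y => ‖v y‖ ^ 2) x e = 2 * ip (v x) (fderiv ℝ v x e) ∧
    dd (fun y => ‖v y‖ ^ 2) e x = 2 * ip (v x) (dd v e x) + 2 * ‖fderiv ℝ v x e‖ ^ 2 := by
  refine dd_eq_of_hasJet (hv.norm_sq ℝ) (v := ‖v x‖ ^ 2) ?_
  have h := hasJet_line hv e
  have h1 := h.clm reCLM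
  have h2 := h.clm imCLM
  refine ((h1.mul h1).add (h2.mul h2)).cast (fun s => ?_) ?_ ?_ ?_
  · rw [norm_sq_re_im]; simp; ring
  · rw [norm_sq_re_im]; simp; ring
  · simp [ip]; ring
  · rw [norm_sq_re_im]; simp [ip]; ring

lemma lapR_normSq {v : ℂ → ℂ} {x : ℂ} (hv : ContDiffAt ℝ 2 v x) :
    lapR (fun y => ‖v y‖ ^ 2) x = 2 * ip (v x) (lapC v x) + 2 * gradSq v x := by
  rw [lapR_eq, (normSq_jet hv 1).2, (normSq_jet hv I).2, lapC_eq, gradSq]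
  simp [ip]; ring

lemma lapC_fderiv_dir {u : ℂ → ℂ} (hu : ContDiff ℝ (⊤ : ℕ∞) u) (e x : ℂ) :
    lapC (fun y => fderiv ℝ u y e) x = fderiv ℝ (lapC u) x e := by
  have h1 := hu.fderiv_dir
  have h2 : ∀ a b, ContDiff ℝ (⊤ : ℕ∞) (fun y => fderiv ℝ (fun y => fderiv ℝ u y a) y b) :=
    fun a b => (h1 a).fderiv_dir b
  have h3 : ∀ a, (fun y => fderiv ℝ (fun y => fderiv ℝ u y e) y a) =
      fun y => fderiv ℝ (fun y => fderiv ℝ u y a) y e := fun a =>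
    funext fun y => fderiv_dir_comm hu e a y
  have h4 : lapC u = fun y => fderiv ℝ (fun y => fderiv ℝ u y 1) y 1 +
    fderiv ℝ (fun y => fderiv ℝ u y I) y I := rfl
  have hd : ∀ a b, DifferentiableAt ℝ (fun y => fderiv ℝ (fun y => fderiv ℝ u y a) y b) x :=
    fun a b => ((h2 a b).differentiable (by simp)).differentiableAt
  rw [h4, fderiv_fun_add (hd 1 1) (hd I I), lapC, h3, h3, fderiv_dir_comm (h1 1) e 1,
    fderiv_dir_comm (h1 I) e I]
  rfl

lemma contDiff_gradSq {u : ℂ → ℂ} (hu : ContDiff ℝ (⊤ : ℕ∞) u) : ContDiff ℝ (⊤ : ℕ∞) (gradSq u) := by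
  have h1 := fun e => (hu.fderiv_dir e).norm_sq ℝ
  exact (h1 1).add (h1 I)

lemma ip_sum_sq_le (a b c d : ℂ) :
    (ip a c + ip b d) ^ 2 ≤ (‖a‖ ^ 2 + ‖b‖ ^ 2) * (‖c‖ ^ 2 + ‖d‖ ^ 2) := by
  have h1 := ip_abs_le a c
  have h2 := ip_abs_le b d
  have h3 : |ip a c + ip b d| ≤ ‖a‖ * ‖c‖ + ‖b‖ * ‖d‖ := (abs_add_le _ _).trans (add_le_add h1 h2)
  have h4 : (ip a c + ip b d) ^ 2 ≤ (‖a‖ * ‖c‖ + ‖b‖ * ‖d‖) ^ 2 := by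
    rw [← sq_abs]; gcongr
  nlinarith [sq_nonneg (‖a‖ * ‖d‖ - ‖b‖ * ‖c‖)]

lemma gradNormSq_gradSq_le {u : ℂ → ℂ} (hu : ContDiff ℝ (⊤ : ℕ∞) u) (x : ℂ) :
    gradNormSq (gradSq u) x ≤ 4 * hessSq u x * gradSq u x := by
  have hc : ∀ a, ContDiffAt ℝ 2 (fun y => fderiv ℝ u y a) x := fun a =>
    ((hu.fderiv_dir a).of_le two_le_smooth).contDiffAt
  have hn : ∀ a, DifferentiableAt ℝ (fun y => ‖fderiv ℝ u y a‖ ^ 2) x := fun a =>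
    ((hc a).norm_sq ℝ).differentiableAt (by simp)
  have h1 : ∀ e, fderiv ℝ (gradSq u) x e =
      2 * (ip (fderiv ℝ u x 1) (fderiv ℝ (fun y => fderiv ℝ u y 1) x e) +
        ip (fderiv ℝ u x I) (fderiv ℝ (fun y => fderiv ℝ u y I) x e)) := by
    intro e
    have : gradSq u = fun y => ‖fderiv ℝ u y 1‖ ^ 2 + ‖fderiv ℝ u y I‖ ^ 2 := rfl
    rw [this, fderiv_fun_add (hn 1) (hn I), add_apply, (normSq_jet (hc 1) e).1,
      (normSq_jet (hc I) e).1]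
    ring
  rw [gradNormSq, h1, h1, hessSq, gradSq]
  have k1 := ip_sum_sq_le (fderiv ℝ u x 1) (fderiv ℝ u x I)
    (fderiv ℝ (fun y => fderiv ℝ u y 1) x 1) (fderiv ℝ (fun y => fderiv ℝ u y I) x 1)
  have k2 := ip_sum_sq_le (fderiv ℝ u x 1) (fderiv ℝ u x I)
    (fderiv ℝ (fun y => fderiv ℝ u y 1) x I) (fderiv ℝ (fun y => fderiv ℝ u y I) x I)
  linarith

/-- The Bochner identity. -/
lemma bochner {u : ℂ → ℂ} (hu : ContDiff ℝ (⊤ : ℕ∞) u) {F : ℂ → ℂ} (hF : ContDiff ℝ (⊤ : ℕ∞) F)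
    {Ω : Set ℂ} (hΩ : IsOpen Ω) {l : ℝ} (h : ∀ x ∈ Ω, lapC u x = l • F (u x)) {x : ℂ} (hx : x ∈ Ω) :
    lapR (gradSq u) x = 2 * hessSq u x +
      2 * l * (ip (fderiv ℝ u x 1) (fderiv ℝ F (u x) (fderiv ℝ u x 1)) +
        ip (fderiv ℝ u x I) (fderiv ℝ F (u x) (fderiv ℝ u x I))) := by
  have hc : ∀ a, ContDiffAt ℝ 2 (fun y => fderiv ℝ u y a) x := fun a =>
    ((hu.fderiv_dir a).of_le two_le_smooth).contDiffAt
  have h1 : ∀ e, lapC (fun y => fderiv ℝ u y e) x = l • fderiv ℝ F (u x) (fderiv ℝ u x e) := by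
    intro e
    have he : lapC u =ᶠ[𝓝 x] fun y => l • F (u y) := by
      filter_upwards [hΩ.mem_nhds hx] with y hy using h y hy
    have hd : HasFDerivAt (fun y => F (u y)) ((fderiv ℝ F (u x)).comp (fderiv ℝ u x)) x :=
      ((hF.differentiable (by simp)).differentiableAt.hasFDerivAt).comp x
        ((hu.differentiable (by simp)).differentiableAt.hasFDerivAt)
    have hd2 : HasFDerivAt (fun y => l • F (u y)) _ x := hd.const_smul l
    rw [lapC_fderiv_dir hu, he.fderiv_eq, hd2.fderiv]
    rfl
  have h2 : gradSq u = fun y => ‖fderiv ℝ u y 1‖ ^ 2 + ‖fderiv ℝ u y I‖ ^ 2 := rfl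
  rw [h2, lapR_add ((hc 1).norm_sq ℝ) ((hc I).norm_sq ℝ), lapR_normSq (hc 1), lapR_normSq (hc I),
    h1, h1, hessSq, gradSq, gradSq]
  simp [ip]; ring

end Bochner

section Potential

variable {γ : ℝ → ℂ} {L : ℝ} {W : ℂ → ℝ}

lemma hasDerivAt_ip {f : ℝ → ℂ} {f' v : ℂ} {s : ℝ} (h : HasDerivAt f f' s) :
    HasDerivAt (fun s => ip (f s) v) (ip f' v) s := by
  have h1 : HasDerivAt (fun s => (f s).re) f'.re s := reCLM.hasFDerivAt.comp_hasDerivAt s h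
  have h2 : HasDerivAt (fun s => (f s).im) f'.im s := imCLM.hasFDerivAt.comp_hasDerivAt s h
  exact (h1.mul_const v.re).add (h2.mul_const v.im)

lemma hasJet_potential (hW : ContDiff ℝ (⊤ : ℕ∞) W) (z v : ℂ) :
    HasJet (fun s : ℝ => W (z + s • v)) (W z) (ip (gradW W z) v)
      (ip (fderiv ℝ (gradW W) z v) v) := by
  have hl : ∀ s : ℝ, HasDerivAt (fun s : ℝ => z + s • v) v s := fun s => by
    simpa using ((hasDerivAt_id s).smul_const v).const_add z
  have hF := gradW_contDiff hW
  refine ⟨by simp, fun s => ip (gradW W (z + s • v)) v, Eventually.of_forall fun s => ?_,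
    by simp, hasDerivAt_ip ?_⟩
  · simp only [ip_gradW]
    exact ((hW.differentiable (by simp)).differentiableAt.hasFDerivAt).comp_hasDerivAt s (hl s)
  · have h2 : HasFDerivAt (gradW W) (fderiv ℝ (gradW W) z) (z + (0 : ℝ) • v) := by
      simpa using ((hF.differentiable (by simp)).differentiableAt (x := z)).hasFDerivAt
    exact h2.comp_hasDerivAt 0 (hl 0)

/-- Second order condition at a zero of a potential with a quadratic lower bound. -/
lemma two_mul_le_hess (hW : ContDiff ℝ (⊤ : ℕ∞) W) {z v : ℂ} (hz : W z = 0) {c : ℝ}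
    (h : ∀ᶠ s : ℝ in 𝓝 0, c * s ^ 2 ≤ W (z + s • v)) :
    ip (gradW W z) v = 0 ∧ 2 * c ≤ ip (fderiv ℝ (gradW W) z v) v := by
  have hq : HasJet (fun s : ℝ => c * s ^ 2) 0 0 (2 * c) := by
    refine ⟨by simp, fun s => c * (2 * s), Eventually.of_forall fun s => ?_, by simp, ?_⟩
    · simpa using (hasDerivAt_pow 2 s).const_mul c
    · exact (((hasDerivAt_id (0 : ℝ)).const_mul 2).const_mul c).congr_deriv (by simp; ring)
  have hj := (hasJet_potential hW z v).add hq.neg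
  have := hj.nonneg_of_isLocalMin (by
    filter_upwards [h] with s hs
    simp only [zero_smul, add_zero, hz]
    linarith)
  constructor <;> linarith [this.1, this.2]

lemma IsLoop.norm_tub_le (hγ : IsLoop γ L) {K d s t : ℝ} (hK : ∀ s, ‖γ s‖ ≤ K) (ht : |t| ≤ d) :
    ‖tub γ s t‖ ≤ K + d := by
  unfold tub
  refine (norm_add_le _ _).trans (add_le_add (hK s) ?_)
  rw [norm_mul, norm_real, hγ.norm_I_deriv, mul_one]
  exact ht

/-- Bounds for a non-degenerate potential in a tubular neighbourhood of its zero set. -/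
theorem IsLoop.potential_bounds (hγ : IsLoop γ L) (hW : ContDiff ℝ (⊤ : ℕ∞) W) (hW0 : ∀ z, 0 ≤ W z)
    (hWγ : ∀ s, W (γ s) = 0) {μ δ : ℝ} (hμ : 0 < μ) (hδ : 0 < δ)
    (hnd : ∀ z, infDist z (range γ) < δ → μ * infDist z (range γ) ^ 2 ≤ W z) {d : ℝ} (hd : 0 < d) :
    ∃ C > 0, ∃ t₀ > 0,
      (∀ s t, |t| ≤ d → ∀ v, |ip v (fderiv ℝ (gradW W) (tub γ s t) v)| ≤ C * ‖v‖ ^ 2) ∧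
      (∀ s t, |t| ≤ d → ∀ v, -(C * |t| * ‖v‖ ^ 2) ≤ ip v (fderiv ℝ (gradW W) (tub γ s t) v)) ∧
      (∀ s t, |t| ≤ d → |t * ip (gradW W (tub γ s t)) (I * deriv γ s)| ≤ C * t ^ 2) ∧
      ∀ s t, |t| ≤ t₀ → μ * t ^ 2 ≤ t * ip (gradW W (tub γ s t)) (I * deriv γ s) := by
  have hF := gradW_contDiff hW
  obtain ⟨K, hK0, hK⟩ := hγ.exists_bound hγ.smooth.continuous hγ.periodic
  obtain ⟨F, hFe⟩ : ∃ F, F = gradW W := ⟨_, rfl⟩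
  rw [← hFe] at hF ⊢
  have hF1 : ContDiff ℝ 1 (fderiv ℝ F) := hF.fderiv_right (by rw [one_add_one_eq_two]; exact two_le_smooth)
  have hF2 : Continuous (fderiv ℝ (fderiv ℝ F)) := hF1.continuous_fderiv (by simp)
  obtain ⟨C₁, hC₁⟩ := (isCompact_closedBall (0 : ℂ) (K + d)).exists_bound_of_continuousOn
    hF1.continuous.continuousOn
  obtain ⟨C₂, hC₂⟩ := (isCompact_closedBall (0 : ℂ) (K + d)).exists_bound_of_continuousOn
    (f := fderiv ℝ (fderiv ℝ F)) hF2.continuousOn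
  have hC₂0 : 0 ≤ C₂ := (norm_nonneg _).trans (hC₂ 0 (by simp; positivity))
  have hC₁0 : 0 ≤ C₁ := (norm_nonneg _).trans (hC₁ 0 (by simp; positivity))
  have hmem : ∀ s t, |t| ≤ d → tub γ s t ∈ closedBall (0 : ℂ) (K + d) := fun s t ht => by
    rw [mem_closedBall_zero_iff]; exact hγ.norm_tub_le hK ht
  have hγmem : ∀ s, γ s ∈ closedBall (0 : ℂ) (K + d) := fun s => by
    simpa [tub] using hmem s 0 (by simpa using hd.le)
  have hlip : ∀ x ∈ closedBall (0 : ℂ) (K + d), ∀ y ∈ closedBall (0 : ℂ) (K + d),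
      ‖fderiv ℝ F y - fderiv ℝ F x‖ ≤ C₂ * ‖y - x‖ := fun x hx y hy =>
    Convex.norm_image_sub_le_of_norm_fderiv_le
      (fun z _ => (hF1.differentiable (by simp)).differentiableAt) hC₂ (convex_closedBall _ _) hx hy
  have hsub : ∀ s t, ‖tub γ s t - γ s‖ = |t| := fun s t => by
    simp [tub, hγ.arclength]
  have hip : ∀ v z : ℂ, ip v z = ip z v := fun v z => by simp [ip]; ring
  have hmin : ∀ s v, ip (F (γ s)) v = 0 ∧ 0 ≤ ip (fderiv ℝ F (γ s) v) v := fun s v => by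
    have := two_mul_le_hess (v := v) hW (hWγ s) (c := 0) (Eventually.of_forall fun r => by
      simpa using hW0 _)
    rw [← hFe] at this
    simpa using this
  have hF0 : ∀ s, F (γ s) = 0 := fun s => by
    have h1 := (hmin s 1).1
    have h2 := (hmin s I).1
    simp only [ip, one_re, one_im, I_re, I_im, mul_one, mul_zero, add_zero, zero_add] at h1 h2
    exact Complex.ext h1 h2
  have htaylor : ∀ s t, |t| ≤ d → ‖F (tub γ s t) - fderiv ℝ F (γ s) (t * (I * deriv γ s))‖ ≤
      C₂ * t ^ 2 := by
    intro s t ht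
    have := Convex.norm_image_sub_le_of_norm_fderiv_le' (f := F) (s := segment ℝ (γ s) (tub γ s t))
      (φ := fderiv ℝ F (γ s)) (C := C₂ * |t|)
      (fun x _ => (hF.differentiable (by simp)).differentiableAt) ?_ (convex_segment _ _)
      (left_mem_segment _ _ _) (right_mem_segment _ _ _)
    · rw [hF0, hsub] at this
      rw [sub_zero] at this
      have e : tub γ s t - γ s = t * (I * deriv γ s) := by simp [tub]
      rw [e] at this
      refine this.trans (le_of_eq ?_)
      rw [mul_assoc, abs_mul_abs_self, sq]
    · intro x hx
      refine (hlip _ (hγmem s) x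
        ((convex_closedBall _ _).segment_subset (hγmem s) (hmem s t ht) hx)).trans ?_
      refine mul_le_mul_of_nonneg_left ?_ hC₂0
      rw [← hsub s t]
      obtain ⟨a, b, ha, hb, hab, rfl⟩ := hx
      have : a • γ s + b • tub γ s t - γ s = b • (tub γ s t - γ s) := by
        rw [← eq_sub_iff_add_eq] at hab
        rw [hab, smul_sub, sub_smul, one_smul]; abel
      rw [this, norm_smul, Real.norm_of_nonneg hb]
      exact mul_le_of_le_one_left (norm_nonneg _) (by linarith)
  obtain ⟨ρ, hρ, hdist⟩ := hγ.infDist_tub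
  have hnorm : ∀ s, 2 * μ ≤ ip (fderiv ℝ F (γ s) (I * deriv γ s)) (I * deriv γ s) := by
    intro s
    have := two_mul_le_hess (v := I * deriv γ s) hW (hWγ s) (c := μ) (by
      have h0 : ∀ᶠ r : ℝ in 𝓝 0, |r| < min ρ δ := by
        have := (continuous_abs (G := ℝ)).tendsto 0
        rw [abs_zero] at this
        exact this.eventually (gt_mem_nhds (lt_min hρ hδ))
      filter_upwards [h0] with r hr
      have h1 := hdist s r (hr.le.trans (min_le_left _ _))
      have h2 := hnd (tub γ s r) (by rw [← h1]; exact hr.trans_le (min_le_right _ _))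
      rw [← h1, sq_abs] at h2
      simpa [tub] using h2)
    rw [← hFe] at this
    exact this.2
  have hop : ∀ z v w : ℂ, |ip (fderiv ℝ F z v) w| ≤ ‖fderiv ℝ F z‖ * ‖v‖ * ‖w‖ := fun z v w =>
    (ip_abs_le _ _).trans (mul_le_mul_of_nonneg_right (ContinuousLinearMap.le_opNorm _ _)
      (norm_nonneg _))
  have hdev : ∀ s t, |t| ≤ d → ∀ v,
      |ip (fderiv ℝ F (tub γ s t) v) v - ip (fderiv ℝ F (γ s) v) v| ≤ C₂ * |t| * ‖v‖ ^ 2 := by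
    intro s t ht v
    have e : ip (fderiv ℝ F (tub γ s t) v) v - ip (fderiv ℝ F (γ s) v) v =
        ip ((fderiv ℝ F (tub γ s t) - fderiv ℝ F (γ s)) v) v := by
      simp [ip]; ring
    have h1 := hlip _ (hγmem s) _ (hmem s t ht)
    rw [hsub] at h1
    rw [e]
    calc _ ≤ _ := ip_abs_le _ _
      _ ≤ ‖fderiv ℝ F (tub γ s t) - fderiv ℝ F (γ s)‖ * ‖v‖ * ‖v‖ :=
        mul_le_mul_of_nonneg_right (ContinuousLinearMap.le_opNorm _ _) (norm_nonneg _)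
      _ ≤ C₂ * |t| * ‖v‖ * ‖v‖ := by gcongr
      _ = _ := by ring
  have hY : ∀ s t, |t| ≤ d → |t * ip (F (tub γ s t)) (I * deriv γ s) -
      t ^ 2 * ip (fderiv ℝ F (γ s) (I * deriv γ s)) (I * deriv γ s)| ≤ C₂ * |t| * t ^ 2 := by
    intro s t ht
    have e : t * ip (F (tub γ s t)) (I * deriv γ s) -
        t ^ 2 * ip (fderiv ℝ F (γ s) (I * deriv γ s)) (I * deriv γ s) =
        t * ip (F (tub γ s t) - fderiv ℝ F (γ s) (t * (I * deriv γ s))) (I * deriv γ s) := by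
      have : (t : ℂ) * (I * deriv γ s) = t • (I * deriv γ s) := by rw [real_smul]
      rw [this, map_smul]
      simp [ip]; ring
    rw [e, abs_mul]
    have h1 := ip_abs_le (F (tub γ s t) - fderiv ℝ F (γ s) (t * (I * deriv γ s))) (I * deriv γ s)
    rw [hγ.norm_I_deriv, mul_one] at h1
    have h2 := mul_le_mul_of_nonneg_left (h1.trans (htaylor s t ht)) (abs_nonneg t)
    linarith
  have hsq : ∀ t : ℝ, |t| ≤ d → C₂ * |t| * t ^ 2 ≤ C₂ * d * t ^ 2 := fun t ht => by gcongr
  obtain ⟨C, hC, hC1, hC2, hC3⟩ : ∃ C > 0, C₁ ≤ C ∧ C₂ ≤ C ∧ C₁ + C₂ * d ≤ C :=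
    ⟨C₁ + C₂ + C₂ * d + 1, by positivity, by nlinarith [mul_nonneg hC₂0 hd.le],
      by nlinarith [mul_nonneg hC₂0 hd.le], by linarith⟩
  refine ⟨C, hC, min d (μ / (C₂ + 1)), by positivity, ?_, ?_, ?_, ?_⟩
  · intro s t ht v
    rw [hip]
    calc _ ≤ _ := hop _ _ _
      _ ≤ C₁ * ‖v‖ * ‖v‖ := by gcongr; exact hC₁ _ (hmem s t ht)
      _ ≤ C * ‖v‖ * ‖v‖ := by gcongr
      _ = _ := by ring
  · intro s t ht v
    rw [hip]
    have h1 := (abs_le.1 (hdev s t ht v)).1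
    have h2 := (hmin s v).2
    have h3 : C₂ * |t| * ‖v‖ ^ 2 ≤ C * |t| * ‖v‖ ^ 2 := by gcongr
    linarith
  · intro s t ht
    have h1 := abs_le.1 (hY s t ht)
    have h2 := hop (γ s) (I * deriv γ s) (I * deriv γ s)
    rw [hγ.norm_I_deriv, mul_one, mul_one] at h2
    have h3 := abs_le.1 (h2.trans (hC₁ _ (hγmem s)))
    have h4 := hsq t ht
    have h5 := sq_nonneg t
    rw [abs_le]
    constructor <;> nlinarith
  · intro s t ht
    have h1 := (abs_le.1 (hY s t (ht.trans (min_le_left _ _)))).1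
    have h2 := mul_le_mul_of_nonneg_left (hnorm s) (sq_nonneg t)
    have h3 : C₂ * |t| ≤ μ := by
      have h4 := ht.trans (min_le_right _ _)
      rw [le_div_iff₀ (by positivity)] at h4
      nlinarith [abs_nonneg t]
    nlinarith [sq_nonneg t]

end Potential

/-- The scalar product of the gradients of two real functions. -/
def gradDot (f g : ℂ → ℝ) (x : ℂ) : ℝ :=
  fderiv ℝ f x 1 * fderiv ℝ g x 1 + fderiv ℝ f x I * fderiv ℝ g x I

lemma abs_gradDot_le (f g : ℂ → ℝ) (x : ℂ) {s : ℝ} (hs : 0 < s) :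
    |gradDot f g x| ≤ s * gradNormSq f x + s⁻¹ * gradNormSq g x := by
  obtain ⟨i, hi⟩ : ∃ i, i = s⁻¹ := ⟨_, rfl⟩
  have hi0 : 0 < i := by rw [hi]; positivity
  have hsi : s * i = 1 := by rw [hi, mul_inv_cancel₀ hs.ne']
  rw [← hi]
  simp only [gradDot, gradNormSq]
  have key : ∀ a b : ℝ, |a * b| ≤ (s * a ^ 2 + i * b ^ 2) / 2 := by
    intro a b
    have h1 : 0 ≤ s * (a - i * b) ^ 2 := by positivity
    have h2 : 0 ≤ s * (a + i * b) ^ 2 := by positivity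
    have e1 : s * (a - i * b) ^ 2 = s * a ^ 2 - 2 * (s * i) * (a * b) + (s * i) * i * b ^ 2 := by ring
    have e2 : s * (a + i * b) ^ 2 = s * a ^ 2 + 2 * (s * i) * (a * b) + (s * i) * i * b ^ 2 := by ring
    rw [hsi] at e1 e2
    rw [abs_le]; constructor <;> linarith
  have h1 := key (fderiv ℝ f x 1) (fderiv ℝ g x 1)
  have h2 := key (fderiv ℝ f x I) (fderiv ℝ g x I)
  have h3 := abs_add_le (fderiv ℝ f x 1 * fderiv ℝ g x 1) (fderiv ℝ f x I * fderiv ℝ g x I)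
  have h4 : 0 ≤ s * fderiv ℝ f x 1 ^ 2 + i * fderiv ℝ g x 1 ^ 2 := by positivity
  have h5 : 0 ≤ s * fderiv ℝ f x I ^ 2 + i * fderiv ℝ g x I ^ 2 := by positivity
  linarith

lemma lapR_sq {f : ℂ → ℝ} {x : ℂ} (hf : ContDiffAt ℝ 2 f x) :
    lapR (fun y => f y ^ 2) x = 2 * f x * lapR f x + 2 * gradNormSq f x := by
  have : (fun y => f y ^ 2) = fun y => f y * f y := by funext y; ring
  rw [this, lapR_mul hf hf, gradNormSq]; ring

section Basic

variable {γ : ℝ → ℂ} {L : ℝ} {W : ℂ → ℝ} {Ω : Set ℂ} {δ₁ l m : ℝ} {u : ℂ → ℂ} {t φ ζ : ℂ → ℝ} {x : ℂ}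

lemma PolarSol.gradSq_eq (h : PolarSol γ W Ω δ₁ l u t φ) (hγ : IsLoop γ L) (hx : x ∈ Ω) :
    gradSq u x = (1 - curv γ (φ x) * t x) ^ 2 * gradNormSq φ x + gradNormSq t x := by
  have h1 := (h.equations hγ hx).1
  have h2 : ∀ a b : ℝ, ‖deriv γ (φ x) * ((a : ℂ) + (b : ℂ) * I)‖ ^ 2 = a ^ 2 + b ^ 2 := by
    intro a b
    rw [norm_mul, hγ.arclength, one_mul, norm_sq_re_im]; simp
  rw [gradSq, h1, h1, h2, h2, gradNormSq, gradNormSq]; ring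

set_option maxHeartbeats 800000 in
/-- Uniform pointwise consequences of the equations in tubular coordinates. -/
theorem Setting.exists_basic (S : Setting γ L W Ω δ₁ m ζ) :
    ∃ C > 0, ∀ l u t φ, DirSol γ W Ω δ₁ ζ l u t φ → ∀ x ∈ Ω,
      0 ≤ forcing γ W u t φ x ∧
      gradSq u x ≤ C * (gradNormSq φ x + gradNormSq t x) ∧
      gradNormSq φ x ≤ C * gradSq u x ∧
      |lapR φ x| ≤ C * (l * forcing γ W u t φ x + |gradDot φ t x| + |t x| * gradNormSq φ x) ∧
      2 * gradNormSq t x + 2 * (l * forcing γ W u t φ x) - C * (|t x| * gradNormSq φ x) ≤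
        lapR (fun y => t y ^ 2) x := by
  obtain ⟨K, hK, hκ, hκ'⟩ := S.exists_curv_bounds
  have hδ := S.δpos
  have hm := S.mpos
  obtain ⟨A, hA⟩ : ∃ A, A = 1 + K * δ₁ := ⟨_, rfl⟩
  have hA0 : 1 ≤ A := by rw [hA]; nlinarith [mul_pos hK hδ]
  obtain ⟨C, hC, c1, c2, c3, c4, c5⟩ : ∃ C : ℝ, 0 < C ∧ A ^ 2 ≤ C ∧ 9 / 4 ≤ C ∧ m ≤ C ∧ 3 * K ≤ C ∧
      2 * (A * K) ≤ C := by
    refine ⟨A ^ 2 + 9 / 4 + m + 3 * K + 2 * (A * K), by positivity, ?_, ?_, ?_, ?_, ?_⟩ <;>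
    nlinarith [mul_pos (by linarith : (0 : ℝ) < A) hK, sq_nonneg A]
  refine ⟨C, hC, fun l u t φ h x hx => ?_⟩
  obtain ⟨t1, t2, t3, t4⟩ := h.tube S.loop S.maxp S.smooth_W hδ hm (subset_closure hx)
  obtain ⟨-, e1, e2⟩ := h.equations S.loop hx
  have hE := h.gradSq_eq S.loop hx
  have ht := h.le x (subset_closure hx)
  have hP := gradNormSq_nonneg φ x
  have hQ := gradNormSq_nonneg t x
  have hl := h.lpos
  rw [lapR_sq (h.contDiffAt_t hx), e2]
  obtain ⟨a, ha⟩ : ∃ a, a = 1 - curv γ (φ x) * t x := ⟨_, rfl⟩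
  have hkt : |curv γ (φ x) * t x| ≤ K * δ₁ := by
    rw [abs_mul]; exact mul_le_mul (hκ _) ht (abs_nonneg _) hK.le
  have haA : a ≤ A := by rw [ha, hA]; linarith [(abs_le.1 hkt).1]
  have hκ1 := hκ (φ x)
  have hκ2 := hκ' (φ x)
  have hpq : fderiv ℝ φ x 1 * fderiv ℝ t x 1 + fderiv ℝ φ x I * fderiv ℝ t x I = gradDot φ t x := rfl
  rw [← ha] at hE t1 t2 e1 ⊢
  rw [hpq] at e1
  have hft : t x * ip (gradW W (u x)) (I * deriv γ (φ x)) = forcing γ W u t φ x := rfl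
  obtain ⟨f, hf⟩ : ∃ f, f = forcing γ W u t φ x := ⟨_, rfl⟩
  rw [← hf] at hft t2 t4 ⊢
  clear hf t3 hkt hA e2 hpq ha
  generalize ip (gradW W (u x)) (I * deriv γ (φ x)) = Y at *
  generalize ip (gradW W (u x)) (deriv γ (φ x)) = X at *
  generalize gradNormSq φ x = P at *
  generalize gradNormSq t x = Q at *
  generalize gradDot φ t x = R at *
  generalize lapR φ x = D at *
  generalize curv γ (φ x) = κ at *
  generalize deriv (curv γ) (φ x) = κ' at *
  generalize t x = s at *
  rw [hE]
  have ha0 : 0 < a := by linarith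
  have haa : a ^ 2 ≤ A ^ 2 := by gcongr
  refine ⟨t4, ?_, ?_, ?_, ?_⟩
  · linarith [mul_le_mul_of_nonneg_right (haa.trans c1) hP,
      mul_le_mul_of_nonneg_right (by linarith : 1 ≤ C) hQ]
  · have h1 : 1 ≤ C * a ^ 2 := by nlinarith
    nlinarith [mul_le_mul_of_nonneg_right h1 hP, mul_nonneg hC.le hQ]
  · have h1 : |l * X| ≤ a * (m * (l * f)) := by
      rw [abs_mul, abs_of_pos hl]
      calc _ ≤ l * (a * m * f) := by gcongr
        _ = _ := by ring
    have h2 : |2 * κ * R| ≤ 2 * K * |R| := by rw [abs_mul, abs_mul, abs_two]; gcongr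
    have h3 : |κ' * s * P| ≤ K * (|s| * P) := by
      rw [abs_mul, abs_mul, abs_of_nonneg hP, mul_assoc]; gcongr
    have h4 : |a * D| ≤ a * (m * (l * f)) + 2 * K * |R| + K * (|s| * P) := by
      rw [e1]
      exact (abs_add_le _ _).trans (add_le_add ((abs_add_le _ _).trans (add_le_add h1 h2)) h3)
    rw [abs_mul, abs_of_pos ha0] at h4
    have h5 : 0 ≤ |R| := abs_nonneg _
    have h6 : 0 ≤ |s| * P := by positivity
    have h7 : 2 * K * |R| ≤ a * (3 * K * |R|) := by nlinarith [mul_nonneg hK.le h5]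
    have h8 : K * (|s| * P) ≤ a * (3 * K * (|s| * P)) := by nlinarith [mul_nonneg hK.le h6]
    have h9 : a * |D| ≤ a * (m * (l * f) + 3 * K * |R| + 3 * K * (|s| * P)) := by linarith
    have h10 := le_of_mul_le_mul_left h9 ha0
    have h11 : 0 ≤ l * f := by positivity
    linarith [mul_le_mul_of_nonneg_right c3 h11, mul_le_mul_of_nonneg_right c4 h5,
      mul_le_mul_of_nonneg_right c4 h6]
  · have h1 : |s * (a * κ * P)| ≤ A * K * (|s| * P) := by
      rw [abs_mul, abs_mul, abs_mul, abs_of_nonneg hP, abs_of_pos ha0]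
      calc _ = a * |κ| * (|s| * P) := by ring
        _ ≤ _ := by gcongr
    have h2 : 0 ≤ |s| * P := by positivity
    have e : 2 * s * (l * Y - a * κ * P) + 2 * Q = 2 * Q + 2 * (l * f) - 2 * (s * (a * κ * P)) := by
      rw [← hft]; ring
    rw [e]
    linarith [(abs_le.1 h1).2, mul_le_mul_of_nonneg_right c5 h2]

end Basic

/-- A nonnegative potential vanishing on a curve and growing quadratically away from it. -/
structure NondegPotential (γ : ℝ → ℂ) (W : ℂ → ℝ) : Prop where
  nonneg : ∀ z, 0 ≤ W z
  zero : ∀ s, W (γ s) = 0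
  nondeg : ∃ μ > 0, ∃ δ > 0, ∀ z, infDist z (range γ) < δ → μ * infDist z (range γ) ^ 2 ≤ W z

section Grad

variable {γ : ℝ → ℂ} {L : ℝ} {W : ℂ → ℝ} {Ω : Set ℂ} {δ₁ l m : ℝ} {u : ℂ → ℂ} {t φ ζ : ℂ → ℝ} {x : ℂ}

/-- Differential inequalities for the energy density. -/
theorem Setting.exists_bochner (S : Setting γ L W Ω δ₁ m ζ) (N : NondegPotential γ W) :
    ∃ C > 0, ∃ β > 0, ∃ t₀ > 0, ∃ μ > 0, ∀ l u t φ, DirSol γ W Ω δ₁ ζ l u t φ → ∀ x ∈ Ω,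
      hessSq u x - C * l * gradSq u x ≤ lapR (gradSq u) x ∧
      ‖gradW W (u x)‖ ≤ C ∧
      (|t x| ≤ t₀ → hessSq u x - β * gradSq u x ^ 2 ≤ lapR (gradSq u) x) ∧
      (|t x| ≤ t₀ → μ * t x ^ 2 ≤ forcing γ W u t φ x) := by
  obtain ⟨μ, hμ, δ, hδ, hnd⟩ := N.nondeg
  obtain ⟨C, hC, t₀, ht₀, H1, H2, -, H4⟩ := S.loop.potential_bounds S.smooth_W N.nonneg N.zero
    hμ hδ hnd S.δpos
  obtain ⟨K, hK0, hK⟩ := S.loop.exists_bound S.loop.smooth.continuous S.loop.periodic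
  obtain ⟨A, hA⟩ := (isCompact_closedBall (0 : ℂ) (K + δ₁)).exists_bound_of_continuousOn
    (gradW_contDiff S.smooth_W).continuous.continuousOn
  refine ⟨max (2 * C) A, lt_max_of_lt_left (by positivity), 2 * C ^ 2 / μ ^ 2, by positivity, t₀, ht₀,
    μ, hμ, fun l u t φ h x hx => ?_⟩
  have hxc := subset_closure hx
  have ht := h.le x hxc
  have hpol := h.polar x hxc
  have hl := h.lpos
  have hB := bochner h.smooth_u (gradW_contDiff S.smooth_W) h.isOpen h.pde hx
  have hE0 := gradSq_nonneg u x
  have hS0 := hessSq_nonneg u x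
  have hf : |t x| ≤ t₀ → μ * t x ^ 2 ≤ forcing γ W u t φ x := fun h1 => by
    have := H4 (φ x) (t x) h1
    rwa [← hpol] at this
  refine ⟨?_, ?_, fun h1 => ?_, hf⟩
  · have h1 := H1 (φ x) (t x) ht (fderiv ℝ u x 1)
    have h2 := H1 (φ x) (t x) ht (fderiv ℝ u x I)
    rw [← hpol] at h1 h2
    have h3 := (abs_le.1 h1).1
    have h4 := (abs_le.1 h2).1
    have h5 : -(C * gradSq u x) ≤ ip (fderiv ℝ u x 1) (fderiv ℝ (gradW W) (u x) (fderiv ℝ u x 1)) +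
        ip (fderiv ℝ u x I) (fderiv ℝ (gradW W) (u x) (fderiv ℝ u x I)) := by
      rw [gradSq]; linarith
    have h6 := mul_le_mul_of_nonneg_left h5 (by positivity : 0 ≤ 2 * l)
    have h7 : 2 * C * (l * gradSq u x) ≤ max (2 * C) A * (l * gradSq u x) := by
      gcongr; exact le_max_left _ _
    rw [hB]; linarith
  · refine (hA _ ?_).trans (le_max_right _ _)
    rw [mem_closedBall_zero_iff, hpol]
    exact S.loop.norm_tub_le hK ht
  · have h2 := H2 (φ x) (t x) ht (fderiv ℝ u x 1)
    have h3 := H2 (φ x) (t x) ht (fderiv ℝ u x I)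
    rw [← hpol] at h2 h3
    have h4 : -(C * |t x| * gradSq u x) ≤
        ip (fderiv ℝ u x 1) (fderiv ℝ (gradW W) (u x) (fderiv ℝ u x 1)) +
        ip (fderiv ℝ u x I) (fderiv ℝ (gradW W) (u x) (fderiv ℝ u x I)) := by
      rw [gradSq]; linarith
    have h5 := mul_le_mul_of_nonneg_left h4 (by positivity : 0 ≤ 2 * l)
    have h6 : μ * |t x| ≤ ‖gradW W (u x)‖ := by
      have h7 := hf h1
      have h8 : forcing γ W u t φ x ≤ |t x| * ‖gradW W (u x)‖ := by
        refine (le_abs_self _).trans ?_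
        rw [forcing, abs_mul]
        have := ip_abs_le (gradW W (u x)) (I * deriv γ (φ x))
        rw [S.loop.norm_I_deriv, mul_one] at this
        exact mul_le_mul_of_nonneg_left this (abs_nonneg _)
      rcases (abs_nonneg (t x)).eq_or_lt with h0 | h0
      · rw [← h0, mul_zero]; positivity
      · refine le_of_mul_le_mul_left ?_ h0
        calc |t x| * (μ * |t x|) = μ * t x ^ 2 := by rw [← sq_abs]; ring
          _ ≤ _ := h7.trans h8
    have h7 := norm_lapC_sq_le u x
    rw [h.pde x hx, norm_smul, Real.norm_of_nonneg hl.le] at h7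
    obtain ⟨n, hn⟩ : ∃ n, n = l * ‖gradW W (u x)‖ := ⟨_, rfl⟩
    rw [← hn] at h7
    have h8 : l * |t x| ≤ n / μ := by
      rw [le_div_iff₀ hμ, hn]
      calc _ = l * (μ * |t x|) := by ring
        _ ≤ _ := by gcongr
    have h9 : 2 * C * (l * |t x|) * gradSq u x ≤ 2 * C * (n / μ) * gradSq u x := by gcongr
    have h10 : 2 * C * (n / μ) * gradSq u x ≤ n ^ 2 / 2 + 2 * C ^ 2 / μ ^ 2 * gradSq u x ^ 2 := by
      have e : n ^ 2 / 2 + 2 * C ^ 2 / μ ^ 2 * gradSq u x ^ 2 - 2 * C * (n / μ) * gradSq u x =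
        (n - 2 * C / μ * gradSq u x) ^ 2 / 2 := by ring
      nlinarith [sq_nonneg (n - 2 * C / μ * gradSq u x)]
    rw [hB]; linarith

lemma contDiffAt_gradSq (hu : ContDiff ℝ (⊤ : ℕ∞) u) (x : ℂ) : ContDiffAt ℝ 2 (gradSq u) x :=
  ((contDiff_gradSq hu).of_le two_le_smooth).contDiffAt

/-- Interior gradient bound with the natural scaling. -/
theorem Setting.gradSq_le_scaled (S : Setting γ L W Ω δ₁ m ζ) (N : NondegPotential γ W) :
    ∃ C > 0, ∀ l u t φ, DirSol γ W Ω δ₁ ζ l u t φ → ∀ x₀ r, 0 < r → closedBall x₀ r ⊆ Ω →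
      gradSq u x₀ ≤ C * (l + 1 / r ^ 2) := by
  obtain ⟨C, hC, _, _, _, _, _, _, HB⟩ := S.exists_bochner N
  obtain ⟨P, C', -, -, -, -, c, hc, B, hB, HV⟩ := S.exists_aux
  obtain ⟨A, hA, HA⟩ := S.exists_basic
  refine ⟨(C + 72) / (c / A) * (B + 1), by positivity, fun l u t φ h x₀ r hr hball => ?_⟩
  have hl := h.lpos
  obtain ⟨-, hV2, hV3, hV4⟩ := HV l u t φ h
  obtain ⟨M, h1, h2⟩ := bernstein_estimate (E := gradSq u) (S := hessSq u)
    (V := fun y => Real.exp (C' * (φ y + P (t y)))) (x₀ := x₀) (α := C * l) (β := 0) (c := c / A)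
    (k := 1 / r ^ 2) (ν := B) hr (by positivity) le_rfl (by positivity) (by positivity) (fun x hx =>
      ⟨contDiffAt_gradSq h.smooth_u x, gradSq_nonneg u x, hessSq_nonneg u x,
        gradNormSq_gradSq_le h.smooth_u x, by linarith [(HB l u t φ h x (hball hx)).1]⟩) (fun x hx =>
      ⟨(hV2.contDiffAt (h.isOpen.mem_nhds (hball hx))).of_le two_le_smooth, by
        obtain ⟨a1, a2, -⟩ := HA l u t φ h x (hball hx)
        refine le_trans ?_ (hV4 x (hball hx))
        have h3 : c / A * gradSq u x ≤ c * (gradNormSq φ x + gradNormSq t x) := by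
          calc _ ≤ c / A * (A * (gradNormSq φ x + gradNormSq t x)) := by gcongr
            _ = _ := by field_simp
        have h4 : 0 ≤ c * (l * forcing γ W u t φ x) := by positivity
        have h5 : 0 ≤ 1 / r ^ 2 := by positivity
        linarith⟩) (fun y hy z hz => by
        have := hV3 y (subset_closure (hball hy))
        have h5 := Real.exp_pos (C' * (φ z + P (t z)))
        linarith)
  refine h1.trans (h2.trans ?_)
  have e : 1 / r ^ 2 * r ^ 2 = 1 := by field_simp
  rw [e, zero_mul, add_zero]
  have h3 : C * l + 72 / r ^ 2 ≤ (C + 72) * (l + 1 / r ^ 2) := by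
    have : 0 ≤ 72 * l + C * (1 / r ^ 2) := by positivity
    have e2 : 72 / r ^ 2 = 72 * (1 / r ^ 2) := by ring
    rw [e2]; linarith
  calc (C * l + 72 / r ^ 2) / (c / A) * (B + 1)
      ≤ (C + 72) * (l + 1 / r ^ 2) / (c / A) * (B + 1) := by gcongr
    _ = _ := by ring

end Grad

lemma exists_nearest_frontier {Ω : Set ℂ} (hΩ : IsOpen Ω) (hb : IsBounded Ω) {x : ℂ} (hx : x ∈ Ω) :
    ∃ y ∈ frontier Ω, 0 < ‖x - y‖ ∧ ball x ‖x - y‖ ⊆ Ω := by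
  have hne : (Ωᶜ).Nonempty := by
    rw [nonempty_compl]
    rintro rfl
    exact NormedSpace.unbounded_univ ℝ ℂ hb
  obtain ⟨y, hy, hxy⟩ := hΩ.isClosed_compl.exists_infDist_eq_dist hne x
  have hball : ball x ‖x - y‖ ⊆ Ω := by
    rw [← dist_eq_norm, ← hxy]; exact ball_infDist_compl_subset
  have hpos : 0 < ‖x - y‖ := by
    rw [norm_pos_iff, sub_ne_zero]; rintro rfl; exact hy hx
  refine ⟨y, ?_, hpos, hball⟩
  rw [hΩ.frontier_eq]
  refine ⟨closure_mono hball ?_, hy⟩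
  rw [closure_ball _ hpos.ne', mem_closedBall, dist_comm, dist_eq_norm]

section Grad

variable {γ : ℝ → ℂ} {L : ℝ} {W : ℂ → ℝ} {Ω : Set ℂ} {δ₁ l m : ℝ} {u : ℂ → ℂ} {t φ ζ : ℂ → ℝ} {x : ℂ}

lemma IsLoop.norm_tub_sub_le (h : IsLoop γ L) (s t s' t' : ℝ) :
    ‖tub γ s t - tub γ s' t'‖ ≤ |s - s'| + |t| + |t'| := by
  have h1 : ‖γ s - γ s'‖ ≤ 1 * ‖s - s'‖ :=
    Convex.norm_image_sub_le_of_norm_deriv_le (s := univ)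
      (fun x _ => (h.smooth.differentiable (by simp)).differentiableAt)
      (fun x _ => (h.arclength x).le) convex_univ (mem_univ _) (mem_univ _)
  rw [one_mul, Real.norm_eq_abs] at h1
  have e : tub γ s t - tub γ s' t' =
      (γ s - γ s') + (t : ℂ) * (I * deriv γ s) - (t' : ℂ) * (I * deriv γ s') := by
    simp [tub]; ring
  rw [e]
  refine (norm_sub_le _ _).trans (add_le_add ((norm_add_le _ _).trans (add_le_add h1 ?_)) ?_) <;>
  rw [norm_mul, norm_real, h.norm_I_deriv, mul_one, Real.norm_eq_abs]

lemma Setting.exists_lipschitz (S : Setting γ L W Ω δ₁ m ζ) :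
    ∃ K > 0, ∀ x ∈ closure Ω, ∀ y ∈ closure Ω, |ζ x - ζ y| ≤ K * ‖x - y‖ := by
  obtain ⟨R, hR⟩ := S.bounded.closure.subset_closedBall 0
  have hc : Continuous (fderiv ℝ ζ) := S.smooth_ζ.continuous_fderiv (by simp)
  obtain ⟨K, hK⟩ := (isCompact_closedBall (0 : ℂ) R).exists_bound_of_continuousOn
    (f := fderiv ℝ ζ) hc.continuousOn
  refine ⟨max K 1, by positivity, fun x hx y hy => ?_⟩
  exact Convex.norm_image_sub_le_of_norm_fderiv_le
    (fun z _ => (S.smooth_ζ.differentiable (by simp)).differentiableAt)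
    (fun z hz => (hK z hz).trans (le_max_left _ _)) (convex_closedBall _ _) (hR hy) (hR hx)

lemma Setting.exists_displacement (S : Setting γ L W Ω δ₁ m ζ) :
    ∃ K > 0, ∀ l u t φ, DirSol γ W Ω δ₁ ζ l u t φ → ∀ y ∈ frontier Ω, ∀ x₀ ∈ closure Ω,
      ∀ x ∈ closure Ω, |φ x - φ x₀| ≤ K * (‖x₀ - y‖ + ‖x - x₀‖) ∧
        |t x| ≤ K * (‖x₀ - y‖ + ‖x - x₀‖) := by
  obtain ⟨A, hA, HA⟩ := S.exists_lipschitz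
  obtain ⟨B, hB, HB⟩ := S.barrier
  refine ⟨2 * B + A, by positivity, fun l u t φ h y hy x₀ hx₀ x hx => ?_⟩
  obtain ⟨h1, h2⟩ := HB l u t φ h y hy x hx
  obtain ⟨h3, -⟩ := HB l u t φ h y hy x₀ hx₀
  have h4 := HA x hx x₀ hx₀
  have h5 : ‖x - y‖ ≤ ‖x₀ - y‖ + ‖x - x₀‖ := by
    have := norm_add_le (x - x₀) (x₀ - y)
    rw [sub_add_sub_cancel] at this
    linarith
  have h6 : B * ‖x - y‖ ≤ B * (‖x₀ - y‖ + ‖x - x₀‖) := by gcongr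
  have p1 : 0 ≤ A * ‖x₀ - y‖ := by positivity
  have p2 : 0 ≤ B * ‖x₀ - y‖ := by positivity
  have p3 : 0 ≤ B * ‖x - x₀‖ := by positivity
  have p4 : 0 ≤ A * ‖x - x₀‖ := by positivity
  constructor
  · rw [abs_le] at h1 h3 h4 ⊢
    constructor <;> linarith
  · linarith

lemma lapR_normSq_sub (hu : ContDiff ℝ (⊤ : ℕ∞) u) (c x : ℂ) :
    lapR (fun y => ‖u y - c‖ ^ 2) x = 2 * ip (u x - c) (lapC u x) + 2 * gradSq u x := by
  have h : ∀ e, (fun y => fderiv ℝ (fun y => u y - c) y e) = fun y => fderiv ℝ u y e := fun e => by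
    funext y; rw [fderiv_sub_const]
  rw [lapR_normSq (((hu.sub contDiff_const).of_le two_le_smooth).contDiffAt)]
  have h1 : lapC (fun y => u y - c) x = lapC u x := by simp only [lapC, h]
  have h2 : gradSq (fun y => u y - c) x = gradSq u x := by
    simp only [gradSq, fderiv_sub_const]
  rw [h1, h2]

/-- Gradient bound for bounded values of the parameter. -/
theorem Setting.gradSq_le_of_le (S : Setting γ L W Ω δ₁ m ζ) (N : NondegPotential γ W) (Λ : ℝ) :
    ∃ C, ∀ l u t φ, DirSol γ W Ω δ₁ ζ l u t φ → l ≤ Λ → ∀ x ∈ Ω, gradSq u x ≤ C := by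
  obtain ⟨A, hA, _, _, _, _, _, _, HB⟩ := S.exists_bochner N
  obtain ⟨K, hK, HK⟩ := S.exists_displacement
  obtain ⟨D, hD⟩ := S.bounded.closure.subset_closedBall 0
  by_cases hΛ : 0 < Λ
  swap
  · exact ⟨0, fun l u t φ h hl => absurd (h.lpos.trans_le hl) hΛ⟩
  obtain ⟨D', hD'⟩ : ∃ D', D' = |D| + 1 := ⟨_, rfl⟩
  have hD0 : 0 < D' := by rw [hD']; positivity
  obtain ⟨k, hk⟩ : ∃ k, k = 2 * (9 * K * D') * (Λ * A) + 1 := ⟨_, rfl⟩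
  have hk0 : 0 < k := by rw [hk]; positivity
  refine ⟨(A * Λ * D' ^ 2 + 72) / 2 * (81 * K ^ 2 + k), fun l u t φ h hlΛ x₀ hx₀ => ?_⟩
  have hl := h.lpos
  obtain ⟨y, hy, hpos, hball⟩ := exists_nearest_frontier S.isOpen S.bounded hx₀
  obtain ⟨r, hr⟩ : ∃ r, r = ‖x₀ - y‖ / 2 := ⟨_, rfl⟩
  have hr0 : 0 < r := by rw [hr]; positivity
  have hxy : ‖x₀ - y‖ = 2 * r := by rw [hr]; ring
  have hsub : closedBall x₀ r ⊆ Ω := (closedBall_subset_ball (by rw [hr]; linarith)).trans hball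
  have hrD : r ≤ D' := by
    have h1 := hD (subset_closure hx₀)
    have h2 := hD (frontier_subset_closure hy)
    rw [mem_closedBall_zero_iff] at h1 h2
    have := norm_sub_le x₀ y
    rw [hD']; linarith [le_abs_self D]
  have hosc : ∀ x ∈ closedBall x₀ r, ‖u x - u x₀‖ ≤ 9 * K * r := by
    intro x hx
    have hxΩ := subset_closure (hsub hx)
    have hx₀Ω := subset_closure hx₀
    obtain ⟨h1, h2⟩ := HK l u t φ h y hy x₀ hx₀Ω x hxΩ
    obtain ⟨-, h3⟩ := HK l u t φ h y hy x₀ hx₀Ω x₀ hx₀Ω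
    rw [mem_closedBall, dist_eq_norm] at hx
    have h4 : K * (‖x₀ - y‖ + ‖x - x₀‖) ≤ K * (3 * r) := by
      rw [hxy]; gcongr; linarith
    have h5 : K * (‖x₀ - y‖ + ‖x₀ - x₀‖) ≤ K * (3 * r) := by
      rw [hxy, sub_self, norm_zero]; gcongr; linarith
    rw [h.polar x hxΩ, h.polar x₀ hx₀Ω]
    refine (S.loop.norm_tub_sub_le _ _ _ _).trans ?_
    linarith
  obtain ⟨M, h1, h2⟩ := bernstein_estimate (E := gradSq u) (S := hessSq u)
    (V := fun y => ‖u y - u x₀‖ ^ 2) (x₀ := x₀) (α := A * l) (β := 0) (c := 2)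
    (k := k) (ν := (9 * K * r) ^ 2) hr0 (by positivity) le_rfl (by positivity) hk0 (fun x hx =>
      ⟨contDiffAt_gradSq h.smooth_u x, gradSq_nonneg u x, hessSq_nonneg u x,
        gradNormSq_gradSq_le h.smooth_u x, by linarith [(HB l u t φ h x (hsub hx)).1]⟩) (fun x hx =>
      ⟨((h.smooth_u.sub contDiff_const).of_le two_le_smooth).contDiffAt.norm_sq ℝ, by
        rw [lapR_normSq_sub h.smooth_u, h.pde x (hsub hx)]
        have h3 := (ip_abs_le (u x - u x₀) (l • gradW W (u x)))
        rw [norm_smul, Real.norm_of_nonneg hl.le] at h3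
        have h4 : ‖u x - u x₀‖ * (l * ‖gradW W (u x)‖) ≤ 9 * K * D' * (Λ * A) := by
          have := (HB l u t φ h x (hsub hx)).2.1
          have := (hosc x hx).trans (mul_le_mul_of_nonneg_left hrD (by positivity))
          gcongr
        have h5 := (abs_le.1 (h3.trans h4)).1
        rw [hk]; linarith⟩) (fun y hy z hz => by
        have h3 : ‖u y - u x₀‖ ^ 2 ≤ (9 * K * r) ^ 2 := by
          gcongr; exact hosc y hy
        have h4 : 0 ≤ ‖u z - u x₀‖ ^ 2 := by positivity
        linarith)
  refine h1.trans (h2.trans ?_)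
  have e : (A * l + 0 * M + 72 / r ^ 2) / 2 * ((9 * K * r) ^ 2 + k * r ^ 2) =
      (A * l * r ^ 2 + 72) / 2 * (81 * K ^ 2 + k) := by
    field_simp; ring
  rw [e]
  gcongr

end Grad

section Grad

variable {γ : ℝ → ℂ} {L : ℝ} {W : ℂ → ℝ} {Ω : Set ℂ} {δ₁ l m : ℝ} {u : ℂ → ℂ} {t φ ζ : ℂ → ℝ} {x : ℂ}

lemma lapR_sub_const (f : ℂ → ℝ) (a : ℝ) (y : ℂ) :
    lapR (fun z => f z - a) y = lapR f y := by
  have h : ∀ e, (fun z => fderiv ℝ (fun z => f z - a) z e) = fun z => fderiv ℝ f z e := fun e => by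
    funext z; rw [fderiv_sub_const]
  simp only [lapR, h]

lemma late_algebra {A s τ f P Q R D T : ℝ} (hA : 0 < A) (hf : 0 ≤ f) (hP : 0 ≤ P) (hQ : 0 ≤ Q)
    (hR : |R| ≤ P + Q) (hs : 8 * A * |s| ≤ 1) (hτ : 8 * A * |τ| ≤ 1) (hτ1 : |τ| ≤ 1)
    (hD : |D| ≤ A * (f + |R| + |τ| * P)) (hT : 2 * Q + 2 * f - A * (|τ| * P) ≤ T) :
    P + Q ≤ 2 * s * D + 2 * P + T := by
  have h1 : |τ| * P ≤ P := mul_le_of_le_one_left hP hτ1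
  have h2 : |D| ≤ A * (f + 2 * P + Q) := hD.trans (mul_le_mul_of_nonneg_left (by linarith) hA.le)
  have h3 : |2 * s * D| ≤ 1 / 4 * (f + 2 * P + Q) := by
    rw [abs_mul, abs_mul, abs_two]
    calc _ ≤ 2 * |s| * (A * (f + 2 * P + Q)) := by gcongr
      _ = (8 * A * |s|) * (1 / 4 * (f + 2 * P + Q)) := by ring
      _ ≤ 1 * (1 / 4 * (f + 2 * P + Q)) := by gcongr
      _ = _ := one_mul _
  have h4 : A * (|τ| * P) ≤ 1 / 8 * P := by
    calc _ = (8 * A * |τ|) * (1 / 8 * P) := by ring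
      _ ≤ 1 * (1 / 8 * P) := by gcongr
      _ = _ := one_mul _
  linarith [(abs_le.1 h3).1]

/-- Gradient bound for solutions whose normal coordinate is small and whose phase is close to its
harmonic extension. -/
theorem Setting.gradSq_le_of_small (S : Setting γ L W Ω δ₁ m ζ) (N : NondegPotential γ W) :
    ∃ η > 0, ∃ C, ∀ l u t φ, DirSol γ W Ω δ₁ ζ l u t φ →
      (∀ x ∈ closure Ω, |t x| ≤ η ∧ |φ x - ζ x| ≤ η) → ∀ x ∈ Ω, gradSq u x ≤ C := by
  obtain ⟨_, _, β, hβ, t₀, ht₀, _, _, HB⟩ := S.exists_bochner N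
  obtain ⟨K, hK, HK⟩ := S.exists_displacement
  obtain ⟨Λ, hΛ, HΛ⟩ := S.exists_lipschitz
  obtain ⟨A, hA, HA⟩ := S.exists_basic
  obtain ⟨K₁, hK₁⟩ : ∃ K₁, K₁ = 3 * K + 2 + Λ := ⟨_, rfl⟩
  have hK₁0 : 0 < K₁ := by rw [hK₁]; positivity
  obtain ⟨G, hG⟩ : ∃ G, G = A * (2 * K₁ ^ 2 + 1) := ⟨_, rfl⟩
  have hG0 : 0 < G := by rw [hG]; positivity
  obtain ⟨η, hη0, hηt, hη1, hη2, hη3, hη4⟩ : ∃ η > 0, η ≤ t₀ ∧ 8 * A * K₁ * η ≤ 1 ∧ K₁ * η ≤ 1 ∧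
      2 * β * G * η ≤ 1 ∧ η ≤ 1 := by
    have hD : 0 < 8 * A * K₁ + K₁ + 2 * β * G + 1 := by positivity
    have key : ∀ a, 0 ≤ a → a ≤ 8 * A * K₁ + K₁ + 2 * β * G + 1 →
        a * min t₀ (1 / (8 * A * K₁ + K₁ + 2 * β * G + 1)) ≤ 1 := fun a ha0 ha => by
      calc _ ≤ a * (1 / (8 * A * K₁ + K₁ + 2 * β * G + 1)) := by gcongr; exact min_le_right _ _
        _ ≤ 1 := by rw [mul_one_div, div_le_one hD]; exact ha
    have p1 : 0 < 8 * A * K₁ := by positivity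
    have p2 : 0 < 2 * β * G := by positivity
    refine ⟨min t₀ (1 / (8 * A * K₁ + K₁ + 2 * β * G + 1)), by positivity, min_le_left _ _,
      key _ p1.le (by linarith), key _ hK₁0.le (by linarith), key _ p2.le (by linarith), ?_⟩
    have := key 1 zero_le_one (by linarith)
    linarith
  refine ⟨η, hη0, 2 * (72 * G), fun l u t φ h hsm x₀ hx₀ => ?_⟩
  have hl := h.lpos
  obtain ⟨y, hy, hpos, hball⟩ := exists_nearest_frontier S.isOpen S.bounded hx₀
  obtain ⟨r, hr⟩ : ∃ r, r = min (‖x₀ - y‖ / 2) η := ⟨_, rfl⟩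
  have hr0 : 0 < r := by rw [hr]; positivity
  have hrη : r ≤ η := by rw [hr]; exact min_le_right _ _
  have hry : r ≤ ‖x₀ - y‖ / 2 := by rw [hr]; exact min_le_left _ _
  have hsub : closedBall x₀ r ⊆ Ω := (closedBall_subset_ball (by linarith)).trans hball
  have hx₀Ω := subset_closure hx₀
  have hosc : ∀ x ∈ closedBall x₀ r, |φ x - φ x₀| ≤ K₁ * r ∧ |t x| ≤ K₁ * r := by
    intro x hx
    have hxΩ := subset_closure (hsub hx)
    rw [mem_closedBall, dist_eq_norm] at hx
    rcases le_total (‖x₀ - y‖ / 2) η with h0 | h0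
    · rw [min_eq_left h0] at hr
      obtain ⟨h1, h2⟩ := HK l u t φ h y hy x₀ hx₀Ω x hxΩ
      have h4 : K * (‖x₀ - y‖ + ‖x - x₀‖) ≤ K * (3 * r) := by gcongr; linarith
      have h5 : K * (3 * r) ≤ K₁ * r := by rw [hK₁]; nlinarith [mul_pos hΛ hr0]
      exact ⟨h1.trans (h4.trans h5), h2.trans (h4.trans h5)⟩
    · rw [min_eq_right h0] at hr
      obtain ⟨h1, h2⟩ := hsm x hxΩ
      obtain ⟨-, h3⟩ := hsm x₀ hx₀Ω
      have h4 := (HΛ x hxΩ x₀ hx₀Ω).trans (mul_le_mul_of_nonneg_left hx hΛ.le)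
      rw [← hr] at h1 h2 h3
      have h5 : 0 < K * r := by positivity
      have h6 : 0 < Λ * r := by positivity
      rw [hK₁]
      rw [abs_le] at h2 h3 h4
      exact ⟨abs_le.2 ⟨by linarith, by linarith⟩, by linarith⟩
  have hKr : K₁ * r ≤ K₁ * η := by gcongr
  obtain ⟨M, h1, h2⟩ := bernstein_estimate (E := gradSq u) (S := hessSq u)
    (V := fun y => (φ y - φ x₀) ^ 2 + t y ^ 2) (x₀ := x₀) (α := 0) (β := β) (c := 1 / A)
    (k := 1) (ν := 2 * (K₁ * r) ^ 2) hr0 le_rfl hβ.le (by positivity) one_pos (fun x hx =>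
      ⟨contDiffAt_gradSq h.smooth_u x, gradSq_nonneg u x, hessSq_nonneg u x,
        gradNormSq_gradSq_le h.smooth_u x, by
          have := (HB l u t φ h x (hsub hx)).2.2.1
            (((hsm x (subset_closure (hsub hx))).1).trans hηt)
          linarith⟩) (fun x hx => by
        have hct := h.contDiffAt_t (hsub hx)
        have hcφ : ContDiffAt ℝ 2 (fun y => φ y - φ x₀) x :=
          (h.contDiffAt_φ (hsub hx)).sub contDiffAt_const
        refine ⟨(hcφ.pow 2).add (hct.pow 2), ?_⟩
        obtain ⟨a0, a1, -, a3, a4⟩ := HA l u t φ h x (hsub hx)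
        obtain ⟨b1, b2⟩ := hosc x hx
        have hgr : gradNormSq (fun y => φ y - φ x₀) x = gradNormSq φ x := by
          simp only [gradNormSq, fderiv_sub_const]
        rw [lapR_add (hcφ.pow 2) (hct.pow 2), lapR_sq hcφ, hgr, lapR_sub_const]
        have hR := abs_gradDot_le φ t x one_pos
        rw [inv_one, one_mul, one_mul] at hR
        have key := late_algebra (s := φ x - φ x₀) hA (mul_nonneg hl.le a0) (gradNormSq_nonneg φ x)
          (gradNormSq_nonneg t x) hR
          (by calc _ ≤ 8 * A * (K₁ * η) := by gcongr; exact b1.trans hKr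
                _ ≤ 1 := by linarith)
          (by calc _ ≤ 8 * A * (K₁ * η) := by gcongr; exact b2.trans hKr
                _ ≤ 1 := by linarith)
          (by linarith) a3 a4
        have h3 : 1 / A * gradSq u x ≤ gradNormSq φ x + gradNormSq t x := by
          rw [one_div_mul_eq_div, div_le_iff₀ hA]; linarith
        linarith) (fun y hy z hz => by
        obtain ⟨b1, b2⟩ := hosc y hy
        have h3 : (φ y - φ x₀) ^ 2 ≤ (K₁ * r) ^ 2 := by
          rw [← sq_abs]; gcongr
        have h4 : t y ^ 2 ≤ (K₁ * r) ^ 2 := by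
          rw [← sq_abs]; gcongr
        have h5 : 0 ≤ (φ z - φ x₀) ^ 2 + t z ^ 2 := by positivity
        linarith)
  have hM : 0 ≤ M := (gradSq_nonneg u x₀).trans h1
  have e : (0 + β * M + 72 / r ^ 2) / (1 / A) * (2 * (K₁ * r) ^ 2 + 1 * r ^ 2) =
      β * G * r ^ 2 * M + 72 * G := by
    rw [hG]; field_simp; ring
  rw [e] at h2
  have h3 : β * G * r ^ 2 * M ≤ 1 / 2 * M := by
    have : r ^ 2 ≤ η := by nlinarith
    have h4 : β * G * r ^ 2 ≤ β * G * η := by gcongr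
    gcongr
    linarith
  linarith

end Grad

section Phase

variable {γ : ℝ → ℂ} {L : ℝ} {W : ℂ → ℝ} {Ω : Set ℂ} {δ₁ l m : ℝ} {u : ℂ → ℂ} {t φ ζ : ℂ → ℝ} {x : ℂ}

lemma phase_algebra {A a M s c τ f P Q R D T w₂ θ : ℝ} (hA : 0 < A) (ha : 0 < a) (hM : 0 ≤ M)
    (hs : 0 < s) (hc : 0 < c)
    (hf : 0 ≤ f) (hP : 0 ≤ P) (hQ : 0 ≤ Q) (hτ : |τ| ≤ θ)
    (hR : |R| ≤ a * P + a⁻¹ * Q)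
    (hD : |D| ≤ A * (f + |R| + |τ| * P)) (hT : 2 * Q + 2 * f - A * (|τ| * P) ≤ T)
    (hw : c * (P + Q + f) ≤ w₂)
    (h1 : A * a ≤ s * c / 4) (h2 : A + A * a⁻¹ ≤ M) (h3 : A * (1 + M) * θ ≤ s * c / 4) :
    |D| ≤ M * T + s * w₂ := by
  have e1 : |τ| * P ≤ θ * P := by gcongr
  have e2 : A * (f + |R| + |τ| * P) ≤ A * (f + (a * P + a⁻¹ * Q) + θ * P) := by gcongr
  have e3 : M * (2 * Q + 2 * f - A * (θ * P)) ≤ M * T := by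
    refine mul_le_mul_of_nonneg_left (le_trans ?_ hT) hM
    have : A * (|τ| * P) ≤ A * (θ * P) := by gcongr
    linarith
  have e4 : s * (c * (P + Q + f)) ≤ s * w₂ := by gcongr
  have e5 : A * a * P ≤ s * c / 4 * P := by gcongr
  have e6 : A * (1 + M) * θ * P ≤ s * c / 4 * P := by gcongr
  have e7 : (A + A * a⁻¹) * Q ≤ M * Q := by gcongr
  have e8 : (A + A * a⁻¹) * f ≤ M * f := by gcongr
  have p1 : 0 ≤ A * a⁻¹ * f := by positivity
  have p2 : 0 ≤ A * Q := by positivity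
  have p3 : 0 ≤ s * c * P := by positivity
  have p4 : 0 ≤ s * c * Q := by positivity
  have p5 : 0 ≤ s * c * f := by positivity
  have p6 : 0 ≤ M * Q := by positivity
  have p7 : 0 ≤ M * f := by positivity
  nlinarith

lemma DirSol.lapR_phase_sub (h : DirSol γ W Ω δ₁ ζ l u t φ) (S : Setting γ L W Ω δ₁ m ζ)
    (hx : x ∈ Ω) : ContDiffAt ℝ 2 (fun y => φ y - ζ y) x ∧
      lapR (fun y => φ y - ζ y) x = lapR φ x := by
  have h1 := h.contDiffAt_φ hx
  have h2 : ContDiffAt ℝ 2 ζ x := (S.smooth_ζ.of_le two_le_smooth).contDiffAt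
  exact ⟨h1.sub h2, by rw [lapR_sub h1 h2, S.harm x hx, sub_zero]⟩

/-- If the normal coordinate is uniformly small, the phase is close to its harmonic extension. -/
theorem Setting.phase_small (S : Setting γ L W Ω δ₁ m ζ) {η : ℝ} (hη : 0 < η) :
    ∃ θ > 0, ∀ l u t φ, DirSol γ W Ω δ₁ ζ l u t φ → (∀ x ∈ closure Ω, |t x| ≤ θ) →
      ∀ x ∈ closure Ω, |φ x - ζ x| ≤ η := by
  obtain ⟨P, C, _, _, _, _, c, hc, B, hB, HW⟩ := S.exists_aux
  obtain ⟨A, hA, HA⟩ := S.exists_basic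
  obtain ⟨D, hD, hDb⟩ := S.exists_bound_of_continuous (distSq_contDiff 0).continuous
  obtain ⟨s, hs⟩ : ∃ s, s = η / (2 * B) := ⟨_, rfl⟩
  have hs0 : 0 < s := by rw [hs]; positivity
  have hsB : s * B = η / 2 := by rw [hs]; field_simp
  obtain ⟨d, hd⟩ : ∃ d, d = η / (2 * D) := ⟨_, rfl⟩
  have hd0 : 0 < d := by rw [hd]; positivity
  have hdD : d * D = η / 2 := by rw [hd]; field_simp
  obtain ⟨a, ha⟩ : ∃ a, a = s * c / (4 * A) := ⟨_, rfl⟩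
  have ha0 : 0 < a := by rw [ha]; positivity
  have haA : A * a ≤ s * c / 4 := by rw [ha]; field_simp; exact le_rfl
  obtain ⟨M, hM⟩ : ∃ M, M = A + A * a⁻¹ := ⟨_, rfl⟩
  have hM0 : 0 < M := by rw [hM]; positivity
  refine ⟨s * c / (4 * (A * (1 + M))), by positivity, fun l u t φ h hθ => ?_⟩
  obtain ⟨w, hw⟩ : ∃ w, w = fun y => Real.exp (C * (φ y + P (t y))) := ⟨_, rfl⟩
  obtain ⟨w1, w2, w3, w4⟩ := HW l u t φ h
  have w0 : ∀ x, 0 ≤ w x := fun x => by rw [hw]; positivity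
  rw [← hw] at w1 w2 w4
  replace w3 : ∀ x ∈ closure Ω, w x ≤ B := by rw [hw]; exact w3
  have key : ∀ σ : ℝ, |σ| = 1 → ∀ x ∈ closure Ω, σ * (φ x - ζ x) ≤ η := by
    intro σ hσ
    have hcψ : ContinuousOn (fun y => φ y - ζ y) (closure Ω) :=
      h.cont_φ.sub S.smooth_ζ.continuous.continuousOn
    have hcont : ContinuousOn (fun y => (σ * (φ y - ζ y) + M * t y ^ 2) + (s * w y +
        d * distSq 0 y)) (closure Ω) :=
      ((continuousOn_const.mul hcψ).add (continuousOn_const.mul (h.cont_t.pow 2))).add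
        ((continuousOn_const.mul w1).add
          (continuousOn_const.mul (distSq_contDiff 0).continuous.continuousOn))
    have main := le_of_lapR_pos (M := η) S.isOpen S.bounded hcont (fun x hx => by
        have hx' := frontier_subset_closure hx
        have h1 := mul_le_mul_of_nonneg_left (w3 x hx') hs0.le
        have h2 := mul_le_mul_of_nonneg_left ((le_abs_self _).trans (hDb x hx')) hd0.le
        simp only [h.bdry_t x hx, h.bdry_φ x hx, sub_self]
        linarith) (fun x hx => by
        obtain ⟨c1, e1⟩ := h.lapR_phase_sub S hx
        have c2 := (h.contDiffAt_t hx).pow 2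
        have c3 : ContDiffAt ℝ 2 w x :=
          (w2.contDiffAt (S.isOpen.mem_nhds hx)).of_le two_le_smooth
        have c4 := distSq_contDiffAt 0 x
        have d1 : ContDiffAt ℝ 2 (fun y => σ * (φ y - ζ y)) x := contDiffAt_const.mul c1
        have d2 : ContDiffAt ℝ 2 (fun y => M * t y ^ 2) x := contDiffAt_const.mul c2
        have d3 : ContDiffAt ℝ 2 (fun y => s * w y) x := contDiffAt_const.mul c3
        have d4 : ContDiffAt ℝ 2 (fun y => d * distSq 0 y) x := contDiffAt_const.mul c4
        refine ⟨(d1.add d2).add (d3.add d4), fun _ _ => ?_⟩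
        rw [lapR_add (d1.add d2) (d3.add d4), lapR_add d1 d2, lapR_add d3 d4,
          lapR_const_mul _ c1, lapR_const_mul _ c2, lapR_const_mul _ c3, lapR_const_mul _ c4,
          e1, lapR_distSq]
        obtain ⟨a0, _, _, a3, a4⟩ := HA l u t φ h x hx
        have h3 := phase_algebra hA ha0 hM0.le hs0 hc (mul_nonneg h.lpos.le a0)
          (gradNormSq_nonneg φ x) (gradNormSq_nonneg t x) (hθ x (subset_closure hx))
          (abs_gradDot_le φ t x ha0) a3 (by linarith) (w4 x hx) haA hM.ge (by field_simp; exact le_rfl)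
        have h4 : |σ * lapR φ x| = |lapR φ x| := by rw [abs_mul, hσ, one_mul]
        have h5 := neg_abs_le (σ * lapR φ x)
        rw [h4] at h5
        linarith)
    intro x hx
    have h1 := main x hx
    have h2 := mul_nonneg hs0.le (w0 x)
    have h3 : 0 ≤ d * distSq 0 x := by unfold distSq; positivity
    have h4 : 0 ≤ M * t x ^ 2 := by positivity
    linarith
  intro x hx
  have h1 := key 1 (by norm_num) x hx
  have h2 := key (-1) (by norm_num) x hx
  exact abs_le.2 ⟨by linarith, by linarith⟩

end Phase

section Decay

variable {γ : ℝ → ℂ} {L : ℝ} {W : ℂ → ℝ} {Ω : Set ℂ} {δ₁ l m : ℝ} {u : ℂ → ℂ} {t φ ζ : ℂ → ℝ} {x : ℂ}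

lemma norm_fderiv_sq_le (f : ℂ → ℝ) (x : ℂ) : ‖fderiv ℝ f x‖ ^ 2 ≤ gradNormSq f x := by
  have h : ‖fderiv ℝ f x‖ ≤ Real.sqrt (gradNormSq f x) := by
    refine ContinuousLinearMap.opNorm_le_bound _ (Real.sqrt_nonneg _) fun e => ?_
    have he : e = e.re • (1 : ℂ) + e.im • I := by
      apply Complex.ext <;> simp
    have h1 : fderiv ℝ f x e = e.re * fderiv ℝ f x 1 + e.im * fderiv ℝ f x I := by
      conv_lhs => rw [he]
      rw [map_add, map_smul, map_smul, smul_eq_mul, smul_eq_mul]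
    rw [h1, Real.norm_eq_abs]
    refine abs_le_of_sq_le_sq ?_ (by positivity)
    rw [mul_pow, Real.sq_sqrt (gradNormSq_nonneg f x), norm_sq_re_im, gradNormSq]
    nlinarith [sq_nonneg (e.re * fderiv ℝ f x I - e.im * fderiv ℝ f x 1)]
  calc _ ≤ Real.sqrt (gradNormSq f x) ^ 2 := by gcongr
    _ = _ := Real.sq_sqrt (gradNormSq_nonneg f x)

lemma abs_sub_le_of_gradNormSq_le {f : ℂ → ℝ} {x₀ : ℂ} {r G : ℝ} (hG : 0 ≤ G)
    (hf : ∀ x ∈ closedBall x₀ r, DifferentiableAt ℝ f x ∧ gradNormSq f x ≤ G ^ 2)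
    (hx : x ∈ closedBall x₀ r) : |f x - f x₀| ≤ G * ‖x - x₀‖ := by
  have hr : 0 ≤ r := dist_nonneg.trans hx
  refine (convex_closedBall x₀ r).norm_image_sub_le_of_norm_fderiv_le (fun y hy => (hf y hy).1)
    (fun y hy => ?_) (mem_closedBall_self hr) hx
  exact abs_le_of_sq_le_sq' ((norm_fderiv_sq_le f y).trans (hf y hy).2) hG |>.2

/-- A bounded subharmonic function cannot have large Laplacian on a small ball. -/
lemma log_comparison {w : ℂ → ℝ} {x₀ : ℂ} {R ρ k B : ℝ} (hρ : 0 < ρ) (hρR : ρ ≤ R) (hk : 0 < k)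
    (hw : ∀ x ∈ closedBall x₀ R, ContDiffAt ℝ 2 w x ∧ 0 ≤ w x ∧ w x ≤ B ∧ 0 ≤ lapR w x)
    (hw2 : ∀ x ∈ closedBall x₀ ρ, 2 * k / ρ ^ 2 ≤ lapR w x) :
    k / 2 * (Real.log (R ^ 2) - Real.log (ρ ^ 2)) < B + R ^ 2 := by
  have hR : 0 < R := hρ.trans_le hρR
  obtain ⟨b, hb⟩ : ∃ b, b = ρ ^ 2 := ⟨_, rfl⟩
  have hb0 : 0 < b := by rw [hb]; positivity
  have hD := distSq_contDiff x₀
  have hcont : ContinuousOn (fun z => w z + distSq x₀ z -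
      k / 2 * (Real.log (max (distSq x₀ z) b) - Real.log b + min (distSq x₀ z) b / b - 1))
      (closure (ball x₀ R)) := by
    rw [closure_ball x₀ hR.ne']
    have h1 : ContinuousOn w (closedBall x₀ R) := fun x hx =>
      (hw x hx).1.continuousAt.continuousWithinAt
    have h2 : Continuous fun z => Real.log (max (distSq x₀ z) b) :=
      (hD.continuous.max continuous_const).log fun z => (lt_max_of_lt_right hb0).ne'
    have h3 : Continuous fun z => k / 2 * (Real.log (max (distSq x₀ z) b) - Real.log b +
        min (distSq x₀ z) b / b - 1) :=
      continuous_const.mul (((h2.sub continuous_const).add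
        ((hD.continuous.min continuous_const).div_const b)).sub continuous_const)
    exact (h1.add hD.continuous.continuousOn).sub h3.continuousOn
  have main := le_of_touching (M := B + R ^ 2 - k / 2 * (Real.log (R ^ 2) - Real.log b))
    isOpen_ball isBounded_ball hcont (fun x hx => by
      rw [frontier_ball x₀ hR.ne', mem_sphere, dist_eq_norm] at hx
      have h1 : distSq x₀ x = R ^ 2 := by rw [distSq, hx]
      have h2 : b ≤ R ^ 2 := by rw [hb]; gcongr
      have h3 := (hw x (by rw [mem_closedBall, dist_eq_norm, hx])).2.2.1
      simp only [h1, max_eq_left h2, min_eq_right h2, div_self hb0.ne']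
      linarith) (fun x hx _ => by
      obtain ⟨c1, -, -, l1⟩ := hw x (ball_subset_closedBall hx)
      have c2 := distSq_contDiffAt x₀ x
      rcases le_or_gt (distSq x₀ x) b with hle | hgt
      · have c3 : ContDiffAt ℝ 2 (fun z => (-(k / (2 * b))) * distSq x₀ z) x :=
          contDiffAt_const.mul c2
        refine ⟨fun z => (w z + distSq x₀ z + (-(k / (2 * b))) * distSq x₀ z) - (-(k / 2)), ?_,
          Eventually.of_forall fun z => ?_, ((c1.add c2).add c3).sub contDiffAt_const,
          fun _ _ => ?_⟩
        · simp only [max_eq_right hle, min_eq_left hle]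
          field_simp; ring
        · have key : Real.log (max (distSq x₀ z) b) - Real.log b + min (distSq x₀ z) b / b - 1 ≤
              distSq x₀ z / b - 1 := by
            rcases le_total (distSq x₀ z) b with h | h
            · rw [max_eq_right h, min_eq_left h]; linarith
            · rw [max_eq_left h, min_eq_right h, div_self hb0.ne',
                ← Real.log_div (hb0.trans_le h).ne' hb0.ne']
              linarith [Real.log_le_sub_one_of_pos (div_pos (hb0.trans_le h) hb0)]
          have h2 := mul_le_mul_of_nonneg_left key (half_pos hk).le
          have h3 : k / 2 * (distSq x₀ z / b - 1) = k / (2 * b) * distSq x₀ z - k / 2 := by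
            field_simp
          linarith
        · rw [lapR_sub_const, lapR_add (c1.add c2) c3, lapR_add c1 c2, lapR_const_mul _ c2,
            lapR_distSq]
          have h1 := hw2 x (by
            rw [mem_closedBall, dist_eq_norm]
            rw [hb, distSq] at hle
            exact abs_le_of_sq_le_sq' hle hρ.le |>.2)
          have h2 : k / (2 * b) * 4 = 2 * k / ρ ^ 2 := by rw [hb]; field_simp; norm_num
          linarith
      · have hne : x ≠ x₀ := by
          rintro rfl
          simp [distSq] at hgt
          linarith
        obtain ⟨c3, e3⟩ := lapR_log_distSq hne
        have c4 : ContDiffAt ℝ 2 (fun z => (-(k / 2)) * Real.log (distSq x₀ z)) x :=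
          contDiffAt_const.mul c3
        refine ⟨fun z => (w z + distSq x₀ z + (-(k / 2)) * Real.log (distSq x₀ z)) -
          (-(k / 2) * Real.log b), ?_, ?_, ((c1.add c2).add c4).sub contDiffAt_const, fun _ _ => ?_⟩
        · simp only [max_eq_left hgt.le, min_eq_right hgt.le, div_self hb0.ne']
          ring
        · filter_upwards [(isOpen_Ioi.preimage hD.continuous).mem_nhds hgt] with z hz
          have hz : b < distSq x₀ z := hz
          simp only [max_eq_left hz.le, min_eq_right hz.le, div_self hb0.ne']
          linarith
        · rw [lapR_sub_const, lapR_add (c1.add c2) c4, lapR_add c1 c2, lapR_const_mul _ c3,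
            lapR_distSq, e3]
          linarith) x₀ (subset_closure (mem_ball_self hR))
  have h0 : distSq x₀ x₀ = 0 := by simp [distSq]
  simp only [h0, max_eq_right hb0.le, min_eq_left hb0.le, zero_div, sub_self] at main
  have := (hw x₀ (mem_closedBall_self hR.le)).2.1
  rw [← hb]
  linarith

end Decay

section Decay

variable {γ : ℝ → ℂ} {L : ℝ} {W : ℂ → ℝ} {Ω : Set ℂ} {δ₁ l m : ℝ} {u : ℂ → ℂ} {t φ ζ : ℂ → ℝ} {x : ℂ}

lemma DirSol.gradNormSq_t_le (h : DirSol γ W Ω δ₁ ζ l u t φ) (S : Setting γ L W Ω δ₁ m ζ)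
    (hx : x ∈ Ω) : gradNormSq t x ≤ gradSq u x := by
  rw [h.gradSq_eq S.loop hx]
  have := gradNormSq_nonneg φ x
  have : 0 ≤ (1 - curv γ (φ x) * t x) ^ 2 * gradNormSq φ x := by positivity
  linarith

/-- If the normal coordinate is not small somewhere, it takes the value `θ` inside the domain. -/
lemma DirSol.exists_abs_eq (h : DirSol γ W Ω δ₁ ζ l u t φ) (S : Setting γ L W Ω δ₁ m ζ) {θ : ℝ}
    (hθ : 0 < θ) (hx : x ∈ closure Ω) (hlt : θ < |t x|) : ∃ x₀ ∈ Ω, |t x₀| = θ := by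
  have := S.sc
  have hpre : IsPreconnected Ω := isPreconnected_iff_preconnectedSpace.2 inferInstance
  obtain ⟨z, hz⟩ := S.nonempty
  obtain ⟨y, hy, -⟩ := exists_nearest_frontier S.isOpen S.bounded hz
  have h1 := hpre.closure.intermediate_value (frontier_subset_closure hy) hx h.cont_t.abs
  have h0 : |t y| = 0 := by rw [h.bdry_t y hy, abs_zero]
  obtain ⟨x₀, hx₀, he⟩ := h1 (show θ ∈ Icc (|t y|) (|t x|) from ⟨by rw [h0]; exact hθ.le, hlt.le⟩)
  refine ⟨x₀, ?_, he⟩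
  by_contra hn
  have h2 : x₀ ∈ frontier Ω := ⟨hx₀, by rwa [S.isOpen.interior_eq]⟩
  simp only [h.bdry_t x₀ h2, abs_zero] at he
  exact hθ.ne he

/-- The normal coordinate tends to zero uniformly in the limit of a large penalization. -/
theorem Setting.normal_small (S : Setting γ L W Ω δ₁ m ζ) (N : NondegPotential γ W) {θ : ℝ}
    (hθ : 0 < θ) : ∃ Λ, ∀ l u t φ, DirSol γ W Ω δ₁ ζ l u t φ → Λ ≤ l →
      ∀ x ∈ closure Ω, |t x| ≤ θ := by
  obtain ⟨_, _, _, _, t₀, ht₀, μ, hμ, HB⟩ := S.exists_bochner N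
  wlog hθt : 2 * θ ≤ t₀ generalizing θ
  · obtain ⟨Λ, H⟩ := this (half_pos ht₀) (by linarith)
    exact ⟨Λ, fun l u t φ h hl x hx => (H l u t φ h hl x hx).trans (by linarith)⟩
  obtain ⟨P, C', _, _, _, _, c, hc, B, hB, HW⟩ := S.exists_aux
  obtain ⟨A, hA, HA⟩ := S.exists_basic
  obtain ⟨K, hK, HK⟩ := S.barrier
  obtain ⟨C, hC, HC⟩ := S.gradSq_le_scaled N
  obtain ⟨R, hR⟩ : ∃ R, R = θ / (2 * K) := ⟨_, rfl⟩
  have hR0 : 0 < R := by rw [hR]; positivity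
  obtain ⟨k, hk⟩ : ∃ k, k = c * μ * θ ^ 4 / (64 * C) := ⟨_, rfl⟩
  have hk0 : 0 < k := by rw [hk]; positivity
  obtain ⟨E, hE⟩ : ∃ E, E = Real.exp (2 * (B + R ^ 2) / k) := ⟨_, rfl⟩
  have hE0 : 0 < E := by rw [hE]; positivity
  refine ⟨4 / R ^ 2 + θ ^ 2 / (2 * C * R ^ 2) + θ ^ 2 / (8 * C * R ^ 2) * E,
    fun l u t φ h hl x hx => ?_⟩
  by_contra! hlt
  obtain ⟨x₀, hx₀, he⟩ := h.exists_abs_eq S hθ hx hlt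
  have hl0 := h.lpos
  have q1 : 0 < 4 / R ^ 2 := by positivity
  have q2 : 0 < θ ^ 2 / (2 * C * R ^ 2) := by positivity
  have q3 : 0 < θ ^ 2 / (8 * C * R ^ 2) * E := by positivity
  have l1 : 4 / R ^ 2 ≤ l := by linarith
  have l2 : θ ^ 2 / (2 * C * R ^ 2) ≤ l := by linarith
  have l3 : θ ^ 2 / (8 * C * R ^ 2) * E ≤ l := by linarith
  clear hl q1 q2 q3
  obtain ⟨y, hy, hpos, hball⟩ := exists_nearest_frontier S.isOpen S.bounded hx₀
  have hsub : closedBall x₀ R ⊆ Ω := by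
    refine (closedBall_subset_ball ?_).trans hball
    have h1 := (HK l u t φ h y hy x₀ (subset_closure hx₀)).2
    rw [he] at h1
    rw [hR, div_lt_iff₀ (by positivity)]
    nlinarith
  obtain ⟨G, hG⟩ : ∃ G, G = Real.sqrt (2 * C * l) := ⟨_, rfl⟩
  have hG0 : 0 < G := by rw [hG]; positivity
  have hG2 : G ^ 2 = 2 * C * l := by rw [hG]; exact Real.sq_sqrt (by positivity)
  obtain ⟨ρ, hρ⟩ : ∃ ρ, ρ = θ / (2 * G) := ⟨_, rfl⟩
  have hρ0 : 0 < ρ := by rw [hρ]; positivity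
  have hρ2 : ρ ^ 2 = θ ^ 2 / (8 * C * l) := by rw [hρ, div_pow, mul_pow, hG2]; ring
  have hρR : ρ ≤ R / 2 := by
    refine abs_le_of_sq_le_sq' ?_ (half_pos hR0).le |>.2
    rw [hρ2, div_le_iff₀ (by positivity)]
    rw [div_le_iff₀ (by positivity)] at l2
    linarith
  have hosc : ∀ z ∈ closedBall x₀ ρ, |t z - t x₀| ≤ θ / 2 := by
    intro z hz
    have h1 := abs_sub_le_of_gradNormSq_le (f := t) hG0.le (fun v hv => by
      have hvb : closedBall v (R / 2) ⊆ Ω := by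
        refine (closedBall_subset_closedBall' ?_).trans hsub
        have : dist v x₀ ≤ ρ := hv
        linarith
      have hvΩ : v ∈ Ω := hvb (mem_closedBall_self (half_pos hR0).le)
      refine ⟨(h.contDiffAt_t hvΩ).differentiableAt (by norm_num), ?_⟩
      have h2 := HC l u t φ h v (R / 2) (half_pos hR0) hvb
      have h3 : 1 / (R / 2) ^ 2 = 4 / R ^ 2 := by field_simp; norm_num
      rw [h3] at h2
      have h4 : C * (l + 4 / R ^ 2) ≤ C * (l + l) := by gcongr
      rw [hG2]
      linarith [h.gradNormSq_t_le S hvΩ]) hz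
    have h2 : ‖z - x₀‖ ≤ ρ := by rwa [mem_closedBall, dist_eq_norm] at hz
    refine h1.trans ((mul_le_mul_of_nonneg_left h2 hG0.le).trans_eq ?_)
    rw [hρ]; field_simp
  obtain ⟨w, hw⟩ : ∃ w, w = fun y => Real.exp (C' * (φ y + P (t y))) := ⟨_, rfl⟩
  obtain ⟨-, w2, w3, w4⟩ := HW l u t φ h
  have w0 : ∀ x, 0 ≤ w x := fun x => by rw [hw]; positivity
  rw [← hw] at w2 w4
  replace w3 : ∀ x ∈ closure Ω, w x ≤ B := by rw [hw]; exact w3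
  have wl : ∀ z ∈ Ω, c * (l * forcing γ W u t φ z) ≤ lapR w z := fun z hz => by
    refine le_trans ?_ (w4 z hz)
    have := gradNormSq_nonneg φ z
    have := gradNormSq_nonneg t z
    gcongr
    linarith
  have hcomp := log_comparison (w := w) (k := k) hρ0 (by linarith : ρ ≤ R) hk0 (B := B)
    (fun z hz => ⟨(w2.contDiffAt (S.isOpen.mem_nhds (hsub hz))).of_le two_le_smooth, w0 z,
      w3 z (subset_closure (hsub hz)), le_trans (by
        have := (HA l u t φ h z (hsub hz)).1
        positivity) (wl z (hsub hz))⟩)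
    (fun z hz => by
      have hzΩ : z ∈ Ω := hsub (closedBall_subset_closedBall (by linarith) hz)
      refine le_trans ?_ (wl z hzΩ)
      have h1 := hosc z hz
      have h2 : |t z| ≤ t₀ := by
        have := abs_sub_abs_le_abs_sub (t z) (t x₀)
        linarith
      have h3 : θ / 2 ≤ |t z| := by
        have := abs_sub_abs_le_abs_sub (t x₀) (t z)
        rw [abs_sub_comm] at this
        linarith
      have h4 := (HB l u t φ h z hzΩ).2.2.2 h2
      have h5 : (θ / 2) ^ 2 ≤ t z ^ 2 := by rw [← sq_abs (t z)]; gcongr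
      have h6 : c * (l * (μ * (θ / 2) ^ 2)) ≤ c * (l * forcing γ W u t φ z) := by
        gcongr
        exact (mul_le_mul_of_nonneg_left h5 hμ.le).trans h4
      refine le_trans (le_of_eq ?_) h6
      rw [hρ2, hk]
      field_simp
      try norm_num)
  have hlog : 2 * (B + R ^ 2) / k ≤ Real.log (R ^ 2) - Real.log (ρ ^ 2) := by
    rw [← Real.log_div (by positivity) (by positivity), Real.le_log_iff_exp_le (by positivity),
      ← hE, hρ2, le_div_iff₀ (by positivity)]
    rw [mul_comm, mul_div_assoc', div_le_iff₀ (by positivity)] at l3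
    rw [mul_div_assoc', div_le_iff₀ (by positivity)]
    linarith
  rw [div_le_iff₀ hk0] at hlog
  linarith

/-- Uniform gradient bound for all penalizations. -/
theorem Setting.gradSq_bounded (S : Setting γ L W Ω δ₁ m ζ) (N : NondegPotential γ W) :
    ∃ C, ∀ l u t φ, DirSol γ W Ω δ₁ ζ l u t φ → ∀ x ∈ Ω, gradSq u x ≤ C := by
  obtain ⟨η, hη, C₁, H₁⟩ := S.gradSq_le_of_small N
  obtain ⟨θ, hθ, H₂⟩ := S.phase_small hη
  obtain ⟨Λ, H₃⟩ := S.normal_small N (lt_min hθ hη)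
  obtain ⟨C₂, H₄⟩ := S.gradSq_le_of_le N Λ
  refine ⟨max C₁ C₂, fun l u t φ h x hx => ?_⟩
  rcases le_total l Λ with hl | hl
  · exact (H₄ l u t φ h hl x hx).trans (le_max_right _ _)
  · have h1 := H₃ l u t φ h hl
    exact (H₁ l u t φ h (fun y hy => ⟨(h1 y hy).trans (min_le_right _ _),
      H₂ l u t φ h (fun z hz => (h1 z hz).trans (min_le_left _ _)) y hy⟩) x hx).trans
      (le_max_left _ _)

/-- Uniform convergence of the phase. -/
theorem Setting.phase_tendsto (S : Setting γ L W Ω δ₁ m ζ) (N : NondegPotential γ W) {η : ℝ}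
    (hη : 0 < η) : ∃ Λ, ∀ l u t φ, DirSol γ W Ω δ₁ ζ l u t φ → Λ ≤ l →
      ∀ x ∈ closure Ω, |φ x - ζ x| ≤ η := by
  obtain ⟨θ, hθ, H₂⟩ := S.phase_small hη
  obtain ⟨Λ, H₃⟩ := S.normal_small N hθ
  exact ⟨Λ, fun l u t φ h hl => H₂ l u t φ h (H₃ l u t φ h hl)⟩

end Decay

section Green

variable {Ω : Set ℂ} {V χ : ℂ → ℝ}

lemma exists_cutoff {K : Set ℂ} (hΩ : IsOpen Ω) (hK : IsCompact K) (hKΩ : K ⊆ Ω) :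
    ∃ χ : ℂ → ℝ, ContDiff ℝ (⊤ : ℕ∞) χ ∧ HasCompactSupport χ ∧ tsupport χ ⊆ Ω ∧
      (∀ x, 0 ≤ χ x) ∧ ∀ x ∈ K, χ x = 1 := by
  obtain ⟨K', hK', h1, h2⟩ := exists_compact_between hK hΩ hKΩ
  obtain ⟨χ, hs, hr, hsupp, hone⟩ := exists_contMDiff_support_eq_eq_one_iff
    (modelWithCornersSelf ℝ ℂ) (n := (⊤ : ℕ∞)) isOpen_interior hK.isClosed h1
  have hts : tsupport χ ⊆ K' := by
    rw [tsupport, hsupp]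
    exact closure_minimal interior_subset hK'.isClosed
  exact ⟨χ, hs.contDiff, hK'.of_isClosed_subset (isClosed_tsupport χ) hts, hts.trans h2,
    fun x => (hr ⟨x, rfl⟩).1, fun x hx => (hone x).1 hx⟩

lemma integrable_mul_of_tsupport {a b : ℂ → ℝ} (hΩ : IsOpen Ω) (ha : Continuous a)
    (hac : HasCompactSupport a) (hsub : tsupport a ⊆ Ω) (hb : ContinuousOn b Ω) :
    Integrable (fun x => a x * b x) := by
  have h1 : tsupport (fun x => a x * b x) ⊆ tsupport a := tsupport_mul_subset_left
  refine Continuous.integrable_of_hasCompactSupport (continuous_of_tsupport fun x hx => ?_)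
    (hac.mul_right)
  exact ha.continuousAt.mul (hb.continuousAt (hΩ.mem_nhds (hsub (h1 hx))))

lemma ContDiffOn.fderiv_dir (hΩ : IsOpen Ω) (hV : ContDiffOn ℝ (⊤ : ℕ∞) V Ω) (e : ℂ) :
    ContDiffOn ℝ (⊤ : ℕ∞) (fun y => fderiv ℝ V y e) Ω :=
  (hV.fderiv_of_isOpen hΩ (m := ((⊤ : ℕ∞) : WithTop ℕ∞)) (by simp)).clm_apply contDiffOn_const

lemma integral_mul_dd (hΩ : IsOpen Ω) (hV : ContDiffOn ℝ (⊤ : ℕ∞) V Ω)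
    (hχ : ContDiff ℝ (⊤ : ℕ∞) χ) (hc : HasCompactSupport χ) (hsub : tsupport χ ⊆ Ω) (e : ℂ) :
    Integrable (fun x => χ x * fderiv ℝ (fun y => fderiv ℝ V y e) x e) ∧
    Integrable (fun x => fderiv ℝ (fun y => fderiv ℝ χ y e) x e * V x) ∧
    ∫ x, χ x * fderiv ℝ (fun y => fderiv ℝ V y e) x e =
      ∫ x, fderiv ℝ (fun y => fderiv ℝ χ y e) x e * V x := by
  have hV1 := hV.fderiv_dir hΩ e
  have hV2 := hV1.fderiv_dir hΩ e
  have hχ1 := hχ.fderiv_dir e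
  have hχ2 := hχ1.fderiv_dir e
  have sub : ∀ f : ℂ → ℝ, tsupport (fun y => fderiv ℝ f y e) ⊆ tsupport f := fun f =>
    tsupport_fderiv_apply_subset ℝ e
  have hc1 := hc.fderiv_dir e
  have hc2 := hc1.fderiv_dir e
  have i1 := integrable_mul_of_tsupport hΩ hχ.continuous hc hsub hV2.continuousOn
  have i2 := integrable_mul_of_tsupport hΩ hχ1.continuous hc1 ((sub χ).trans hsub) hV1.continuousOn
  have i3 := integrable_mul_of_tsupport hΩ hχ2.continuous hc2
    ((sub _).trans ((sub χ).trans hsub)) hV.continuousOn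
  have i4 := integrable_mul_of_tsupport hΩ hχ.continuous hc hsub hV1.continuousOn
  have i5 := integrable_mul_of_tsupport hΩ hχ1.continuous hc1 ((sub χ).trans hsub) hV.continuousOn
  have dat : ∀ {f : ℂ → ℝ}, ContDiffOn ℝ (⊤ : ℕ∞) f Ω → ∀ x ∈ Ω, DifferentiableAt ℝ f x :=
    fun hf x hx => (hf.contDiffAt (hΩ.mem_nhds hx)).differentiableAt (by simp)
  refine ⟨i1, i3, ?_⟩
  rw [integral_mul_fderiv_eq_neg_fderiv_mul_of_integrable i2 i1 i4
    (fun x _ => hχ.differentiable (by simp) x) (fun x hx => dat hV1 x (hsub hx)),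
    integral_mul_fderiv_eq_neg_fderiv_mul_of_integrable i3 i2 i5
    (fun x _ => hχ1.differentiable (by simp) x)
    (fun x hx => dat hV x (hsub (sub χ hx))), neg_neg]

/-- Green's formula against a compactly supported test function. -/
lemma integral_mul_lapR (hΩ : IsOpen Ω) (hV : ContDiffOn ℝ (⊤ : ℕ∞) V Ω)
    (hχ : ContDiff ℝ (⊤ : ℕ∞) χ) (hc : HasCompactSupport χ) (hsub : tsupport χ ⊆ Ω) :
    Integrable (fun x => χ x * lapR V x) ∧ Integrable (fun x => lapR χ x * V x) ∧
    ∫ x, χ x * lapR V x = ∫ x, lapR χ x * V x := by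
  obtain ⟨a1, a2, a3⟩ := integral_mul_dd hΩ hV hχ hc hsub 1
  obtain ⟨b1, b2, b3⟩ := integral_mul_dd hΩ hV hχ hc hsub I
  have e1 : (fun x => χ x * lapR V x) = fun x => χ x * fderiv ℝ (fun y => fderiv ℝ V y 1) x 1 +
      χ x * fderiv ℝ (fun y => fderiv ℝ V y I) x I := by
    funext x; rw [lapR, mul_add]
  have e2 : (fun x => lapR χ x * V x) = fun x => fderiv ℝ (fun y => fderiv ℝ χ y 1) x 1 * V x +
      fderiv ℝ (fun y => fderiv ℝ χ y I) x I * V x := by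
    funext x; rw [lapR, add_mul]
  rw [e1, e2]
  exact ⟨a1.add b1, a2.add b2, by rw [integral_add a1 b1, integral_add a2 b2, a3, b3]⟩

end Green

section Quartic

variable {γ : ℝ → ℂ} {L : ℝ} {W : ℂ → ℝ} {Ω : Set ℂ} {δ₁ l m : ℝ} {u : ℂ → ℂ} {t φ ζ : ℂ → ℝ} {x : ℂ}

lemma gradNormSq_sub_le {f g : ℂ → ℝ} (hf : DifferentiableAt ℝ f x) (hg : DifferentiableAt ℝ g x) :
    gradNormSq (fun y => f y - g y) x ≤ 2 * gradNormSq f x + 2 * gradNormSq g x := by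
  have h : fderiv ℝ (fun y => f y - g y) x = fderiv ℝ f x - fderiv ℝ g x := fderiv_sub hf hg
  simp only [gradNormSq, h, sub_apply]
  nlinarith [sq_nonneg (fderiv ℝ f x 1 + fderiv ℝ g x 1),
    sq_nonneg (fderiv ℝ f x I + fderiv ℝ g x I)]

lemma Setting.exists_phase_grad_bound (S : Setting γ L W Ω δ₁ m ζ) (N : NondegPotential γ W) :
    ∃ G > 0, ∀ l u t φ, DirSol γ W Ω δ₁ ζ l u t φ → ∀ x ∈ Ω,
      gradNormSq φ x ≤ G ∧ gradNormSq (fun y => φ y - ζ y) x ≤ G := by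
  obtain ⟨C₁, hC₁, H₁⟩ := S.exists_basic
  obtain ⟨C₂, H₂⟩ := S.gradSq_bounded N
  have hcont : Continuous (gradNormSq ζ) :=
    ((S.smooth_ζ.fderiv_dir 1).continuous.pow 2).add ((S.smooth_ζ.fderiv_dir I).continuous.pow 2)
  obtain ⟨Z, hZ, HZ⟩ := S.exists_bound_of_continuous hcont
  refine ⟨2 * (C₁ * |C₂|) + 2 * Z, by positivity, fun l u t φ h x hx => ?_⟩
  have h1 : gradNormSq φ x ≤ C₁ * |C₂| := (H₁ l u t φ h x hx).2.2.1.trans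
    (mul_le_mul_of_nonneg_left ((H₂ l u t φ h x hx).trans (le_abs_self _)) hC₁.le)
  have h2 := (le_abs_self _).trans (HZ x (subset_closure hx))
  have h3 := gradNormSq_sub_le ((h.contDiffAt_φ hx).differentiableAt (by norm_num))
    (S.smooth_ζ.differentiable (by simp) x)
  have h4 := gradNormSq_nonneg φ x
  exact ⟨by linarith, by linarith⟩

/-- A bounded function whose Laplacian dominates the squared gradient of `φ - ζ`. -/
lemma Setting.exists_square_aux (S : Setting γ L W Ω δ₁ m ζ) :
    ∃ C > 0, ∀ l u t φ, DirSol γ W Ω δ₁ ζ l u t φ → ∀ η, 0 < η → η ≤ 1 →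
      (∀ x ∈ closure Ω, |φ x - ζ x| ≤ η) → ∃ V : ℂ → ℝ, ContDiffOn ℝ (⊤ : ℕ∞) V Ω ∧
        ∀ x ∈ Ω, |V x| ≤ C * η ∧ 2 * gradNormSq (fun y => φ y - ζ y) x ≤ lapR V x := by
  obtain ⟨P, C, _, _, _, _, c, hc, B, hB, HW⟩ := S.exists_aux
  obtain ⟨A, hA, HA⟩ := S.exists_basic
  have hδ := S.δpos
  obtain ⟨k, hk⟩ : ∃ k, k = 2 * A * (1 + δ₁) / c := ⟨_, rfl⟩
  have hk0 : 0 < k := by rw [hk]; positivity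
  have hkc : k * c = 2 * A * (1 + δ₁) := by rw [hk]; field_simp
  refine ⟨1 + k * B, by positivity, fun l u t φ h η hη hη1 hψ => ?_⟩
  obtain ⟨w, hw⟩ : ∃ w, w = fun y => Real.exp (C * (φ y + P (t y))) := ⟨_, rfl⟩
  obtain ⟨-, w2, w3, w4⟩ := HW l u t φ h
  have w0 : ∀ x, 0 ≤ w x := fun x => by rw [hw]; positivity
  rw [← hw] at w2 w4
  replace w3 : ∀ x ∈ closure Ω, w x ≤ B := by rw [hw]; exact w3
  refine ⟨fun y => (φ y - ζ y) ^ 2 + (η * k) * w y,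
    ((h.smooth_φ.sub S.smooth_ζ.contDiffOn).pow 2).add (contDiffOn_const.mul w2),
    fun x hx => ⟨?_, ?_⟩⟩
  · have h0 := w0 x
    have h1 := hψ x (subset_closure hx)
    have h2 : (φ x - ζ x) ^ 2 ≤ η * 1 := by
      rw [← sq_abs, sq]
      gcongr
      exact h1.trans hη1
    have h3 : η * k * w x ≤ η * k * B :=
      mul_le_mul_of_nonneg_left (w3 x (subset_closure hx)) (by positivity)
    rw [abs_of_nonneg (by positivity)]
    linarith
  · obtain ⟨c1, e1⟩ := h.lapR_phase_sub S hx
    have c3 : ContDiffAt ℝ 2 w x :=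
      (w2.contDiffAt (S.isOpen.mem_nhds hx)).of_le two_le_smooth
    have c4 : ContDiffAt ℝ 2 (fun y => (η * k) * w y) x := contDiffAt_const.mul c3
    rw [lapR_add (c1.pow 2) c4, lapR_sq c1, lapR_const_mul _ c3, e1]
    obtain ⟨a0, _, _, a3, _⟩ := HA l u t φ h x hx
    have hP := gradNormSq_nonneg φ x
    have hQ := gradNormSq_nonneg t x
    have hf : 0 ≤ l * forcing γ W u t φ x := mul_nonneg h.lpos.le a0
    have hR := abs_gradDot_le φ t x one_pos
    rw [inv_one, one_mul, one_mul] at hR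
    have ht := mul_le_mul_of_nonneg_right (h.le x (subset_closure hx)) hP
    have h0 := w4 x hx
    obtain ⟨X, hX⟩ : ∃ X, X = gradNormSq φ x + gradNormSq t x + l * forcing γ W u t φ x := ⟨_, rfl⟩
    have hX0 : 0 ≤ X := by rw [hX]; positivity
    have h1 : |lapR φ x| ≤ A * ((1 + δ₁) * X) := by
      refine a3.trans (mul_le_mul_of_nonneg_left ?_ hA.le)
      have p1 := mul_nonneg hδ.le hQ
      have p2 := mul_nonneg hδ.le hf
      rw [hX]
      linarith
    have h2 : |2 * (φ x - ζ x) * lapR φ x| ≤ 2 * η * (A * ((1 + δ₁) * X)) := by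
      rw [abs_mul, abs_mul, abs_two]
      gcongr
      exact hψ x (subset_closure hx)
    rw [← hX] at h0
    have h3 : η * k * (c * X) ≤ η * k * lapR w x := by gcongr
    have h4 : η * k * (c * X) = 2 * η * (A * ((1 + δ₁) * X)) := by
      linear_combination η * X * hkc
    linarith [(abs_le.1 h2).1]

/-- The quartic gradient energy of `φ - ζ` tends to zero. -/
theorem Setting.quartic_small (S : Setting γ L W Ω δ₁ m ζ) (N : NondegPotential γ W) {κ : ℝ}
    (hκ : 0 < κ) : ∃ Λ, ∀ l u t φ, DirSol γ W Ω δ₁ ζ l u t φ → Λ ≤ l →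
      ∫ x in Ω, ‖fderiv ℝ (fun w => φ w - ζ w) x‖ ^ 4 ≤ κ := by
  obtain ⟨G, hG, HG⟩ := S.exists_phase_grad_bound N
  obtain ⟨C, hC, HC⟩ := S.exists_square_aux
  have hΩm := S.isOpen.measurableSet
  have hvol : volume Ω ≠ ⊤ := S.bounded.measure_lt_top.ne
  obtain ⟨K, hKΩ, hK, hKv⟩ := hΩm.exists_isCompact_sdiff_lt hvol
    (ENNReal.ofReal_pos.2 (show 0 < κ / (2 * G ^ 2) by positivity)).ne'
  obtain ⟨χ, hχ, hχc, hχs, hχ0, hχ1⟩ := exists_cutoff S.isOpen hK hKΩ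
  have hJi : Integrable (lapR χ) := by
    have := (integral_mul_lapR S.isOpen (contDiffOn_const (c := (1 : ℝ))) hχ hχc hχs).2.1
    simpa using this
  obtain ⟨J, hJ⟩ : ∃ J, J = ∫ x, |lapR χ x| := ⟨_, rfl⟩
  have hJ0 : 0 ≤ J := by rw [hJ]; exact integral_nonneg fun x => abs_nonneg _
  obtain ⟨η, hη⟩ : ∃ η, η = min 1 (κ / (G * (C * (J + 1)))) := ⟨_, rfl⟩
  have hη0 : 0 < η := by rw [hη]; positivity
  have hη1 : η ≤ 1 := by rw [hη]; exact min_le_left _ _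
  have hη2 : G * (C * (J + 1)) * η ≤ κ := by
    have : η ≤ κ / (G * (C * (J + 1))) := by rw [hη]; exact min_le_right _ _
    rwa [le_div_iff₀' (by positivity)] at this
  obtain ⟨Λ, HΛ⟩ := S.phase_tendsto N hη0
  refine ⟨Λ, fun l u t φ h hl => ?_⟩
  obtain ⟨V, hV, HV⟩ := HC l u t φ h η hη0 hη1 (HΛ l u t φ h hl)
  obtain ⟨i1, i2, e⟩ := integral_mul_lapR S.isOpen hV hχ hχc hχs
  have hχout : ∀ x, x ∉ Ω → χ x = 0 := fun x hx => image_eq_zero_of_notMem_tsupport fun h => hx (hχs h)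
  have hlout : ∀ x, x ∉ Ω → lapR χ x = 0 := fun x hx => by
    have hn : x ∉ tsupport χ := fun h => hx (hχs h)
    have sub : ∀ e f, tsupport (fun y => fderiv ℝ f y e) ⊆ tsupport f := fun e (f : ℂ → ℝ) =>
      tsupport_fderiv_apply_subset ℝ e
    have z : ∀ e, fderiv ℝ (fun y => fderiv ℝ χ y e) x e = 0 := fun e =>
      image_eq_zero_of_notMem_tsupport (f := fun x => fderiv ℝ (fun y => fderiv ℝ χ y e) x e)
        fun h => hn (sub e χ (sub e _ h))
    rw [lapR, z, z, add_zero]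
  have h1 : ∫ x, lapR χ x * V x ≤ C * η * J := by
    rw [hJ, ← integral_const_mul]
    refine integral_mono i2 (hJi.abs.const_mul _) fun x => ?_
    by_cases hx : x ∈ Ω
    · calc lapR χ x * V x ≤ |lapR χ x * V x| := le_abs_self _
        _ = |V x| * |lapR χ x| := by rw [abs_mul, mul_comm]
        _ ≤ _ := mul_le_mul_of_nonneg_right (HV x hx).1 (abs_nonneg _)
    · simp [hlout x hx]
  have h2 : ∫ x in Ω, χ x * lapR V x ≤ C * η * J := by
    rw [setIntegral_eq_integral_of_forall_compl_eq_zero fun x hx => by rw [hχout x hx, zero_mul], e]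
    exact h1
  have hfin : volume (Ω \ K) ≠ ⊤ := (hKv.trans_le le_top).ne
  have hKr : volume.real (Ω \ K) ≤ κ / (2 * G ^ 2) := by
    rw [Measure.real]
    exact ENNReal.toReal_le_of_le_ofReal (by positivity) hKv.le
  have hmd : MeasurableSet (Ω \ K) := hΩm.diff hK.measurableSet
  have hind : Integrable ((Ω \ K).indicator fun _ => G ^ 2) (volume.restrict Ω) :=
    ((integrable_indicator_iff hmd).2 (integrableOn_const hfin)).restrict
  have h3 : ∫ x in Ω, ((Ω \ K).indicator fun _ => G ^ 2) x = volume.real (Ω \ K) * G ^ 2 := by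
    rw [setIntegral_indicator hmd, setIntegral_const, smul_eq_mul, inter_eq_right.2 sdiff_subset]
  have h4 : ∫ x in Ω, ‖fderiv ℝ (fun w => φ w - ζ w) x‖ ^ 4 ≤
      ∫ x in Ω, (G / 2 * (χ x * lapR V x) + ((Ω \ K).indicator fun _ => G ^ 2) x) := by
    refine integral_mono_of_nonneg (Eventually.of_forall fun x => by positivity)
      ((i1.restrict.const_mul _).add hind) ?_
    filter_upwards [ae_restrict_mem hΩm] with x hx
    have q1 := norm_fderiv_sq_le (fun w => φ w - ζ w) x
    have q2 := (HG l u t φ h x hx).2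
    have q3 := gradNormSq_nonneg (fun w => φ w - ζ w) x
    have q4 : ‖fderiv ℝ (fun w => φ w - ζ w) x‖ ^ 4 ≤ G * gradNormSq (fun w => φ w - ζ w) x := by
      calc _ = ‖fderiv ℝ (fun w => φ w - ζ w) x‖ ^ 2 * ‖fderiv ℝ (fun w => φ w - ζ w) x‖ ^ 2 := by
            ring
        _ ≤ _ := mul_le_mul (q1.trans q2) q1 (by positivity) hG.le
    have q5 := (HV x hx).2
    by_cases hxK : x ∈ K
    · rw [indicator_of_notMem (fun h => h.2 hxK), hχ1 x hxK]
      have := mul_le_mul_of_nonneg_left q5 hG.le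
      linarith
    · rw [indicator_of_mem (show x ∈ Ω \ K from ⟨hx, hxK⟩)]
      have p1 : 0 ≤ G / 2 * (χ x * lapR V x) := by
        have : 0 ≤ lapR V x := le_trans (by positivity) q5
        have := hχ0 x
        positivity
      have p2 := mul_le_mul_of_nonneg_left q2 hG.le
      nlinarith
  rw [integral_add (i1.restrict.const_mul _) hind, h3, integral_const_mul] at h4
  have h5 : G / 2 * ∫ x in Ω, χ x * lapR V x ≤ κ / 2 := by
    have h6 := mul_le_mul_of_nonneg_left h2 (half_pos hG).le
    have h7 : 0 < G * C * η := by positivity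
    nlinarith
  have h8 : volume.real (Ω \ K) * G ^ 2 ≤ κ / 2 := by
    calc _ ≤ κ / (2 * G ^ 2) * G ^ 2 := by gcongr
      _ = κ / 2 := by field_simp
  linarith

end Quartic

lemma Setting.quartic_bounded {γ : ℝ → ℂ} {L : ℝ} {W : ℂ → ℝ} {Ω : Set ℂ} {δ₁ m : ℝ} {ζ : ℂ → ℝ}
    (S : Setting γ L W Ω δ₁ m ζ) (N : NondegPotential γ W) :
    ∃ C, ∀ l u t φ, DirSol γ W Ω δ₁ ζ l u t φ →
      ∫ x in Ω, (|φ x| ^ 4 + ‖fderiv ℝ φ x‖ ^ 4) ≤ C := by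
  obtain ⟨G, hG, HG⟩ := S.exists_phase_grad_bound N
  obtain ⟨Z, hZ, HZ⟩ := S.exists_bound_of_continuous S.smooth_ζ.continuous
  refine ⟨(Z ^ 4 + G ^ 2) * volume.real Ω, fun l u t φ h => (Real.le_norm_self _).trans ?_⟩
  have hv : volume Ω < ⊤ := S.bounded.measure_lt_top
  refine norm_setIntegral_le_of_norm_le_const hv fun x hx => ?_
  have h1 := h.abs_phase_le S HZ (subset_closure hx)
  have h2 := (norm_fderiv_sq_le φ x).trans (HG l u t φ h x hx).1
  have h3 : ‖fderiv ℝ φ x‖ ^ 4 ≤ G ^ 2 := by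
    calc _ = (‖fderiv ℝ φ x‖ ^ 2) ^ 2 := by ring
      _ ≤ _ := by gcongr
  have h4 : |φ x| ^ 4 ≤ Z ^ 4 := by gcongr
  rw [Real.norm_eq_abs, abs_of_nonneg (by positivity)]
  linarith

/-- Lemma 3.7: for vortex-less solutions with degree-zero boundary datum,
the phases `φ_ε` (normalized so that `ψ_ε := φ_ε - ζ = 0` on `∂Ω`) are bounded in
`W^{1,4}(Ω)`; moreover `∫_Ω |∇ψ_ε|⁴ → 0` as `ε → 0`. -/
theorem phase_bounded_W14
    (Γ : Set ℂ) (τ : ℝ → ℂ) (W : ℂ → ℝ) (R₀ : ℝ)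
    (hΓ : ArcParam Γ τ) (hW : PotentialHyp Γ W R₀)
    (Ω : Set ℂ) (hΩo : IsOpen Ω) (hΩb : Bornology.IsBounded Ω) (hΩne : Ω.Nonempty)
    (hΩsc : SimplyConnectedSpace ↥Ω) (hΩsm : ∃ γ L, BoundaryParam Ω γ L)
    (δ₁ m : ℝ) (hδ₁ : 0 < δ₁) (hm : 0 < m) (hmax : MaxPrinciple Γ τ W δ₁ m)
    (g : ℂ → ℂ) (φ₀ : ℂ → ℝ) (hφ₀ : ContDiff ℝ (⊤ : ℕ∞) φ₀)
    (hgφ₀ : ∀ x ∈ frontier Ω, g x = τ (φ₀ x))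
    (ζ : ℂ → ℝ) (hζsm : ContDiff ℝ (⊤ : ℕ∞) ζ)
    (hζharm : ∀ x ∈ Ω, lapR ζ x = 0)
    (hζbd : ∀ x ∈ frontier Ω, ζ x = φ₀ x)
    (u : ℝ → ℂ → ℂ)
    (hu : ∀ ε > (0 : ℝ), SolvesGL W Ω ε (u ε) ∧
      (∀ x ∈ frontier Ω, u ε x = g x) ∧
      ∀ x ∈ Ω, Metric.infDist (u ε x) Γ ≤ δ₁)
    (t φ : ℝ → ℂ → ℝ)
    (hdec : ∀ ε > (0 : ℝ), PhaseDecomp Γ τ (closure Ω) (u ε) (t ε) (φ ε) ∧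
      ContDiffOn ℝ (⊤ : ℕ∞) (t ε) Ω ∧ ContDiffOn ℝ (⊤ : ℕ∞) (φ ε) Ω ∧
      ∀ x ∈ frontier Ω, φ ε x = ζ x) :
    (∃ C : ℝ, ∀ ε > (0 : ℝ),
        (∫ x in Ω, (|φ ε x| ^ 4 + ‖fderiv ℝ (φ ε) x‖ ^ 4)) ≤ C) ∧
    Tendsto (fun ε => ∫ x in Ω, ‖fderiv ℝ (fun w => φ ε w - ζ w) x‖ ^ 4)
      (𝓝[>] (0 : ℝ)) (𝓝 0) := by
  have hr : range τ = Γ := hΓ.srange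
  have S : Setting τ (2 * Real.pi) W Ω δ₁ m ζ :=
    ⟨hΓ.isLoop, hr ▸ hmax, hW.smooth, hδ₁, hm, hΩo, hΩb, hΩne, hΩsc,
      let ⟨σ, L', h⟩ := hΩsm; ⟨σ, L', h.isLoop, h.srange⟩, hζsm, hζharm⟩
  have N : NondegPotential τ W :=
    ⟨hW.nonneg, fun s => by
      have : τ s ∈ W ⁻¹' {0} := by rw [hW.zeros, ← hr]; exact mem_range_self s
      exact this, by rw [hr]; exact hW.nondeg⟩
  have D : ∀ ε > 0, DirSol τ W Ω δ₁ ζ ((ε ^ 2)⁻¹) (u ε) (t ε) (φ ε) := by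
    intro ε hε
    obtain ⟨⟨hus, hpde⟩, hbd, hle⟩ := hu ε hε
    obtain ⟨⟨hct, hcφ, hpol⟩, hts, hφs, hφζ⟩ := hdec ε hε
    refine ⟨⟨hΩo, hΩb, by positivity, hus, hts, hφs, hct, hcφ, fun x hx => (hpol x hx).1,
      fun x hx => by rw [hr]; exact (hpol x hx).2, fun x hx => ?_, hpde⟩, fun x hx => ?_, hφζ⟩
    · exact closure_minimal hle
        (isClosed_le ((continuous_infDist_pt Γ).comp hus.continuous) continuous_const) hx
        |> (hpol x hx).2.trans_le
    · have h1 := (hpol x (frontier_subset_closure hx)).2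
      have h2 : u ε x ∈ Γ := by
        rw [hbd x hx, hgφ₀ x hx, ← hr]
        exact mem_range_self _
      rw [infDist_zero_of_mem h2] at h1
      exact abs_eq_zero.1 h1
  refine ⟨?_, ?_⟩
  · obtain ⟨C, hC⟩ := S.quartic_bounded N
    exact ⟨C, fun ε hε => hC _ _ _ _ (D ε hε)⟩
  · have hl : Tendsto (fun ε : ℝ => (ε ^ 2)⁻¹) (𝓝[>] 0) atTop := by
      have h1 := (tendsto_pow_atTop (α := ℝ) two_ne_zero).comp tendsto_inv_nhdsGT_zero
      refine h1.congr fun ε => ?_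
      simp
    rw [Metric.tendsto_nhds]
    intro κ hκ
    obtain ⟨Λ, hΛ⟩ := S.quartic_small N (half_pos hκ)
    filter_upwards [self_mem_nhdsWithin, hl.eventually_ge_atTop Λ] with ε hε hle
    have h1 := hΛ _ _ _ _ (D ε hε) hle
    have h2 : 0 ≤ ∫ x in Ω, ‖fderiv ℝ (fun w => φ ε w - ζ w) x‖ ^ 4 :=
      integral_nonneg fun x => by positivity
    rw [Real.dist_eq, sub_zero, abs_of_nonneg h2]
    linarith
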